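/- Suppose T > 4√d·(2 + N⁻¹)^d/√μ. Then for every pair of discrete initial data (u⁰, u¹) ∈ P_N^{Di}(Ω)^d × P_N^{Di}(Ω)^d there exist controls f ∈ L²(0,T; P_N(Γ))^d and g_j ∈ L²(0,T; P_N(Γ_j))^d for j = 1,…,2d, and a function u ∈ C¹([0,T]; P_N(Ω)^d) with u_t absolutely continuous in t, such that: u_tt(t, P_i) − Δ*u(t, P_i) = Σ_{j=1}^{2d} G_j(t, P_i) for almost every t ∈ (0,T) and every interior node P_i; u(t, P_i) = f(t, P_i)·χ_Γ(P_i) for every boundary node P_i; u(0, P_i) = u⁰(P_i) and u_t(0, P_i) = u¹(P_i) for every interior node P_i; and u(T, P_i) = u_t(T, P_i) = 0 for every interior node P_i. Moreover there is a constant C > 0, depending only on d, T, λ and μ but not on N, such that the controls can be chosen with ∫₀^T ∫_Γ |f|² dγ dt + Σ_{j=1}^{2d} ∫₀^T ∫_{Γ_j} |g_j|² dγ dt ≤ C·( ‖u⁰‖²_{L²(Ω)} + ‖u¹‖²_{H^{−1}(Ω)} ), where ‖u¹‖_{H^{−1}(Ω)} = sup { ∫_Ω u¹·v dx : v ∈ C_c^∞(Ω)^d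 with ∫_Ω |∇v|² dx ≤ 1 }. -/

import Mathlib

open MeasureTheory Polynomial Finset
open scoped Classical

noncomputable section

/-- Points of `ℝ^d`. -/
abbrev Vec (d : ℕ) := Fin d → ℝ

/-- The open cube `Ω = (-1,1)^d`. -/
def cubeO (d : ℕ) : Set (Vec d) := Set.univ.pi fun _ => Set.Ioo (-1 : ℝ) 1

/-- The closed cube `cl(Ω) = [-1,1]^d`. -/
def cubeC (d : ℕ) : Set (Vec d) := Set.univ.pi fun _ => Set.Icc (-1 : ℝ) 1

/-- The boundary `∂Ω` of the cube. -/
def cubeB (d : ℕ) : Set (Vec d) := cubeC d \ cubeO d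

/-- The Legendre polynomial `L_N` via Rodrigues' formula. -/
def legendre (N : ℕ) : Polynomial ℝ :=
  C (1 / (2 ^ N * (N.factorial : ℝ))) * derivative^[N] ((X ^ 2 - 1) ^ N)

/-- `nd` is the increasing enumeration of the `N+1` Legendre–Gauss–Lobatto nodes,
which are exactly the roots of `(1 - x²) L_N'(x)`. -/
def IsLGL (N : ℕ) (nd : Fin (N + 1) → ℝ) : Prop :=
  StrictMono nd ∧ nd 0 = -1 ∧ nd (Fin.last N) = 1 ∧
    ∀ x : ℝ, (1 - x ^ 2) * (derivative (legendre N)).eval x = 0 ↔ ∃ k, nd k = x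

/-- `Ψ` is the family of Lagrange basis polynomials of degree `N` at the nodes `nd`. -/
def IsLagrange (N : ℕ) (nd : Fin (N + 1) → ℝ) (Ψ : Fin (N + 1) → Polynomial ℝ) : Prop :=
  ∀ k, (Ψ k).natDegree ≤ N ∧ ∀ m, (Ψ k).eval (nd m) = if m = k then 1 else 0

/-- The LGL quadrature weight `ω_k = ∫_{-1}^1 Ψ_k`. -/
def lglW (N : ℕ) (Ψ : Fin (N + 1) → Polynomial ℝ) (k : Fin (N + 1)) : ℝ :=
  ∫ x in (-1 : ℝ)..(1 : ℝ), (Ψ k).eval x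

/-- The tensor-product collocation node `P_i` associated with a multi-index. -/
def nodeP {N d : ℕ} (nd : Fin (N + 1) → ℝ) (k : Fin d → Fin (N + 1)) : Vec d :=
  fun j => nd (k j)

/-- `p : ℝ^d → ℝ` is (the function associated with) a polynomial of degree at most `N`
in each of the `d` variables, i.e. a member of `P_N(Ω)`. -/
def MemPolyN (d N : ℕ) (p : Vec d → ℝ) : Prop :=
  ∃ q : MvPolynomial (Fin d) ℝ, (∀ j, q.degreeOf j ≤ N) ∧ ∀ x, MvPolynomial.eval x q = p x

/-- Membership in `P_N^{Di}(Ω)`: a polynomial of degree `≤ N` in each variable vanishing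
on `∂Ω`. -/
def MemPolyDi (d N : ℕ) (p : Vec d → ℝ) : Prop :=
  MemPolyN d N p ∧ ∀ x ∈ cubeB d, p x = 0

/-- Partial derivative `∂f/∂x_j`. -/
def pd {d : ℕ} (j : Fin d) (f : Vec d → ℝ) (x : Vec d) : ℝ :=
  fderiv ℝ f x (Pi.single j 1)

/-- Divergence of a vector field. -/
def vdiv {d : ℕ} (v : Vec d → Fin d → ℝ) (x : Vec d) : ℝ :=
  ∑ j, pd j (fun y => v y j) x

/-- The elasticity operator `Δ* = μΔ + (λ+μ)∇div` acting on vector fields. -/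
def elast {d : ℕ} (lam mu : ℝ) (v : Vec d → Fin d → ℝ) (x : Vec d) (i : Fin d) : ℝ :=
  mu * ∑ j, pd j (pd j fun y => v y i) x + (lam + mu) * pd i (vdiv v) x

/-- Time derivative of a time-dependent vector field. -/
def tderiv {d : ℕ} (φ : ℝ → Vec d → Fin d → ℝ) : ℝ → Vec d → Fin d → ℝ :=
  fun t x i => deriv (fun s => φ s x i) t

/-- `φ` is a solution of the spectral collocation approximation of the elasticity system:
`φ ∈ C^∞([0,T]; P_N(Ω)^d)`, `φ_tt(t,P_i) = Δ*φ(t,P_i)` at interior collocation nodes and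
`φ(t,P_i) = 0` at boundary collocation nodes. -/
def IsColloc (d N : ℕ) (lam mu T : ℝ) (nd : Fin (N + 1) → ℝ)
    (φ : ℝ → Vec d → Fin d → ℝ) : Prop :=
  (∀ x i, ContDiff ℝ (⊤ : ℕ∞) fun t => φ t x i) ∧
  (∀ t ∈ Set.Icc (0 : ℝ) T, ∀ i, MemPolyN d N fun x => φ t x i) ∧
  (∀ t ∈ Set.Icc (0 : ℝ) T, ∀ k : Fin d → Fin (N + 1), nodeP nd k ∈ cubeO d →
    ∀ i, tderiv (tderiv φ) t (nodeP nd k) i = elast lam mu (φ t) (nodeP nd k) i) ∧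
  (∀ t ∈ Set.Icc (0 : ℝ) T, ∀ k : Fin d → Fin (N + 1), nodeP nd k ∈ cubeB d →
    ∀ i, φ t (nodeP nd k) i = 0)

/-- The discrete (LGL) inner product `(w,z)_N = Σ_i ω_i w(P_i) z(P_i)`. -/
def dInner (N d : ℕ) (nd : Fin (N + 1) → ℝ) (Ψ : Fin (N + 1) → Polynomial ℝ)
    (w z : Vec d → ℝ) : ℝ :=
  ∑ k : Fin d → Fin (N + 1), (∏ j, lglW N Ψ (k j)) * (w (nodeP nd k) * z (nodeP nd k))

/-- The discrete energy
`E(t) = ½(‖φ_t‖_N² + μ‖∇φ‖_N² + (λ+μ)‖div φ‖_N²)` of a collocation solution. -/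
def dEnergy (d N : ℕ) (lam mu : ℝ) (nd : Fin (N + 1) → ℝ) (Ψ : Fin (N + 1) → Polynomial ℝ)
    (φ : ℝ → Vec d → Fin d → ℝ) (t : ℝ) : ℝ :=
  (1 / 2) * ((∑ i, dInner N d nd Ψ (fun x => tderiv φ t x i) fun x => tderiv φ t x i) +
    mu * ∑ i, ∑ j, dInner N d nd Ψ (pd j fun y => φ t y i) (pd j fun y => φ t y i) +
    (lam + mu) * dInner N d nd Ψ (vdiv (φ t)) (vdiv (φ t)))

/-- Surface integral over the face `{x ∈ ∂Ω : x_j = c}` (with `c = ±1`) of the cube: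
the integrand does not depend on the `j`-th variable after the substitution, so the
integral over the full cube divided by `2` is exactly the `(d-1)`-dimensional integral. -/
def faceInt (d : ℕ) (j : Fin d) (c : ℝ) (f : Vec d → ℝ) : ℝ :=
  (1 / 2) * ∫ x in cubeC d, f (Function.update x j c)

/-- The `i`-th component of `μ ∂v/∂ν + (λ+μ) ν div v` on the face with outward normal
`ν = c·e_j`. -/
def obs1 {d : ℕ} (lam mu : ℝ) (v : Vec d → Fin d → ℝ) (j : Fin d) (c : ℝ) (x : Vec d)
    (i : Fin d) : ℝ :=
  mu * (c * pd j (fun y => v y i) x) +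
    (lam + mu) * (c * if i = j then 1 else 0) * vdiv v x

/-- The `i`-th component of `μ ∂²v/∂ν² + (λ+μ) ν ∂(div v)/∂ν` on the face with outward
normal `ν = c·e_j`. -/
def obs2 {d : ℕ} (lam mu : ℝ) (v : Vec d → Fin d → ℝ) (j : Fin d) (c : ℝ) (x : Vec d)
    (i : Fin d) : ℝ :=
  mu * (c * (c * pd j (pd j fun y => v y i) x)) +
    (lam + mu) * (c * if i = j then 1 else 0) * (c * pd j (vdiv v) x)

/-- Apply the matrix `A` to a grid function in the `k`-th coordinate. -/
def op {n : Type} [Fintype n] {d : ℕ} (k : Fin d) (A : Matrix n n ℝ) :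
    ((Fin d → n) → ℝ) →ₗ[ℝ] ((Fin d → n) → ℝ) where
  toFun u K := ∑ m, A (K k) m * u (Function.update K k m)
  map_add' u v := by
    funext K; simp [mul_add, Finset.sum_add_distrib]
  map_smul' c u := by
    funext K; simp only [Pi.smul_apply, smul_eq_mul, RingHom.id_apply, Finset.mul_sum]
    exact Finset.sum_congr rfl fun m _ => by ring

theorem op_apply {n : Type} [Fintype n] {d : ℕ} (k : Fin d) (A : Matrix n n ℝ)
    (u : (Fin d → n) → ℝ) (K : Fin d → n) :
    op k A u K = ∑ m, A (K k) m * u (Function.update K k m) := rfl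

theorem op_mul {n : Type} [Fintype n] {d : ℕ} (k : Fin d) (A B : Matrix n n ℝ)
    (u : (Fin d → n) → ℝ) : op k (A * B) u = op k A (op k B u) := by
  funext K
  simp only [op_apply, Matrix.mul_apply, Function.update_self, Function.update_idem,
    Finset.sum_mul, Finset.mul_sum]
  rw [Finset.sum_comm]
  exact Finset.sum_congr rfl fun m _ => Finset.sum_congr rfl fun l _ => by ring

theorem op_add {n : Type} [Fintype n] {d : ℕ} (k : Fin d) (A B : Matrix n n ℝ)
    (u : (Fin d → n) → ℝ) : op k (A + B) u = op k A u + op k B u := by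
  funext K
  simp [op_apply, add_mul, Finset.sum_add_distrib]

theorem op_sub {n : Type} [Fintype n] {d : ℕ} (k : Fin d) (A B : Matrix n n ℝ)
    (u : (Fin d → n) → ℝ) : op k (A - B) u = op k A u - op k B u := by
  funext K
  simp [op_apply, sub_mul, Finset.sum_sub_distrib]

theorem op_neg {n : Type} [Fintype n] {d : ℕ} (k : Fin d) (A : Matrix n n ℝ)
    (u : (Fin d → n) → ℝ) : op k (-A) u = -op k A u := by
  funext K
  simp [op_apply, Finset.sum_neg_distrib]

theorem op_smul {n : Type} [Fintype n] {d : ℕ} (k : Fin d) (c : ℝ) (A : Matrix n n ℝ)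
    (u : (Fin d → n) → ℝ) : op k (c • A) u = c • op k A u := by
  funext K
  simp [op_apply, Finset.mul_sum, mul_assoc]

theorem op_zero {n : Type} [Fintype n] {d : ℕ} (k : Fin d)
    (u : (Fin d → n) → ℝ) : op k (0 : Matrix n n ℝ) u = 0 := by
  funext K
  simp [op_apply]

theorem op_diagonal_apply {n : Type} [Fintype n] [DecidableEq n] {d : ℕ} (k : Fin d) (c : n → ℝ)
    (u : (Fin d → n) → ℝ) (K : Fin d → n) :
    op k (Matrix.diagonal c) u K = c (K k) * u K := by
  rw [op_apply, Finset.sum_eq_single (K k)]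
  · simp
  · intro m _ hm
    rw [Matrix.diagonal_apply_ne _ hm.symm, zero_mul]
  · simp

theorem op_one {n : Type} [Fintype n] [DecidableEq n] {d : ℕ} (k : Fin d)
    (u : (Fin d → n) → ℝ) : op k (1 : Matrix n n ℝ) u = u := by
  funext K
  rw [← Matrix.diagonal_one, op_diagonal_apply, one_mul]

theorem op_comm {n : Type} [Fintype n] {d : ℕ} {j k : Fin d} (hjk : j ≠ k) (A B : Matrix n n ℝ)
    (u : (Fin d → n) → ℝ) : op j A (op k B u) = op k B (op j A u) := by
  funext K
  simp only [op_apply, Function.update_of_ne hjk.symm, Function.update_of_ne hjk, Finset.mul_sum]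
  rw [Finset.sum_comm]
  refine Finset.sum_congr rfl fun m _ => Finset.sum_congr rfl fun l _ => ?_
  rw [Function.update_comm hjk]
  ring

/-- The tensor-product weighted inner product of grid functions. -/
def gip {n : Type} [Fintype n] (d : ℕ) (w : n → ℝ) :
    ((Fin d → n) → ℝ) →ₗ[ℝ] ((Fin d → n) → ℝ) →ₗ[ℝ] ℝ :=
  LinearMap.mk₂ ℝ (fun u v => ∑ K : Fin d → n, (∏ j, w (K j)) * (u K * v K))
    (fun u v z => by
      rw [← Finset.sum_add_distrib]
      exact Finset.sum_congr rfl fun K _ => by simp only [Pi.add_apply]; ring)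
    (fun c u v => by
      rw [smul_eq_mul, Finset.mul_sum]
      exact Finset.sum_congr rfl fun K _ => by simp only [Pi.smul_apply, smul_eq_mul]; ring)
    (fun u v z => by
      rw [← Finset.sum_add_distrib]
      exact Finset.sum_congr rfl fun K _ => by simp only [Pi.add_apply]; ring)
    (fun c u v => by
      rw [smul_eq_mul, Finset.mul_sum]
      exact Finset.sum_congr rfl fun K _ => by simp only [Pi.smul_apply, smul_eq_mul]; ring)

theorem gip_apply {n : Type} [Fintype n] (d : ℕ) (w : n → ℝ) (u v : (Fin d → n) → ℝ) :
    gip d w u v = ∑ K : Fin d → n, (∏ j, w (K j)) * (u K * v K) := rfl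

theorem gip_comm {n : Type} [Fintype n] (d : ℕ) (w : n → ℝ) (u v : (Fin d → n) → ℝ) :
    gip d w u v = gip d w v u := by
  simp only [gip_apply, mul_comm]

theorem gip_self_nonneg {n : Type} [Fintype n] {d : ℕ} {w : n → ℝ} (hw : ∀ i, 0 < w i)
    (u : (Fin d → n) → ℝ) : 0 ≤ gip d w u u :=
  Finset.sum_nonneg fun _ _ =>
    mul_nonneg (Finset.prod_nonneg fun _ _ => (hw _).le) (mul_self_nonneg _)

theorem gip_self_pos {n : Type} [Fintype n] {d : ℕ} {w : n → ℝ} (hw : ∀ i, 0 < w i)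
    {u : (Fin d → n) → ℝ} (hu : u ≠ 0) : 0 < gip d w u u := by
  obtain ⟨K, hK⟩ := Function.ne_iff.1 hu
  refine Finset.sum_pos' (fun _ _ =>
    mul_nonneg (Finset.prod_nonneg fun _ _ => (hw _).le) (mul_self_nonneg _))
    ⟨K, Finset.mem_univ _, mul_pos (Finset.prod_pos fun _ _ => hw _) ?_⟩
  exact mul_self_pos.2 hK

/-- The adjoint of a matrix with respect to the weights `w`. -/
def adj {n : Type} (w : n → ℝ) (A : Matrix n n ℝ) : Matrix n n ℝ :=
  fun m l => w l * A l m / w m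

theorem prod_update_mul {n : Type} {d : ℕ} (w : n → ℝ) (k : Fin d) (K : Fin d → n) (m : n) :
    (∏ j, w (Function.update K k m j)) * w (K k) = (∏ j, w (K j)) * w m := by
  rw [← Finset.mul_prod_erase Finset.univ _ (Finset.mem_univ k),
    ← Finset.mul_prod_erase Finset.univ (fun j => w (K j)) (Finset.mem_univ k)]
  have : ∏ j ∈ Finset.univ.erase k, w (Function.update K k m j)
      = ∏ j ∈ Finset.univ.erase k, w (K j) :=
    Finset.prod_congr rfl fun j hj => by
      rw [Function.update_of_ne (Finset.ne_of_mem_erase hj)]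
  rw [this, Function.update_self]
  ring

/-- The involution exchanging the `k`-th entry of a multi-index with an extra index. -/
def swapEntry {n : Type} {d : ℕ} (k : Fin d) : Equiv.Perm ((Fin d → n) × n) :=
  Function.Involutive.toPerm (fun p => (Function.update p.1 k p.2, p.1 k)) fun p => by
    simp

theorem gip_op_left {n : Type} [Fintype n] {d : ℕ} {w : n → ℝ} (hw : ∀ i, 0 < w i) (k : Fin d)
    (A : Matrix n n ℝ) (u v : (Fin d → n) → ℝ) :
    gip d w (op k A u) v = gip d w u (op k (adj w A) v) := by
  simp only [gip_apply, op_apply, Finset.sum_mul, Finset.mul_sum]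
  rw [← Fintype.sum_prod_type', ← Fintype.sum_prod_type']
  refine Fintype.sum_equiv (swapEntry k) _ _ fun p => ?_
  obtain ⟨K, m⟩ := p
  have h := prod_update_mul w k K m
  have hm := (hw m).ne'
  have hs : swapEntry k (K, m) = (Function.update K k m, K k) := rfl
  simp only [hs, Function.update_self, Function.update_idem, Function.update_eq_self, adj]
  field_simp
  linear_combination (-(A (K k) m * u (Function.update K k m) * v K)) * h

/-- The algebraic structure of one-dimensional Legendre–Gauss–Lobatto collocation: weights `w`,
nodes `s`, nodal values `L` of the Legendre polynomial, differentiation matrix `D`, and the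
two end points `a`, `b`. -/
structure LGLData (n : Type) [Fintype n] [DecidableEq n] where
  N : ℕ
  two_le : 2 ≤ N
  w : n → ℝ
  s : n → ℝ
  L : n → ℝ
  D : Matrix n n ℝ
  a : n
  b : n
  w_pos : ∀ i, 0 < w i
  a_ne_b : a ≠ b
  s_a : s a = -1
  s_b : s b = 1
  s_sq_le : ∀ i, s i ^ 2 ≤ 1
  L_a : L a ^ 2 = 1
  L_b : L b ^ 2 = 1
  w_a : w a * ((N : ℝ) * (N + 1) / 2) = 1
  w_b : w b * ((N : ℝ) * (N + 1) / 2) = 1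
  sum_L : ∑ i, w i * L i ^ 2 = 2 / N
  sum_L_D : ∀ l, ∑ m, w m * L m * D m l = 0
  sbp : ∀ m l, w m * D m l + w l * D l m =
    (if m = b ∧ l = b then 1 else 0) - (if m = a ∧ l = a then 1 else 0)
  commutator : ∀ m l, D m l * (1 + s l) - (1 + s m) * D m l =
    (if m = l then 1 else 0) - ((N : ℝ) * (N + 1) / 2) * (L m * L l * w l)

namespace LGLData

variable {n : Type} [Fintype n] [DecidableEq n] (S : LGLData n)

/-- The constant `N(N+1)/2`. -/
def th : ℝ := (S.N : ℝ) * (S.N + 1) / 2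

/-- Diagonal matrix concentrated at the node `c` with entry `1 / w c`. -/
def F (c : n) : Matrix n n ℝ := Matrix.diagonal fun m => if m = c then 1 / S.w c else 0

/-- Multiplication by `1 + x`. -/
def X : Matrix n n ℝ := Matrix.diagonal fun m => 1 + S.s m

/-- The rank one matrix attached to the Legendre polynomial. -/
def P : Matrix n n ℝ := fun m l => S.L m * S.L l * S.w l

/-- The symmetrised multiplier. -/
def M : Matrix n n ℝ := S.X * S.D + (1 / 2 : ℝ) • (1 : Matrix n n ℝ) - (S.th / 2) • S.P

/-- `c` is one of the two end points. -/
def IsEnd (c : n) : Prop := c = S.a ∨ c = S.b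

theorem two_le' : (2 : ℝ) ≤ S.N := by exact_mod_cast S.two_le

theorem N_pos : (0 : ℝ) < S.N := by linarith [S.two_le']

theorem th_pos : 0 < S.th := by
  have := S.N_pos
  unfold th; positivity

theorem w_end {c : n} (hc : S.IsEnd c) : S.w c = 1 / S.th := by
  have := S.th_pos
  rw [eq_div_iff this.ne']
  rcases hc with rfl | rfl
  · exact S.w_a
  · exact S.w_b

theorem w_end_le {c : n} (hc : S.IsEnd c) : S.w c ≤ 1 := by
  have := S.th_pos
  rw [S.w_end hc, div_le_one this]
  have := S.two_le'
  unfold th; nlinarith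

theorem L_end {c : n} (hc : S.IsEnd c) : S.L c ^ 2 = 1 := by
  rcases hc with rfl | rfl
  · exact S.L_a
  · exact S.L_b

theorem adj_D : adj S.w S.D = -S.D + S.F S.b - S.F S.a := by
  ext m l
  have hm := (S.w_pos m).ne'
  have h := S.sbp m l
  simp only [adj, F, Matrix.sub_apply, Matrix.add_apply, Matrix.neg_apply, Matrix.diagonal_apply]
  rw [div_eq_iff hm]
  have e1 : (if m = l then if m = S.b then 1 / S.w S.b else 0 else 0) * S.w m
      = (if m = S.b ∧ l = S.b then (1 : ℝ) else 0) := by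
    by_cases h1 : m = l
    · subst h1
      by_cases h2 : m = S.b
      · subst h2; simp [hm]
      · simp [h2]
    · rw [if_neg h1, if_neg (fun h => h1 (h.1.trans h.2.symm)), zero_mul]
  have e2 : (if m = l then if m = S.a then 1 / S.w S.a else 0 else 0) * S.w m
      = (if m = S.a ∧ l = S.a then (1 : ℝ) else 0) := by
    by_cases h1 : m = l
    · subst h1
      by_cases h2 : m = S.a
      · subst h2; simp [hm]
      · simp [h2]
    · rw [if_neg h1, if_neg (fun h => h1 (h.1.trans h.2.symm)), zero_mul]
  linear_combination h - e1 + e2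

theorem adj_diagonal (c : n → ℝ) : adj S.w (Matrix.diagonal c) = Matrix.diagonal c := by
  ext m l
  have hm := (S.w_pos m).ne'
  simp only [adj, Matrix.diagonal_apply]
  by_cases h : l = m
  · subst h; simp [hm]
  · simp [h, Ne.symm h]

theorem adj_P : adj S.w S.P = S.P := by
  ext m l
  have hm := (S.w_pos m).ne'
  simp only [adj, P]
  field_simp

theorem P_mul_D : S.P * S.D = 0 := by
  ext m l
  have h := S.sum_L_D l
  simp only [Matrix.mul_apply, P, Matrix.zero_apply]
  have : ∀ j, S.L m * S.L j * S.w j * S.D j l = S.L m * (S.w j * S.L j * S.D j l) :=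
    fun j => by ring
  simp only [this, ← Finset.mul_sum, h, mul_zero]

theorem P_mul_P : S.P * S.P = (2 / (S.N : ℝ)) • S.P := by
  ext m l
  simp only [Matrix.mul_apply, P, Matrix.smul_apply, smul_eq_mul]
  have : ∀ j, S.L m * S.L j * S.w j * (S.L j * S.L l * S.w l)
      = (S.w j * S.L j ^ 2) * (S.L m * S.L l * S.w l) := fun j => by ring
  simp only [this, ← Finset.sum_mul, S.sum_L]

theorem P_mul_F_mul_P {c : n} (hc : S.IsEnd c) : S.P * (S.F c * S.P) = S.P := by
  ext m l
  have h := S.L_end hc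
  have hw := (S.w_pos c).ne'
  rw [Matrix.mul_apply]
  simp only [F, Matrix.diagonal_mul, P]
  rw [Finset.sum_eq_single c]
  · rw [if_pos rfl]; field_simp; linear_combination (S.L m * S.L l * S.w l) * h
  · intro j _ hj; rw [if_neg hj]; ring
  · simp

theorem D_mul_X : S.D * S.X = S.X * S.D + 1 - S.th • S.P := by
  ext m l
  have h := S.commutator m l
  simp only [X, Matrix.mul_diagonal, Matrix.sub_apply, Matrix.add_apply, Matrix.diagonal_mul,
    Matrix.one_apply, Matrix.smul_apply, smul_eq_mul, P, th]
  linear_combination h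

/-- The grid function `u` vanishes at the end points in direction `k`. -/
def Van {d : ℕ} (k : Fin d) (u : (Fin d → n) → ℝ) : Prop := ∀ K, S.IsEnd (K k) → u K = 0

variable {S} {d : ℕ}

theorem Van.add {k : Fin d} {u v : (Fin d → n) → ℝ} (hu : S.Van k u) (hv : S.Van k v) :
    S.Van k (u + v) := fun K hK => by simp [hu K hK, hv K hK]

theorem Van.smul {k : Fin d} {u : (Fin d → n) → ℝ} (hu : S.Van k u) (c : ℝ) :
    S.Van k (c • u) := fun K hK => by simp [hu K hK]

theorem Van.sum {k : Fin d} {ι : Type*} {t : Finset ι} {u : ι → (Fin d → n) → ℝ}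
    (hu : ∀ i ∈ t, S.Van k (u i)) : S.Van k (∑ i ∈ t, u i) := fun K hK => by
  rw [Finset.sum_apply]
  exact Finset.sum_eq_zero fun i hi => hu i hi K hK

theorem Van.op {k j : Fin d} (hjk : j ≠ k) {u : (Fin d → n) → ℝ} (hu : S.Van k u)
    (A : Matrix n n ℝ) : S.Van k (op j A u) := fun K hK => by
  rw [op_apply]
  refine Finset.sum_eq_zero fun m _ => ?_
  rw [hu, mul_zero]
  rwa [Function.update_of_ne hjk.symm]

theorem op_F_of_van {k : Fin d} {c : n} (hc : S.IsEnd c) {u : (Fin d → n) → ℝ}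
    (hu : S.Van k u) : op k (S.F c) u = 0 := by
  funext K
  rw [F, op_diagonal_apply]
  by_cases h : K k = c
  · rw [hu K (h ▸ hc), mul_zero, Pi.zero_apply]
  · simp [h]

variable (S)

/-- The weighted inner product on the `d`-dimensional grid. -/
abbrev ip : ((Fin d → n) → ℝ) →ₗ[ℝ] ((Fin d → n) → ℝ) →ₗ[ℝ] ℝ := gip d S.w

/-- The face inner product on the face `x_k = c`. -/
def fip (k : Fin d) (c : n) : ((Fin d → n) → ℝ) →ₗ[ℝ] ((Fin d → n) → ℝ) →ₗ[ℝ] ℝ :=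
  (gip d S.w).comp (op k (S.F c))

theorem fip_def (k : Fin d) (c : n) (u v : (Fin d → n) → ℝ) :
    S.fip k c u v = S.ip (op k (S.F c) u) v := rfl

theorem isEnd_a : S.IsEnd S.a := Or.inl rfl

theorem isEnd_b : S.IsEnd S.b := Or.inr rfl

theorem ip_X_left (k : Fin d) (u v : (Fin d → n) → ℝ) :
    S.ip (op k S.X u) v = S.ip u (op k S.X v) := by
  rw [gip_op_left S.w_pos, X, adj_diagonal]

theorem ip_P_left (k : Fin d) (u v : (Fin d → n) → ℝ) :
    S.ip (op k S.P u) v = S.ip u (op k S.P v) := by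
  rw [gip_op_left S.w_pos, adj_P]

theorem fip_right (k : Fin d) (c : n) (u v : (Fin d → n) → ℝ) :
    S.fip k c u v = S.ip u (op k (S.F c) v) := by
  rw [fip_def, gip_op_left S.w_pos, F, adj_diagonal]

theorem fip_comm (k : Fin d) (c : n) (u v : (Fin d → n) → ℝ) :
    S.fip k c u v = S.fip k c v u := by
  rw [fip_right, gip_comm, fip_def]

theorem fip_apply (k : Fin d) (c : n) (u v : (Fin d → n) → ℝ) :
    S.fip k c u v = ∑ K : Fin d → n, (∏ j, S.w (K j)) *
      ((if K k = c then 1 / S.w c else 0) * (u K * v K)) := by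
  rw [fip_def, gip_apply]
  refine Finset.sum_congr rfl fun K _ => ?_
  rw [F, op_diagonal_apply]; ring

theorem fip_self_nonneg (k : Fin d) (c : n) (u : (Fin d → n) → ℝ) : 0 ≤ S.fip k c u u := by
  rw [fip_apply]
  refine Finset.sum_nonneg fun K _ => mul_nonneg
    (Finset.prod_nonneg fun _ _ => (S.w_pos _).le) (mul_nonneg ?_ (mul_self_nonneg _))
  split_ifs
  · exact one_div_nonneg.2 (S.w_pos c).le
  · exact le_rfl

theorem ip_D_left (k : Fin d) (u v : (Fin d → n) → ℝ) :
    S.ip (op k S.D u) v = -S.ip u (op k S.D v) + S.fip k S.b u v - S.fip k S.a u v := by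
  rw [gip_op_left S.w_pos, adj_D, op_sub, op_add, op_neg, map_sub, map_add, map_neg,
    fip_right, fip_right]

theorem ip_D_left_of_van {k : Fin d} (u : (Fin d → n) → ℝ) {v : (Fin d → n) → ℝ}
    (hv : S.Van k v) : S.ip (op k S.D u) v = -S.ip u (op k S.D v) := by
  rw [ip_D_left, fip_right, fip_right, op_F_of_van S.isEnd_a hv, op_F_of_van S.isEnd_b hv,
    map_zero]
  ring

theorem op_D_X (k : Fin d) (u : (Fin d → n) → ℝ) :
    op k S.D (op k S.X u) = op k S.X (op k S.D u) + u - S.th • op k S.P u := by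
  rw [← op_mul, D_mul_X, op_sub, op_add, op_one, op_smul, op_mul]

theorem op_M (k : Fin d) (u : (Fin d → n) → ℝ) :
    op k S.M u = op k S.X (op k S.D u) + (1 / 2 : ℝ) • u - (S.th / 2) • op k S.P u := by
  rw [M, op_sub, op_add, op_smul, op_smul, op_one, op_mul]

theorem op_P_D (k : Fin d) (u : (Fin d → n) → ℝ) : op k S.P (op k S.D u) = 0 := by
  rw [← op_mul, P_mul_D, op_zero]

theorem ip_D_P (k : Fin d) (u v : (Fin d → n) → ℝ) :
    S.ip (op k S.D u) (op k S.P v) = 0 := by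
  rw [← ip_P_left, op_P_D, map_zero, LinearMap.zero_apply]

theorem ip_skew_D {k : Fin d} {u v : (Fin d → n) → ℝ} (_ : S.Van k u) (hv : S.Van k v) :
    S.ip u (op k S.D v) = -S.ip (op k S.D u) v := by
  rw [ip_D_left_of_van S u hv, neg_neg]

theorem ip_skew_M {k : Fin d} {u v : (Fin d → n) → ℝ} (hv : S.Van k v) :
    S.ip u (op k S.M v) = -S.ip (op k S.M u) v := by
  have h1 := S.ip_D_left_of_van (k := k) (op k S.X u) hv
  rw [op_D_X, map_sub, map_add, map_smul, LinearMap.sub_apply, LinearMap.add_apply,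
    LinearMap.smul_apply, S.ip_X_left k u] at h1
  simp only [op_M, map_sub, map_add, map_smul, LinearMap.sub_apply, LinearMap.add_apply,
    LinearMap.smul_apply, smul_eq_mul] at h1 ⊢
  rw [ip_P_left] at h1 ⊢
  linarith

theorem fip_X_b (k : Fin d) (u v : (Fin d → n) → ℝ) :
    S.fip k S.b u (op k S.X v) = 2 * S.fip k S.b u v := by
  rw [fip_apply, fip_apply, Finset.mul_sum]
  refine Finset.sum_congr rfl fun K _ => ?_
  rw [X, op_diagonal_apply]
  split_ifs with h
  · rw [h, S.s_b]; ring
  · ring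

theorem fip_X_a (k : Fin d) (u v : (Fin d → n) → ℝ) :
    S.fip k S.a u (op k S.X v) = 0 := by
  rw [fip_apply]
  refine Finset.sum_eq_zero fun K _ => ?_
  rw [X, op_diagonal_apply]
  split_ifs with h
  · rw [h, S.s_a]; ring
  · ring

theorem ip_DD_M {k : Fin d} {u : (Fin d → n) → ℝ} (hu : S.Van k u) :
    S.ip (op k S.D (op k S.D u)) (op k S.M u) =
      S.fip k S.b (op k S.D u) (op k S.D u) - S.ip (op k S.D u) (op k S.D u) := by
  set p := op k S.D u with hp
  have h1 : S.ip (op k S.D p) (op k S.X p) = -S.ip p (op k S.D (op k S.X p)) +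
      S.fip k S.b p (op k S.X p) - S.fip k S.a p (op k S.X p) := S.ip_D_left k p _
  have h2 := S.ip_D_left_of_van (k := k) p hu
  have h3 := S.ip_D_P k p u
  have h4 : op k S.P p = 0 := S.op_P_D k u
  have h5 := S.ip_X_left k p (op k S.D p)
  have h6 := gip_comm d S.w (op k S.X p) (op k S.D p)
  rw [fip_X_a, fip_X_b, op_D_X, h4] at h1
  rw [op_M]
  simp only [map_sub, map_add, map_smul, smul_eq_mul, ← hp, smul_zero, sub_zero] at h1 ⊢
  simp only [ip] at *
  rw [h3]
  linarith

theorem ip_D_M_sub {k : Fin d} {z v : (Fin d → n) → ℝ} (hz : S.Van k z) :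
    S.ip (op k S.D z) (op k S.M v) - S.ip (op k S.D v) (op k S.M z) =
      S.ip (op k S.D z) v := by
  have h1 := S.ip_D_P k z v
  have h2 := S.ip_D_P k v z
  have h3 := S.ip_X_left k (op k S.D z) (op k S.D v)
  have h4 := gip_comm d S.w (op k S.X (op k S.D z)) (op k S.D v)
  have h5 := S.ip_D_left_of_van (k := k) v hz
  have h6 := gip_comm d S.w (op k S.D z) v
  simp only [op_M, map_sub, map_add, map_smul, smul_eq_mul]
  simp only [ip] at *
  rw [h1, h2]
  linarith

theorem ip_DD_D (k : Fin d) (u : (Fin d → n) → ℝ) :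
    S.ip (op k S.D (op k S.D u)) (op k S.D u) =
      (S.fip k S.b (op k S.D u) (op k S.D u) - S.fip k S.a (op k S.D u) (op k S.D u)) / 2 := by
  have h1 := S.ip_D_left k (op k S.D u) (op k S.D u)
  have h2 := gip_comm d S.w (op k S.D u) (op k S.D (op k S.D u))
  simp only [ip] at *
  linarith

theorem ip_young (u v : (Fin d → n) → ℝ) {t : ℝ} (ht : 0 < t) :
    S.ip u v ≤ t / 2 * S.ip u u + 1 / (2 * t) * S.ip v v := by
  have h := gip_self_nonneg S.w_pos (t • u - v)
  have h2 := gip_comm d S.w u v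
  simp only [map_sub, map_smul, LinearMap.sub_apply, LinearMap.smul_apply, smul_eq_mul] at h
  simp only [ip] at *
  rw [← h2] at h
  have : gip d S.w u v = (1 / (2 * t)) * (2 * t * gip d S.w u v) := by field_simp
  rw [this]
  have e : t / 2 * gip d S.w u u = (1 / (2 * t)) * (t * t * gip d S.w u u) := by field_simp
  rw [e, ← mul_add]
  exact mul_le_mul_of_nonneg_left (by linarith) (by positivity)

theorem fip_young (k : Fin d) (c : n) (u v : (Fin d → n) → ℝ) {t : ℝ} (ht : 0 < t) :
    S.fip k c u v ≤ t / 2 * S.fip k c u u + 1 / (2 * t) * S.fip k c v v := by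
  have h := S.fip_self_nonneg k c (t • u - v)
  have h2 := S.fip_comm k c u v
  simp only [map_sub, map_smul, LinearMap.sub_apply, LinearMap.smul_apply,
    smul_eq_mul] at h
  rw [← h2] at h
  generalize S.fip k c u v = A at *
  generalize S.fip k c u u = B at *
  generalize S.fip k c v v = Z at *
  have : A = (1 / (2 * t)) * (2 * t * A) := by field_simp
  rw [this]
  have e : t / 2 * B = (1 / (2 * t)) * (t * t * B) := by field_simp
  rw [e, ← mul_add]
  exact mul_le_mul_of_nonneg_left (by linarith) (by positivity)

theorem fip_P {c : n} (hc : S.IsEnd c) (k : Fin d) (u : (Fin d → n) → ℝ) :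
    S.fip k c (op k S.P u) (op k S.P u) = S.ip u (op k S.P u) := by
  rw [fip_def, gip_comm, ip_P_left, ← op_mul, ← op_mul, Matrix.mul_assoc, P_mul_F_mul_P S hc]

theorem ip_P_P (k : Fin d) (u : (Fin d → n) → ℝ) :
    S.ip (op k S.P u) (op k S.P u) = 2 / S.N * S.ip u (op k S.P u) := by
  rw [ip_P_left, ← op_mul, P_mul_P, op_smul, map_smul, smul_eq_mul]

theorem ip_P_le (k : Fin d) (u : (Fin d → n) → ℝ) :
    S.ip u (op k S.P u) ≤ 2 / S.N * S.ip u u := by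
  have h := gip_self_nonneg S.w_pos (op k S.P u - (2 / (S.N : ℝ)) • u)
  have h2 := S.ip_P_P k u
  have h3 := gip_comm d S.w (op k S.P u) u
  have hN := S.N_pos
  simp only [map_sub, map_smul, LinearMap.sub_apply, LinearMap.smul_apply, smul_eq_mul] at h
  simp only [ip] at *
  rw [h3, h2] at h
  have : 0 ≤ 2 / (S.N : ℝ) * (2 / (S.N : ℝ) * gip d S.w u u - gip d S.w u (op k S.P u)) := by
    linarith
  have := nonneg_of_mul_nonneg_right this (by positivity)
  linarith

theorem ip_diag_le (k : Fin d) (c : n → ℝ) {B : ℝ} (hB : ∀ i, c i ^ 2 ≤ B)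
    (u : (Fin d → n) → ℝ) :
    S.ip (op k (Matrix.diagonal c) u) (op k (Matrix.diagonal c) u) ≤ B * S.ip u u := by
  simp only [ip, gip_apply, op_diagonal_apply, Finset.mul_sum]
  refine Finset.sum_le_sum fun K _ => ?_
  have h1 : 0 ≤ ∏ j, S.w (K j) := Finset.prod_nonneg fun _ _ => (S.w_pos _).le
  have h2 := hB (K k)
  have h3 : 0 ≤ (∏ j, S.w (K j)) * u K ^ 2 := by positivity
  nlinarith

theorem op_P_X_D (k : Fin d) (u : (Fin d → n) → ℝ) :
    op k S.P (op k (Matrix.diagonal S.s) (op k S.D u)) = (S.N : ℝ) • op k S.P u := by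
  have hX : Matrix.diagonal S.s = S.X - 1 := by
    rw [X, ← Matrix.diagonal_one, Matrix.diagonal_sub]
    congr 1; funext i; ring
  have h := congrArg (op k S.P) (S.op_D_X k u)
  have hN := S.N_pos
  rw [op_P_D, map_sub, map_add, map_smul, ← op_mul k S.P S.P, P_mul_P, op_smul] at h
  rw [hX, op_sub, op_one, map_sub, op_P_D, sub_zero]
  have e : S.th * (2 / (S.N : ℝ)) = S.N + 1 := by
    unfold th; field_simp
  rw [smul_smul, e, add_smul, one_smul] at h
  have h' : op k S.P (op k S.X (op k S.D u)) =
    ((S.N : ℝ) • op k S.P u + op k S.P u) - op k S.P u +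
     (op k S.P (op k S.X (op k S.D u)) + op k S.P u - ((S.N : ℝ) • op k S.P u + op k S.P u)) := by
    abel
  rw [← h] at h'
  rw [h']; abel

theorem ip_P_le_D (k : Fin d) (u : (Fin d → n) → ℝ) :
    S.ip u (op k S.P u) ≤ 2 / (S.N : ℝ) ^ 3 * S.ip (op k S.D u) (op k S.D u) := by
  have hN := S.N_pos
  set z := op k (Matrix.diagonal S.s) (op k S.D u) with hz
  have h1 := S.ip_P_P k z
  rw [hz, op_P_X_D, ← hz] at h1
  have h2 := S.ip_P_P k u
  have h3 : S.ip z ((S.N : ℝ) • op k S.P u) = S.ip z (op k S.P z) := by rw [hz, op_P_X_D]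
  rw [h3] at h1
  simp only [map_smul, LinearMap.smul_apply, smul_eq_mul] at h1
  have h4 := S.ip_P_le k z
  have h5 : S.ip z z ≤ 1 * _ := S.ip_diag_le k S.s S.s_sq_le (op k S.D u)
  simp only [ip] at *
  rw [h2] at h1
  generalize gip d S.w u (op k S.P u) = A at *
  generalize gip d S.w z (op k S.P z) = B at *
  generalize gip d S.w z z = Z at *
  generalize gip d S.w (op k S.D u) (op k S.D u) = Y at *
  have e1 : B = (S.N : ℝ) ^ 2 * A := by
    field_simp at h1; linarith
  have e2 : B ≤ 2 / S.N * Y := h4.trans (by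
    rw [one_mul] at h5
    exact mul_le_mul_of_nonneg_left h5 (by positivity))
  rw [e1, div_mul_eq_mul_div, le_div_iff₀ hN] at e2
  rw [div_mul_eq_mul_div, le_div_iff₀ (by positivity)]
  calc A * (S.N : ℝ) ^ 3 = (S.N : ℝ) ^ 2 * A * S.N := by ring
    _ ≤ _ := e2

theorem th_ip_P_le_D (k : Fin d) (u : (Fin d → n) → ℝ) :
    S.th * S.ip u (op k S.P u) ≤ 3 / 4 * S.ip (op k S.D u) (op k S.D u) := by
  have hN := S.two_le'
  have h := mul_le_mul_of_nonneg_left (S.ip_P_le_D k u) S.th_pos.le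
  refine h.trans ?_
  have hY := gip_self_nonneg S.w_pos (op k S.D u)
  rw [← mul_assoc]
  refine mul_le_mul_of_nonneg_right ?_ hY
  have : S.th * (2 / (S.N : ℝ) ^ 3) = (S.N + 1) / (S.N : ℝ) ^ 2 := by
    unfold th; field_simp
  rw [this, div_le_iff₀ (by positivity)]
  nlinarith

theorem poincare {k : Fin d} {u : (Fin d → n) → ℝ} (hu : S.Van k u) :
    S.ip u u ≤ 11 / 2 * S.ip (op k S.D u) (op k S.D u) := by
  have h1 := S.ip_skew_M (u := u) hu
  rw [gip_comm d S.w (op k S.M u)] at h1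
  rw [op_M] at h1
  have h2 := S.ip_skew_D hu hu
  rw [gip_comm d S.w (op k S.D u)] at h2
  have hX : Matrix.diagonal S.s = S.X - 1 := by
    rw [X, ← Matrix.diagonal_one, Matrix.diagonal_sub]
    congr 1; funext i; ring
  set z := op k (Matrix.diagonal S.s) (op k S.D u) with hz
  have h5 : S.ip z z ≤ 1 * _ := S.ip_diag_le k S.s S.s_sq_le (op k S.D u)
  have h3 : op k S.X (op k S.D u) = z + op k S.D u := by
    rw [hz, hX, op_sub, op_one]; abel
  have h6 := S.ip_young (-u) z (t := 1 / 2) (by norm_num)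
  have h7 := S.th_ip_P_le_D k u
  rw [h3] at h1
  simp only [map_sub, map_add, map_smul, smul_eq_mul, map_neg, LinearMap.neg_apply] at h1 h6
  simp only [ip] at *
  norm_num at h6
  linarith

theorem ip_M_aux {k : Fin d} {u : (Fin d → n) → ℝ} (hu : S.Van k u) {c : ℝ} (hc : 0 ≤ c)
    (hc' : c ≤ 1 / 2) :
    S.ip (op k S.M u - c • u) (op k S.M u - c • u) ≤ 18 * S.ip (op k S.D u) (op k S.D u) := by
  have h1 : S.ip (op k S.X (op k S.D u)) (op k S.X (op k S.D u)) ≤ _ :=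
    S.ip_diag_le k (fun i => 1 + S.s i) (B := 4) (fun i => by
      have := S.s_sq_le i; nlinarith [sq_nonneg (S.s i - 1)]) (op k S.D u)
  have h2 := S.poincare hu
  have h3 := S.ip_P_P k u
  have h4 := S.ip_P_le_D k u
  have hN := S.two_le'
  have hY := gip_self_nonneg S.w_pos (op k S.D u)
  have hU := gip_self_nonneg S.w_pos u
  have h5 : (S.th / 2) ^ 2 * S.ip (op k S.P u) (op k S.P u) ≤
      9 / 16 * S.ip (op k S.D u) (op k S.D u) := by
    rw [h3]
    have : (S.th / 2) ^ 2 * (2 / (S.N : ℝ) * (2 / (S.N : ℝ) ^ 3)) ≤ 9 / 16 := by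
      have : (S.th / 2) ^ 2 * (2 / (S.N : ℝ) * (2 / (S.N : ℝ) ^ 3)) =
          (S.N + 1) ^ 2 / (4 * (S.N : ℝ) ^ 2) := by
        unfold th; field_simp; norm_num
      rw [this, div_le_iff₀ (by positivity)]
      nlinarith
    calc _ ≤ (S.th / 2) ^ 2 * (2 / S.N * (2 / (S.N : ℝ) ^ 3 *
          S.ip (op k S.D u) (op k S.D u))) := by gcongr
      _ = (S.th / 2) ^ 2 * (2 / (S.N : ℝ) * (2 / (S.N : ℝ) ^ 3)) *
          S.ip (op k S.D u) (op k S.D u) := by ring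
      _ ≤ _ := mul_le_mul_of_nonneg_right this hY
  have h6 : (1 / 2 - c) ^ 2 * S.ip u u ≤ 11 / 8 * S.ip (op k S.D u) (op k S.D u) := by
    have : (1 / 2 - c) ^ 2 ≤ 1 / 4 := by nlinarith
    calc _ ≤ 1 / 4 * S.ip u u := mul_le_mul_of_nonneg_right this hU
      _ ≤ _ := by linarith
  have e : op k S.M u - c • u = op k S.X (op k S.D u) + (1 / 2 - c) • u -
      (S.th / 2) • op k S.P u := by rw [op_M]; module
  rw [e]
  set x := op k S.X (op k S.D u)
  set y := (1 / 2 - c) • u with hy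
  set z := (S.th / 2) • op k S.P u with hz
  have ey : S.ip y y = (1 / 2 - c) ^ 2 * S.ip u u := by
    simp only [hy, ip, map_smul, LinearMap.smul_apply, smul_eq_mul]; ring
  have ez : S.ip z z = (S.th / 2) ^ 2 * S.ip (op k S.P u) (op k S.P u) := by
    simp only [hz, ip, map_smul, LinearMap.smul_apply, smul_eq_mul]; ring
  rw [← ey] at h6
  rw [← ez] at h5
  have y1 := S.ip_young x y (t := 1) one_pos
  have y2 := S.ip_young (-x) z (t := 1) one_pos
  have y3 := S.ip_young (-y) z (t := 1) one_pos
  have c1 := gip_comm d S.w x y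
  have c2 := gip_comm d S.w x z
  have c3 := gip_comm d S.w y z
  simp only [map_sub, map_add, map_neg, LinearMap.neg_apply, LinearMap.sub_apply,
    LinearMap.add_apply] at y2 y3 ⊢
  simp only [ip] at *
  norm_num at y1 y2 y3
  linarith

end LGLData

namespace LGLData

variable {n : Type} [Fintype n] [DecidableEq n] (S : LGLData n) {d : ℕ}

/-- Discrete divergence of a grid vector field. -/
def dv (φ : Fin d → (Fin d → n) → ℝ) : (Fin d → n) → ℝ := ∑ j, op j S.D (φ j)

/-- Discrete elasticity operator on grid vector fields. -/
def el (lam mu : ℝ) (φ : Fin d → (Fin d → n) → ℝ) (i : Fin d) : (Fin d → n) → ℝ :=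
  mu • ∑ j, op j S.D (op j S.D (φ i)) + (lam + mu) • op i S.D (S.dv φ)

/-- Dirichlet grid fields. -/
def Di (φ : Fin d → (Fin d → n) → ℝ) : Prop := ∀ i k, S.Van k (φ i)

/-- Fields vanishing at the end points in all directions other than `k`. -/
def Tan (k : Fin d) (ζ : Fin d → (Fin d → n) → ℝ) : Prop := ∀ i j, j ≠ k → S.Van j (ζ i)

/-- The sum of the directional derivatives other than the `k`-th one. -/
def dvErase (k : Fin d) (φ : Fin d → (Fin d → n) → ℝ) : (Fin d → n) → ℝ :=
  ∑ j ∈ Finset.univ.erase k, op j S.D (φ j)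

/-- Interior restriction. -/
def inn : ((Fin d → n) → ℝ) →ₗ[ℝ] ((Fin d → n) → ℝ) where
  toFun u K := if ∀ j, ¬ S.IsEnd (K j) then u K else 0
  map_add' u v := by funext K; dsimp only [Pi.add_apply]; split_ifs <;> simp
  map_smul' c u := by
    funext K; dsimp only [Pi.smul_apply, RingHom.id_apply, smul_eq_mul]; split_ifs <;> simp

theorem inn_apply (u : (Fin d → n) → ℝ) (K : Fin d → n) :
    S.inn u K = if ∀ j, ¬ S.IsEnd (K j) then u K else 0 := rfl

/-- Restriction to multi-indices that are interior in all directions other than `k`. -/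
def tmask (k : Fin d) : ((Fin d → n) → ℝ) →ₗ[ℝ] ((Fin d → n) → ℝ) where
  toFun u K := if ∀ j, j ≠ k → ¬ S.IsEnd (K j) then u K else 0
  map_add' u v := by funext K; dsimp only [Pi.add_apply]; split_ifs <;> simp
  map_smul' c u := by
    funext K; dsimp only [Pi.smul_apply, RingHom.id_apply, smul_eq_mul]; split_ifs <;> simp

theorem tmask_apply (k : Fin d) (u : (Fin d → n) → ℝ) (K : Fin d → n) :
    S.tmask k u K = if ∀ j, j ≠ k → ¬ S.IsEnd (K j) then u K else 0 := rfl

variable {S}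

theorem Di.tan_op {φ : Fin d → (Fin d → n) → ℝ} (h : S.Di φ) (k : Fin d) (A : Matrix n n ℝ) :
    S.Tan k fun i => op k A (φ i) :=
  fun i j hj => (h i j).op hj.symm A

theorem van_dvErase {φ : Fin d → (Fin d → n) → ℝ} (h : S.Di φ) (k : Fin d) :
    S.Van k (S.dvErase k φ) :=
  Van.sum fun j hj => (h j k).op (Finset.ne_of_mem_erase hj) S.D

variable (S)

theorem dv_eq (φ : Fin d → (Fin d → n) → ℝ) (k : Fin d) :
    S.dv φ = op k S.D (φ k) + S.dvErase k φ :=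
  (Finset.add_sum_erase Finset.univ (fun j => op j S.D (φ j)) (Finset.mem_univ k)).symm

/-- Coefficient of the second normal derivative in the direction `k`. -/
def cf (lam mu : ℝ) (k i : Fin d) : ℝ := mu + (lam + mu) * if i = k then 1 else 0

theorem sum_cf (lam mu : ℝ) (k : Fin d) (f : Fin d → ℝ) :
    ∑ i, cf lam mu k i * f i = mu * ∑ i, f i + (lam + mu) * f k := by
  simp only [cf, add_mul, Finset.sum_add_distrib, ← Finset.mul_sum, mul_assoc, ite_mul, one_mul,
    zero_mul]
  simp

theorem ip_el (lam mu : ℝ) (φ : Fin d → (Fin d → n) → ℝ) (i : Fin d)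
    (ζ : (Fin d → n) → ℝ) :
    S.ip (S.el lam mu φ i) ζ =
      mu * ∑ j, S.ip (op j S.D (op j S.D (φ i))) ζ + (lam + mu) * S.ip (op i S.D (S.dv φ)) ζ := by
  simp only [el, map_add, map_smul, LinearMap.add_apply, LinearMap.smul_apply, smul_eq_mul,
    map_sum, LinearMap.sum_apply]

theorem multiplier_identity {lam mu : ℝ} {φ : Fin d → (Fin d → n) → ℝ} (hφ : S.Di φ)
    (k : Fin d) {Y : Matrix n n ℝ} (hY : ∀ u v, S.Van k u → S.Van k v →
      S.ip u (op k Y v) = -S.ip (op k Y u) v) :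
    ∑ i, S.ip (S.el lam mu φ i) (op k Y (φ i)) =
      ∑ i, cf lam mu k i * S.ip (op k S.D (op k S.D (φ i))) (op k Y (φ i)) +
      (lam + mu) * (S.ip (op k S.D (S.dvErase k φ)) (op k Y (φ k)) -
        S.ip (op k S.D (φ k)) (op k Y (S.dvErase k φ))) := by
  have hself : ∀ u, S.Van k u → S.ip u (op k Y u) = 0 := fun u hu => by
    have h := hY u u hu hu
    rw [gip_comm d S.w (op k Y u)] at h
    linarith
  have h1 : ∀ i, ∑ j, S.ip (op j S.D (op j S.D (φ i))) (op k Y (φ i)) =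
      S.ip (op k S.D (op k S.D (φ i))) (op k Y (φ i)) := fun i => by
    refine Finset.sum_eq_single k (fun j _ hj => ?_) (by simp)
    rw [ip_D_left_of_van S _ ((hφ i j).op hj.symm Y), op_comm hj, hself, neg_zero]
    exact (hφ i k).op hj S.D
  have h2 : ∑ i, S.ip (op i S.D (S.dv φ)) (op k Y (φ i)) =
      S.ip (op k S.D (op k S.D (φ k))) (op k Y (φ k)) +
      (S.ip (op k S.D (S.dvErase k φ)) (op k Y (φ k)) -
        S.ip (op k S.D (φ k)) (op k Y (S.dvErase k φ))) := by
    rw [← Finset.add_sum_erase Finset.univ _ (Finset.mem_univ k)]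
    have : ∑ i ∈ Finset.univ.erase k, S.ip (op i S.D (S.dv φ)) (op k Y (φ i)) =
        -S.ip (S.dv φ) (op k Y (S.dvErase k φ)) := by
      rw [dvErase, map_sum, map_sum, ← Finset.sum_neg_distrib]
      refine Finset.sum_congr rfl fun i hi => ?_
      have hi := Finset.ne_of_mem_erase hi
      rw [ip_D_left_of_van S _ ((hφ i i).op hi.symm Y), op_comm hi]
    rw [this, S.dv_eq φ k]
    have h3 := hself _ (van_dvErase hφ k)
    simp only [map_add, LinearMap.add_apply, h3]
    ring
  simp only [ip_el, h1, Finset.sum_add_distrib, ← Finset.mul_sum, h2, sum_cf]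
  ring

theorem ip_op_comm_F {k j : Fin d} (hjk : j ≠ k) (c : n) (A : Matrix n n ℝ)
    (u : (Fin d → n) → ℝ) : op k (S.F c) (op j A u) = op j A (op k (S.F c) u) :=
  op_comm hjk.symm _ _ _

theorem fip_el_of_tan {lam mu : ℝ} {φ ζ : Fin d → (Fin d → n) → ℝ} (hφ : S.Di φ) {k : Fin d}
    (hζ : S.Tan k ζ) {c : n} (hc : S.IsEnd c) :
    ∑ i, S.fip k c (S.el lam mu φ i) (ζ i) =
      ∑ i, cf lam mu k i * S.fip k c (op k S.D (op k S.D (φ i))) (ζ i) -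
      (lam + mu) * ∑ j ∈ Finset.univ.erase k,
        (S.fip k c (op k S.D (φ k)) (op j S.D (ζ j)) +
          S.fip k c (op k S.D (φ j)) (op j S.D (ζ k))) := by
  have h0 : ∀ i j u, j ≠ k → S.fip k c (op j S.D u) (ζ i) = -S.fip k c u (op j S.D (ζ i)) :=
    fun i j u hj => by
      rw [fip_def, fip_def, ip_op_comm_F S hj, ip_D_left_of_van S _ (hζ i j hj)]
  have hz : ∀ i v, S.fip k c (φ i) v = 0 := fun i v => by
    rw [fip_def, op_F_of_van hc (hφ i k), map_zero, LinearMap.zero_apply]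
  have hz' : ∀ i j v, j ≠ k → S.fip k c (op j S.D (φ i)) v = 0 := fun i j v hj => by
    rw [fip_def, op_F_of_van hc ((hφ i k).op hj _), map_zero, LinearMap.zero_apply]
  have h1 : ∀ i, ∑ j, S.fip k c (op j S.D (op j S.D (φ i))) (ζ i) =
      S.fip k c (op k S.D (op k S.D (φ i))) (ζ i) := fun i => by
    refine Finset.sum_eq_single k (fun j _ hj => ?_) (by simp)
    rw [h0 _ _ _ hj, hz' _ _ _ hj, neg_zero]
  have h2 : ∑ i, S.fip k c (op i S.D (S.dv φ)) (ζ i) =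
      S.fip k c (op k S.D (op k S.D (φ k))) (ζ k) - ∑ j ∈ Finset.univ.erase k,
        (S.fip k c (op k S.D (φ k)) (op j S.D (ζ j)) +
          S.fip k c (op k S.D (φ j)) (op j S.D (ζ k))) := by
    rw [← Finset.add_sum_erase Finset.univ _ (Finset.mem_univ k)]
    have e1 : ∑ i ∈ Finset.univ.erase k, S.fip k c (op i S.D (S.dv φ)) (ζ i) =
        -∑ j ∈ Finset.univ.erase k, S.fip k c (op k S.D (φ k)) (op j S.D (ζ j)) := by
      rw [← Finset.sum_neg_distrib]
      refine Finset.sum_congr rfl fun i hi => ?_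
      have hi := Finset.ne_of_mem_erase hi
      rw [h0 _ _ _ hi, S.dv_eq φ k, map_add, LinearMap.add_apply, dvErase, map_sum,
        LinearMap.sum_apply, Finset.sum_eq_zero (s := Finset.univ.erase k), add_zero]
      exact fun j hj => hz' _ _ _ (Finset.ne_of_mem_erase hj)
    have e2 : S.fip k c (op k S.D (S.dv φ)) (ζ k) =
        S.fip k c (op k S.D (op k S.D (φ k))) (ζ k) -
        ∑ j ∈ Finset.univ.erase k, S.fip k c (op k S.D (φ j)) (op j S.D (ζ k)) := by
      rw [S.dv_eq φ k, map_add, map_add, LinearMap.add_apply, dvErase, map_sum, map_sum,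
        LinearMap.sum_apply, sub_eq_add_neg, ← Finset.sum_neg_distrib]
      congr 1
      refine Finset.sum_congr rfl fun j hj => ?_
      have hj := Finset.ne_of_mem_erase hj
      rw [op_comm hj.symm, h0 _ _ _ hj]
    rw [e1, e2, Finset.sum_add_distrib]
    ring
  have h3 : ∀ i, S.fip k c (S.el lam mu φ i) (ζ i) =
      mu * ∑ j, S.fip k c (op j S.D (op j S.D (φ i))) (ζ i) +
      (lam + mu) * S.fip k c (op i S.D (S.dv φ)) (ζ i) := fun i => by
    simp only [el, map_add, map_smul, LinearMap.add_apply, LinearMap.smul_apply, smul_eq_mul,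
      map_sum, LinearMap.sum_apply]
  simp only [h3, h1, Finset.sum_add_distrib, ← Finset.mul_sum, h2, sum_cf]
  ring

theorem fip_el_normal {lam mu : ℝ} {φ : Fin d → (Fin d → n) → ℝ} (hφ : S.Di φ) (k : Fin d)
    {c : n} (hc : S.IsEnd c) :
    ∑ i, S.fip k c (S.el lam mu φ i) (op k S.D (φ i)) =
      ∑ i, cf lam mu k i * S.fip k c (op k S.D (op k S.D (φ i))) (op k S.D (φ i)) := by
  rw [S.fip_el_of_tan hφ (hφ.tan_op k S.D) hc, sub_eq_self]
  refine mul_eq_zero_of_right _ (Finset.sum_eq_zero fun j hj => ?_)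
  have hj := Finset.ne_of_mem_erase hj
  have h := S.fip_comm k c (op k S.D (φ j)) (op j S.D (op k S.D (φ k)))
  rw [h, fip_def S k c (op j S.D (op k S.D (φ k))), ip_op_comm_F S hj,
    ip_D_left_of_van S _ ((hφ j j).op hj.symm _), ← fip_def]
  ring

theorem ip_inn {k : Fin d} {ζ : (Fin d → n) → ℝ} (hζ : ∀ j, j ≠ k → S.Van j ζ)
    (u : (Fin d → n) → ℝ) :
    S.ip u ζ = S.ip (S.inn u) ζ + S.w S.b * S.fip k S.b u ζ + S.w S.a * S.fip k S.a u ζ := by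
  simp only [fip_apply, gip_apply, Finset.mul_sum, ← Finset.sum_add_distrib]
  refine Finset.sum_congr rfl fun K _ => ?_
  have hb := (S.w_pos S.b).ne'
  have ha := (S.w_pos S.a).ne'
  by_cases h : ∃ j, j ≠ k ∧ S.IsEnd (K j)
  · obtain ⟨j, hj, he⟩ := h
    rw [hζ j hj K he]; ring
  · push Not at h
    rw [inn_apply]
    by_cases hK : S.IsEnd (K k)
    · rw [if_neg (fun hh => hh k hK)]
      rcases hK with hK | hK
      · rw [hK, if_neg S.a_ne_b, if_pos rfl]; field_simp; ring
      · rw [hK, if_neg S.a_ne_b.symm, if_pos rfl]; field_simp; ring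
    · have h1 : K k ≠ S.a := fun h => hK (Or.inl h)
      have h2 : K k ≠ S.b := fun h => hK (Or.inr h)
      rw [if_neg h1, if_neg h2, if_pos]
      · ring
      · intro j
        by_cases hj : j = k
        · rwa [hj]
        · exact h j hj

theorem fip_tmask {k : Fin d} {ζ : (Fin d → n) → ℝ} (hζ : ∀ j, j ≠ k → S.Van j ζ) (c : n)
    (u : (Fin d → n) → ℝ) : S.fip k c (S.tmask k u) ζ = S.fip k c u ζ := by
  simp only [fip_apply]
  refine Finset.sum_congr rfl fun K _ => ?_
  rw [tmask_apply]
  by_cases h2 : ∀ j, j ≠ k → ¬ S.IsEnd (K j)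
  · rw [if_pos h2]
  · rw [if_neg h2]
    push Not at h2
    obtain ⟨j, hj, he⟩ := h2
    rw [hζ j hj K he]; ring

/-- The normal quadratic form on a face. -/
def nrm (lam mu : ℝ) (k : Fin d) (c : n) (φ ψ : Fin d → (Fin d → n) → ℝ) : ℝ :=
  ∑ i, cf lam mu k i * S.fip k c (φ i) (ψ i)

theorem ip_inn_el_D {lam mu : ℝ} {φ : Fin d → (Fin d → n) → ℝ} (hφ : S.Di φ) (k : Fin d) :
    ∑ i, S.ip (S.inn (S.el lam mu φ i)) (op k S.D (φ i)) =
      S.nrm lam mu k S.b (fun i => op k S.D (φ i)) (fun i => op k S.D (φ i)) / 2 -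
      S.nrm lam mu k S.a (fun i => op k S.D (φ i)) (fun i => op k S.D (φ i)) / 2 -
      S.w S.b * S.nrm lam mu k S.b (fun i => op k S.D (op k S.D (φ i)))
        (fun i => op k S.D (φ i)) -
      S.w S.a * S.nrm lam mu k S.a (fun i => op k S.D (op k S.D (φ i)))
        (fun i => op k S.D (φ i)) := by
  have h1 := S.multiplier_identity (lam := lam) (mu := mu) hφ k
    (Y := S.D) (fun u v hu hv => S.ip_skew_D hu hv)
  have h2 : ∀ i, S.ip (S.el lam mu φ i) (op k S.D (φ i)) = _ :=
    fun i => S.ip_inn (hφ.tan_op k S.D i) _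
  have h3 := gip_comm d S.w (op k S.D (S.dvErase k φ)) (op k S.D (φ k))
  simp only [h2, Finset.sum_add_distrib, ← Finset.mul_sum] at h1
  rw [S.fip_el_normal hφ k S.isEnd_a, S.fip_el_normal hφ k S.isEnd_b, h3, sub_self, mul_zero,
    add_zero] at h1
  simp only [nrm]
  simp only [S.ip_DD_D] at h1
  have h4 : ∑ i, cf lam mu k i *
      ((S.fip k S.b (op k S.D (φ i)) (op k S.D (φ i)) -
        S.fip k S.a (op k S.D (φ i)) (op k S.D (φ i))) / 2) =
      (∑ i, cf lam mu k i * S.fip k S.b (op k S.D (φ i)) (op k S.D (φ i))) / 2 -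
      (∑ i, cf lam mu k i * S.fip k S.a (op k S.D (φ i)) (op k S.D (φ i))) / 2 := by
    rw [Finset.sum_div, Finset.sum_div, ← Finset.sum_sub_distrib]
    exact Finset.sum_congr rfl fun i _ => by ring
  rw [h4] at h1
  linarith

/-- The elastic energy form. -/
def af (lam mu : ℝ) (φ ψ : Fin d → (Fin d → n) → ℝ) : ℝ :=
  mu * ∑ k, ∑ i, S.ip (op k S.D (φ i)) (op k S.D (ψ i)) +
    (lam + mu) * S.ip (S.dv φ) (S.dv ψ)

theorem ip_inn_el_M {lam mu : ℝ} {φ : Fin d → (Fin d → n) → ℝ} (hφ : S.Di φ) (k : Fin d) :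
    ∑ i, S.ip (S.inn (S.el lam mu φ i)) (op k S.M (φ i)) =
      S.nrm lam mu k S.b (fun i => op k S.D (φ i)) (fun i => op k S.D (φ i)) -
      (mu * ∑ i, S.ip (op k S.D (φ i)) (op k S.D (φ i)) +
        (lam + mu) * S.ip (S.dv φ) (op k S.D (φ k))) -
      2 * S.w S.b * S.nrm lam mu k S.b (fun i => op k S.D (op k S.D (φ i)))
        (fun i => op k S.D (φ i)) +
      (∑ i, S.fip k S.b (S.el lam mu φ i) (op k S.P (φ i)) +
        ∑ i, S.fip k S.a (S.el lam mu φ i) (op k S.P (φ i))) / 2 := by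
  have h1 := S.multiplier_identity (lam := lam) (mu := mu) hφ k
    (Y := S.M) (fun _ _ _ hv => S.ip_skew_M hv)
  have h2 : ∀ i, S.ip (S.el lam mu φ i) (op k S.M (φ i)) = _ :=
    fun i => S.ip_inn (hφ.tan_op k S.M i) _
  have hzb : ∀ u i, S.fip k S.b u (φ i) = 0 := fun u i => by
    rw [fip_right, op_F_of_van S.isEnd_b (hφ i k), map_zero]
  have hza : ∀ u i, S.fip k S.a u (φ i) = 0 := fun u i => by
    rw [fip_right, op_F_of_van S.isEnd_a (hφ i k), map_zero]
  have eb : ∀ i, S.fip k S.b (S.el lam mu φ i) (op k S.M (φ i)) =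
      2 * S.fip k S.b (S.el lam mu φ i) (op k S.D (φ i)) -
      S.th / 2 * S.fip k S.b (S.el lam mu φ i) (op k S.P (φ i)) := fun i => by
    rw [op_M]
    simp only [map_add, map_sub, map_smul, smul_eq_mul, fip_X_b, hzb]
    ring
  have ea : ∀ i, S.fip k S.a (S.el lam mu φ i) (op k S.M (φ i)) =
      - (S.th / 2 * S.fip k S.a (S.el lam mu φ i) (op k S.P (φ i))) := fun i => by
    rw [op_M]
    simp only [map_add, map_sub, map_smul, smul_eq_mul, fip_X_a, hza]
    ring
  have hwb : S.w S.b * S.th = 1 := S.w_b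
  have hwa : S.w S.a * S.th = 1 := S.w_a
  have h3 := S.ip_D_M_sub (k := k) (v := φ k) (van_dvErase hφ k)
  rw [ip_D_left_of_van S _ (hφ k k)] at h3
  have h4 := S.dv_eq φ k
  simp only [h2, Finset.sum_add_distrib, ← Finset.mul_sum] at h1
  rw [h3] at h1
  simp only [eb, ea, Finset.sum_sub_distrib, ← Finset.mul_sum, Finset.sum_neg_distrib] at h1
  rw [S.fip_el_normal hφ k S.isEnd_b] at h1
  simp only [S.ip_DD_M (hφ _ k), mul_sub, Finset.sum_sub_distrib] at h1
  rw [sum_cf lam mu k fun i => S.ip (op k S.D (φ i)) (op k S.D (φ i))] at h1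
  simp only [nrm]
  rw [h4, map_add, LinearMap.add_apply]
  linear_combination h1 + (∑ i, S.fip k S.b (S.el lam mu φ i) (op k S.P (φ i))) / 2 * hwb +
    (∑ i, S.fip k S.a (S.el lam mu φ i) (op k S.P (φ i))) / 2 * hwa

theorem ip_inn_of_di {ζ : (Fin d → n) → ℝ} (hζ : ∀ j, S.Van j ζ)
    (u : (Fin d → n) → ℝ) : S.ip (S.inn u) ζ = S.ip u ζ := by
  simp only [gip_apply]
  refine Finset.sum_congr rfl fun K _ => ?_
  rw [inn_apply]
  split_ifs with h
  · rfl
  · push Not at h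
    obtain ⟨j, hj⟩ := h
    rw [hζ j K hj]; ring

/-- Discrete Green formula. -/
theorem ip_el_eq_neg_af {lam mu : ℝ} {φ ψ : Fin d → (Fin d → n) → ℝ} (hψ : S.Di ψ) :
    ∑ i, S.ip (S.inn (S.el lam mu φ i)) (ψ i) = -S.af lam mu φ ψ := by
  simp only [S.ip_inn_of_di (hψ _)]
  have h1 : ∀ i j u, S.ip (op j S.D u) (ψ i) = -S.ip u (op j S.D (ψ i)) :=
    fun i j u => ip_D_left_of_van S u (hψ i j)
  simp only [ip_el, h1, Finset.sum_add_distrib, ← Finset.mul_sum, Finset.sum_neg_distrib, af]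
  rw [Finset.sum_comm, ← map_sum]
  simp only [dv]
  ring

end LGLData

namespace LGLData

variable {n : Type} [Fintype n] [DecidableEq n] (S : LGLData n) {d : ℕ}

/-- First boundary observation on the face `x_k = 1`. -/
def obsF (lam mu : ℝ) (k : Fin d) (φ : Fin d → (Fin d → n) → ℝ) (i : Fin d) :
    (Fin d → n) → ℝ :=
  S.tmask k (cf lam mu k i • op k S.D (φ i) - S.w S.b • S.el lam mu φ i)

/-- The observation form. -/
def obs (lam mu : ℝ) (φ ψ : Fin d → (Fin d → n) → ℝ) : ℝ :=
  ∑ k, ∑ i, (S.fip k S.b (S.obsF lam mu k φ i) (S.obsF lam mu k ψ i) +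
    S.w S.a * (cf lam mu k i ^ 2 *
      S.fip k S.a (op k S.D (op k S.D (φ i))) (op k S.D (op k S.D (ψ i)))) +
    S.w S.b * (cf lam mu k i ^ 2 *
      S.fip k S.b (op k S.D (op k S.D (φ i))) (op k S.D (op k S.D (ψ i)))))

/-- Twice the energy. -/
def en2 (lam mu : ℝ) (φ χ : Fin d → (Fin d → n) → ℝ) : ℝ :=
  ∑ i, S.ip (χ i) (χ i) + S.af lam mu φ φ

/-- The virial multiplier. -/
def Mt (φ : Fin d → (Fin d → n) → ℝ) (i : Fin d) : (Fin d → n) → ℝ :=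
  ∑ k, op k S.M (φ i) - (1 / 2 : ℝ) • φ i

theorem le_cf {lam mu : ℝ} (hlam : 0 < lam) (hmu : 0 < mu) (k i : Fin d) : mu ≤ cf lam mu k i := by
  unfold cf; split_ifs <;> linarith

theorem cf_le {lam mu : ℝ} (hlam : 0 < lam) (hmu : 0 < mu) (k i : Fin d) :
    cf lam mu k i ≤ lam + 2 * mu := by
  unfold cf; split_ifs <;> linarith

theorem le_nrm {lam mu : ℝ} (hlam : 0 < lam) (hmu : 0 < mu) (k : Fin d) (c : n)
    (p : Fin d → (Fin d → n) → ℝ) :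
    mu * ∑ i, S.fip k c (p i) (p i) ≤ S.nrm lam mu k c p p := by
  rw [nrm, Finset.mul_sum]
  exact Finset.sum_le_sum fun i _ =>
    mul_le_mul_of_nonneg_right (le_cf hlam hmu k i) (S.fip_self_nonneg _ _ _)

theorem nrm_le {lam mu : ℝ} (hlam : 0 < lam) (hmu : 0 < mu) (k : Fin d) (c : n)
    (p : Fin d → (Fin d → n) → ℝ) :
    S.nrm lam mu k c p p ≤ (lam + 2 * mu) * ∑ i, S.fip k c (p i) (p i) := by
  rw [nrm, Finset.mul_sum]
  exact Finset.sum_le_sum fun i _ =>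
    mul_le_mul_of_nonneg_right (cf_le hlam hmu k i) (S.fip_self_nonneg _ _ _)

theorem nrm_young (lam mu : ℝ) (k : Fin d) (c : n) (q p : Fin d → (Fin d → n) → ℝ)
    {r : ℝ} (hr : 0 < r) :
    S.nrm lam mu k c q p ≤ r / 2 * ∑ i, cf lam mu k i ^ 2 * S.fip k c (q i) (q i) +
      1 / (2 * r) * ∑ i, S.fip k c (p i) (p i) := by
  rw [nrm, Finset.mul_sum, Finset.mul_sum, ← Finset.sum_add_distrib]
  refine Finset.sum_le_sum fun i _ => ?_
  have h := S.fip_young k c (cf lam mu k i • q i) (p i) hr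
  simp only [map_smul, LinearMap.smul_apply, smul_eq_mul] at h
  linarith

theorem neg_nrm_young (lam mu : ℝ) (k : Fin d) (c : n) (q p : Fin d → (Fin d → n) → ℝ)
    {r : ℝ} (hr : 0 < r) :
    -S.nrm lam mu k c q p ≤ r / 2 * ∑ i, cf lam mu k i ^ 2 * S.fip k c (q i) (q i) +
      1 / (2 * r) * ∑ i, S.fip k c (p i) (p i) := by
  have h := S.nrm_young lam mu k c q (fun i => -p i) hr
  simpa only [nrm, map_neg, LinearMap.neg_apply, neg_neg, mul_neg, Finset.sum_neg_distrib]
    using h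

theorem fip_op_op_P_le {u v : (Fin d → n) → ℝ} {k j : Fin d} (hj : j ≠ k) {c : n}
    (hc : S.IsEnd c) {R pc : ℝ} (hR : 0 < R) (hu : S.fip k c u u ≤ pc) :
    -S.fip k c u (op j S.D (op k S.P v)) ≤
      R / S.N / 2 * pc + 1 / R * S.ip (op j S.D v) (op j S.D v) := by
  have hN0 := S.N_pos
  have h := S.fip_young k c (-u) (op j S.D (op k S.P v)) (t := R / S.N) (by positivity)
  simp only [map_neg, LinearMap.neg_apply, neg_neg] at h
  refine h.trans (add_le_add (mul_le_mul_of_nonneg_left hu (by positivity)) ?_)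
  rw [op_comm hj, S.fip_P hc]
  have h2 := S.ip_P_le k (op j S.D v)
  calc _ ≤ 1 / (2 * (R / S.N)) * (2 / S.N * S.ip (op j S.D v) (op j S.D v)) :=
        mul_le_mul_of_nonneg_left h2 (by positivity)
    _ = _ := by field_simp

theorem sum_ip_D_le (φ : Fin d → (Fin d → n) → ℝ) (k : Fin d) :
    ∑ i, S.ip (op k S.D (φ i)) (op k S.D (φ i)) ≤
      ∑ j, ∑ i, S.ip (op j S.D (φ i)) (op j S.D (φ i)) :=
  Finset.single_le_sum (f := fun j => ∑ i, S.ip (op j S.D (φ i)) (op j S.D (φ i)))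
    (fun _ _ => Finset.sum_nonneg fun _ _ => gip_self_nonneg S.w_pos _) (Finset.mem_univ k)

theorem sum_ip_D_le_of_fun (φ : Fin d → (Fin d → n) → ℝ) (l : Fin d → Fin d) :
    ∑ j, S.ip (op j S.D (φ (l j))) (op j S.D (φ (l j))) ≤
      ∑ j, ∑ i, S.ip (op j S.D (φ i)) (op j S.D (φ i)) :=
  Finset.sum_le_sum fun j _ => Finset.single_le_sum
    (f := fun i => S.ip (op j S.D (φ i)) (op j S.D (φ i)))
    (fun _ _ => gip_self_nonneg S.w_pos _) (Finset.mem_univ (l j))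

theorem neg_sum_cross_le (φ : Fin d → (Fin d → n) → ℝ) (k : Fin d)
    {c : n} (hc : S.IsEnd c) {R pc G : ℝ} (hR : 0 < R)
    (hpk : ∀ i, S.fip k c (op k S.D (φ i)) (op k S.D (φ i)) ≤ pc)
    (hG : ∑ j, ∑ i, S.ip (op j S.D (φ i)) (op j S.D (φ i)) = G) :
    -∑ j ∈ Finset.univ.erase k,
        (S.fip k c (op k S.D (φ k)) (op j S.D (op k S.P (φ j))) +
          S.fip k c (op k S.D (φ j)) (op j S.D (op k S.P (φ k)))) ≤
      d * (R / S.N) * pc + 2 / R * G := by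
  have hN0 := S.N_pos
  have hip : ∀ u : (Fin d → n) → ℝ, 0 ≤ S.ip u u := fun u => gip_self_nonneg S.w_pos u
  have hpc0 : 0 ≤ pc := (S.fip_self_nonneg _ _ _).trans (hpk k)
  rw [← Finset.sum_neg_distrib]
  calc _ ≤ ∑ j ∈ Finset.univ.erase k, (R / S.N * pc +
        1 / R * (S.ip (op j S.D (φ j)) (op j S.D (φ j)) +
          S.ip (op j S.D (φ k)) (op j S.D (φ k)))) := by
        refine Finset.sum_le_sum fun j hj => ?_
        have hj := Finset.ne_of_mem_erase hj
        have h1 := S.fip_op_op_P_le (v := φ j) hj hc hR (hpk k)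
        have h2 := S.fip_op_op_P_le (v := φ k) hj hc hR (hpk j)
        linarith
    _ ≤ ∑ j, (R / S.N * pc +
        1 / R * (S.ip (op j S.D (φ j)) (op j S.D (φ j)) +
          S.ip (op j S.D (φ k)) (op j S.D (φ k)))) := by
        refine Finset.sum_le_sum_of_subset_of_nonneg (Finset.erase_subset _ _) fun j _ _ => ?_
        have h1 := hip (op j S.D (φ j))
        have h2 := hip (op j S.D (φ k))
        positivity
    _ ≤ _ := by
        rw [Finset.sum_add_distrib, Finset.sum_const, Finset.card_univ, Fintype.card_fin,
          nsmul_eq_mul, ← Finset.mul_sum, Finset.sum_add_distrib]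
        have h1 := S.sum_ip_D_le_of_fun φ (fun j => j)
        have h2 := S.sum_ip_D_le_of_fun φ (fun _ => k)
        rw [hG] at h1 h2
        have h3 := mul_le_mul_of_nonneg_left (add_le_add h1 h2) (by positivity : 0 ≤ 1 / R)
        have : 1 / R * (G + G) = 2 / R * G := by ring
        linarith

theorem nrm_P_le {lam mu : ℝ} (φ : Fin d → (Fin d → n) → ℝ) (k : Fin d)
    {c : n} (hc : S.IsEnd c) {R : ℝ} (hR : 0 < R) :
    S.nrm lam mu k c (fun i => op k S.D (op k S.D (φ i))) (fun i => op k S.P (φ i)) ≤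
      R / 2 * (S.w c * ∑ i, cf lam mu k i ^ 2 *
        S.fip k c (op k S.D (op k S.D (φ i))) (op k S.D (op k S.D (φ i)))) +
      1 / R * ∑ j, ∑ i, S.ip (op j S.D (φ i)) (op j S.D (φ i)) := by
  have hN := S.two_le'
  have hN0 := S.N_pos
  have hth := S.th_pos
  have a1 := S.nrm_young lam mu k c (fun i => op k S.D (op k S.D (φ i)))
    (fun i => op k S.P (φ i)) (r := R / S.th) (by positivity)
  have hk := S.sum_ip_D_le φ k
  generalize ∑ j, ∑ i, S.ip (op j S.D (φ i)) (op j S.D (φ i)) = G at hk ⊢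
  have hG0 : 0 ≤ G := (Finset.sum_nonneg fun i _ => gip_self_nonneg S.w_pos _).trans hk
  have a2 : ∑ i, S.fip k c (op k S.P (φ i)) (op k S.P (φ i)) ≤ 2 / (S.N : ℝ) ^ 3 * G := by
    refine le_trans ?_ (mul_le_mul_of_nonneg_left hk (by positivity))
    rw [Finset.mul_sum]
    refine Finset.sum_le_sum fun i _ => ?_
    rw [S.fip_P hc]
    exact S.ip_P_le_D k (φ i)
  have a3 : 1 / (2 * (R / S.th)) * (2 / (S.N : ℝ) ^ 3 * G) ≤ 1 / R * G := by
    rw [← mul_assoc]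
    refine mul_le_mul_of_nonneg_right ?_ hG0
    have : 1 / (2 * (R / S.th)) * (2 / (S.N : ℝ) ^ 3) =
        1 / R * ((S.N + 1) / (2 * (S.N : ℝ) ^ 2)) := by
      unfold th; field_simp
    rw [this]
    refine mul_le_of_le_one_right (by positivity) ?_
    rw [div_le_one (by positivity)]
    nlinarith
  have a4 := mul_le_mul_of_nonneg_left a2 (by positivity : 0 ≤ 1 / (2 * (R / S.th)))
  rw [S.w_end hc]
  have e1 : ∀ x : ℝ, R / S.th / 2 * x = R / 2 * (1 / S.th * x) := fun x => by ring
  rw [e1] at a1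
  linarith

theorem fip_el_P_le {lam mu : ℝ} (hlam : 0 < lam) (hmu : 0 < mu)
    {φ : Fin d → (Fin d → n) → ℝ} (hφ : S.Di φ) (k : Fin d)
    {c : n} (hc : S.IsEnd c) {R : ℝ} (hR : 0 < R) :
    ∑ i, S.fip k c (S.el lam mu φ i) (op k S.P (φ i)) ≤
      R / 2 * (S.w c * ∑ i, cf lam mu k i ^ 2 *
        S.fip k c (op k S.D (op k S.D (φ i))) (op k S.D (op k S.D (φ i)))) +
      (lam + mu) * d * R / S.N * ∑ i, S.fip k c (op k S.D (φ i)) (op k S.D (φ i)) +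
      (2 * (lam + mu) + 1) / R * ∑ j, ∑ i, S.ip (op j S.D (φ i)) (op j S.D (φ i)) := by
  have a1 := S.nrm_P_le (lam := lam) (mu := mu) φ k hc hR
  have b2 := S.neg_sum_cross_le φ k hc hR (fun i => Finset.single_le_sum
    (f := fun i => S.fip k c (op k S.D (φ i)) (op k S.D (φ i)))
      (fun j _ => S.fip_self_nonneg _ _ _) (Finset.mem_univ i)) rfl
  have b3 := mul_le_mul_of_nonneg_left b2 (by positivity : 0 ≤ lam + mu)
  rw [S.fip_el_of_tan hφ (hφ.tan_op k S.P) hc]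
  simp only [nrm] at a1
  generalize ∑ j, ∑ i, S.ip (op j S.D (φ i)) (op j S.D (φ i)) = G at *
  generalize ∑ i, S.fip k c (op k S.D (φ i)) (op k S.D (φ i)) = pc at *
  have e2 : (lam + mu) * (d * (R / S.N) * pc + 2 / R * G) + 1 / R * G =
      (lam + mu) * d * R / S.N * pc + (2 * (lam + mu) + 1) / R * G := by ring
  linarith

theorem fip_obsF {lam mu : ℝ} {φ : Fin d → (Fin d → n) → ℝ} (hφ : S.Di φ) (k : Fin d) :
    ∑ i, S.fip k S.b (S.obsF lam mu k φ i) (op k S.D (φ i)) =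
      S.nrm lam mu k S.b (fun i => op k S.D (φ i)) (fun i => op k S.D (φ i)) -
      S.w S.b * S.nrm lam mu k S.b (fun i => op k S.D (op k S.D (φ i)))
        (fun i => op k S.D (φ i)) := by
  have h : ∀ i, S.fip k S.b (S.obsF lam mu k φ i) (op k S.D (φ i)) =
      cf lam mu k i * S.fip k S.b (op k S.D (φ i)) (op k S.D (φ i)) -
      S.w S.b * S.fip k S.b (S.el lam mu φ i) (op k S.D (φ i)) := fun i => by
    rw [obsF, S.fip_tmask (hφ.tan_op k S.D i)]
    simp only [map_sub, map_smul, LinearMap.sub_apply, LinearMap.smul_apply, smul_eq_mul]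
  simp only [h, Finset.sum_sub_distrib, ← Finset.mul_sum, nrm]
  rw [S.fip_el_normal hφ k S.isEnd_b]

/-- Coefficient of the auxiliary multiplier in the virial inequality. -/
def virialC (d : ℕ) (lam mu : ℝ) : ℝ :=
  2 * (lam + mu) * d * (8 * d * (2 * (lam + mu) + 1) / mu) / mu

/-- Coefficient of the observation in the virial inequality. -/
def obsC (d : ℕ) (lam mu : ℝ) : ℝ :=
  (lam + 2 * mu + 1 + (lam + mu) * d * (8 * d * (2 * (lam + mu) + 1) / mu) +
    virialC d lam mu * (lam + 2 * mu + 1)) * (2 / mu ^ 2) +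
  1 + 8 * d * (2 * (lam + mu) + 1) / mu + virialC d lam mu * (1 + 1 / mu)

theorem virialC_nonneg {d : ℕ} {lam mu : ℝ} (hlam : 0 < lam) (hmu : 0 < mu) :
    0 ≤ virialC d lam mu := by
  unfold virialC; positivity

theorem obsC_nonneg {d : ℕ} {lam mu : ℝ} (hlam : 0 < lam) (hmu : 0 < mu) :
    0 ≤ obsC d lam mu := by
  have := virialC_nonneg (d := d) hlam hmu
  unfold obsC; positivity

theorem face_arith {d N lam mu R c of ogb oga pb pa Nb Na Xb Xa Pb Pa G : ℝ}
    (hlam : 0 < lam) (hmu : 0 < mu) (hd : 0 < d) (hN : 1 ≤ N) (hR : 0 < R)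
    (hc : c = 2 * (lam + mu) * d * R / mu)
    (hof : 0 ≤ of) (hogb : 0 ≤ ogb) (hoga : 0 ≤ oga) (hpb : 0 ≤ pb)
    (hNb1 : mu * pb ≤ Nb) (hNb2 : Nb ≤ (lam + 2 * mu) * pb) (hNa1 : mu * pa ≤ Na)
    (hX1 : Xb ≤ ogb / mu + mu / 4 * pb) (hX2 : -Xb ≤ ogb / 2 + pb / 2)
    (hX3 : -Xa ≤ oga / mu + mu / 4 * pa)
    (hO : Nb - Xb ≤ of / mu + mu / 4 * pb)
    (hPb : Pb ≤ R / 2 * ogb + (lam + mu) * d * R / N * pb + (2 * (lam + mu) + 1) / R * G)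
    (hPa : Pa ≤ R / 2 * oga + (lam + mu) * d * R / N * pa + (2 * (lam + mu) + 1) / R * G) :
    Nb - 2 * Xb + (Pb + Pa) / 2 + c / N * (Nb / 2 - Na / 2 - Xb - Xa) ≤
      (2 * (lam + mu) + 1) / R * G +
      ((lam + 2 * mu + 1 + (lam + mu) * d * R + c * (lam + 2 * mu + 1)) * (2 / mu ^ 2) +
        1 + R + c * (1 + 1 / mu)) * (of + oga + ogb) := by
  have hpb2 : pb ≤ 2 / mu ^ 2 * (of + ogb) := by
    have : mu / 2 * pb ≤ (of + ogb) / mu := by rw [add_div]; linarith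
    have h2 := mul_le_mul_of_nonneg_left this (by positivity : 0 ≤ 2 / mu)
    have e1 : 2 / mu * (mu / 2 * pb) = pb := by field_simp
    have e2 : 2 / mu * ((of + ogb) / mu) = 2 / mu ^ 2 * (of + ogb) := by field_simp
    linarith
  have hN0 : 0 < N := by linarith
  have hc0 : 0 ≤ c := by rw [hc]; positivity
  have hcN : 0 ≤ c / N := by positivity
  have hcN' : c / N ≤ c := div_le_self hc0 hN
  have hT : Nb / 2 - Na / 2 - Xb - Xa ≤
      ((lam + 2 * mu + 1) / 2 * pb + ogb / 2 + oga / mu) - mu / 4 * pa := by linarith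
  have h1 := mul_le_mul_of_nonneg_left hT hcN
  have h2 : c / N * ((lam + 2 * mu + 1) / 2 * pb + ogb / 2 + oga / mu) ≤
      c * ((lam + 2 * mu + 1) / 2 * pb + ogb / 2 + oga / mu) :=
    mul_le_mul_of_nonneg_right hcN' (by positivity)
  have h3 : c / N * (mu / 4 * pa) = (lam + mu) * d * R / N * pa / 2 := by
    rw [hc]; field_simp; ring
  have h4 : (lam + mu) * d * R / N * pb ≤ (lam + mu) * d * R * pb :=
    mul_le_mul_of_nonneg_right (div_le_self (by positivity) hN) hpb
  have h5 : (lam + 2 * mu + 1 + (lam + mu) * d * R + c * (lam + 2 * mu + 1)) * pb ≤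
      (lam + 2 * mu + 1 + (lam + mu) * d * R + c * (lam + 2 * mu + 1)) *
        (2 / mu ^ 2 * (of + ogb)) :=
    mul_le_mul_of_nonneg_left hpb2 (by positivity)
  have h6 : 0 ≤ (lam + 2 * mu + 1 + (lam + mu) * d * R + c * (lam + 2 * mu + 1)) *
      (2 / mu ^ 2) * oga := by positivity
  have h7 : 0 ≤ (1 + R + c * (1 + 1 / mu)) * of := by positivity
  have h8 : 0 ≤ R * ogb := by positivity
  have h9 : 0 ≤ R * oga := by positivity
  have h10 : 0 ≤ c * ogb := by positivity
  have h11 : 0 ≤ c * oga := by positivity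
  have h12 : 0 ≤ c * (1 / mu) * ogb := by positivity
  have h13 : oga / mu = 1 / mu * oga := by ring
  have h14 : 0 ≤ c * (lam + 2 * mu + 1) * pb := by positivity
  have h15 : 0 ≤ (lam + mu) * d * R * pb := by positivity
  rw [h13] at h1 h2
  rw [mul_sub (c / N) _ (mu / 4 * pa), h3] at h1
  have e1 : ((lam + 2 * mu + 1 + (lam + mu) * d * R + c * (lam + 2 * mu + 1)) * (2 / mu ^ 2) +
        1 + R + c * (1 + 1 / mu)) * (of + oga + ogb) =
      (lam + 2 * mu + 1 + (lam + mu) * d * R + c * (lam + 2 * mu + 1)) *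
        (2 / mu ^ 2 * (of + ogb)) +
      (lam + 2 * mu + 1 + (lam + mu) * d * R + c * (lam + 2 * mu + 1)) *
      (2 / mu ^ 2) * oga + (1 + R + c * (1 + 1 / mu)) * of +
      (ogb + oga + R * ogb + R * oga + c * ogb + c * oga + c * (1 / mu) * ogb +
        c * (1 / mu * oga)) := by ring
  rw [e1]
  linarith

theorem face_bound {lam mu : ℝ} (hd : 0 < d) (hlam : 0 < lam) (hmu : 0 < mu)
    {φ : Fin d → (Fin d → n) → ℝ} (hφ : S.Di φ) (k : Fin d) :
    S.nrm lam mu k S.b (fun i => op k S.D (φ i)) (fun i => op k S.D (φ i)) -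
      2 * (S.w S.b * S.nrm lam mu k S.b (fun i => op k S.D (op k S.D (φ i)))
        (fun i => op k S.D (φ i))) +
      (∑ i, S.fip k S.b (S.el lam mu φ i) (op k S.P (φ i)) +
        ∑ i, S.fip k S.a (S.el lam mu φ i) (op k S.P (φ i))) / 2 +
      virialC d lam mu / S.N * ∑ i, S.ip (S.inn (S.el lam mu φ i)) (op k S.D (φ i)) ≤
    mu / (8 * d) * ∑ j, ∑ i, S.ip (op j S.D (φ i)) (op j S.D (φ i)) +
    obsC d lam mu * ∑ i, (S.fip k S.b (S.obsF lam mu k φ i) (S.obsF lam mu k φ i) +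
      S.w S.a * (cf lam mu k i ^ 2 *
        S.fip k S.a (op k S.D (op k S.D (φ i))) (op k S.D (op k S.D (φ i)))) +
      S.w S.b * (cf lam mu k i ^ 2 *
        S.fip k S.b (op k S.D (op k S.D (φ i))) (op k S.D (op k S.D (φ i))))) := by
  have hd' : (0 : ℝ) < d := by exact_mod_cast hd
  set R : ℝ := 8 * d * (2 * (lam + mu) + 1) / mu with hR
  have hR0 : 0 < R := by positivity
  have hpos : ∀ c (u : Fin d → (Fin d → n) → ℝ), 0 ≤ ∑ i, S.fip k c (u i) (u i) :=
    fun c u => Finset.sum_nonneg fun i _ => S.fip_self_nonneg _ _ _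
  have hpos2 : ∀ c, 0 ≤ S.w c * ∑ i, cf lam mu k i ^ 2 *
      S.fip k c (op k S.D (op k S.D (φ i))) (op k S.D (op k S.D (φ i))) :=
    fun c => mul_nonneg (S.w_pos c).le (Finset.sum_nonneg fun i _ =>
      mul_nonneg (sq_nonneg _) (S.fip_self_nonneg _ _ _))
  have hq : 1 / (2 * (2 / mu)) = mu / 4 := by field_simp; norm_num
  rw [S.ip_inn_el_D hφ k]
  simp only [Finset.sum_add_distrib, ← Finset.mul_sum]
  have hwle : ∀ c, S.IsEnd c → ∀ x : ℝ, 0 ≤ x → S.w c * x ≤ x := fun c hc x hx =>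
    mul_le_of_le_one_left hx (S.w_end_le hc)
  have key := face_arith (d := d) (N := S.N) (R := R) (c := virialC d lam mu)
    (of := ∑ i, S.fip k S.b (S.obsF lam mu k φ i) (S.obsF lam mu k φ i))
    hlam hmu hd' (by linarith [S.two_le']) hR0
    (by rw [virialC, hR]) (hpos S.b _) (hpos2 S.b) (hpos2 S.a)
    (hpos S.b fun i => op k S.D (φ i))
    (S.le_nrm hlam hmu k S.b fun i => op k S.D (φ i))
    (S.nrm_le hlam hmu k S.b fun i => op k S.D (φ i))
    (S.le_nrm hlam hmu k S.a fun i => op k S.D (φ i))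
    (Xb := S.w S.b * S.nrm lam mu k S.b (fun i => op k S.D (op k S.D (φ i)))
        (fun i => op k S.D (φ i)))
    (Xa := S.w S.a * S.nrm lam mu k S.a (fun i => op k S.D (op k S.D (φ i)))
        (fun i => op k S.D (φ i)))
    (by
      have h := S.nrm_young lam mu k S.b (fun i => op k S.D (op k S.D (φ i)))
        (fun i => op k S.D (φ i)) (r := 2 / mu) (by positivity)
      have h2 := mul_le_mul_of_nonneg_left h (S.w_pos S.b).le
      have h3 := hwle S.b S.isEnd_b _ (mul_nonneg (by positivity : 0 ≤ mu / 4)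
        (hpos S.b fun i => op k S.D (φ i)))
      refine h2.trans ?_
      rw [mul_add]
      refine add_le_add (le_of_eq ?_) (le_trans (le_of_eq ?_) h3)
      · field_simp
      · rw [hq])
    (by
      have h := S.neg_nrm_young lam mu k S.b (fun i => op k S.D (op k S.D (φ i)))
        (fun i => op k S.D (φ i)) (r := 1) one_pos
      have h2 := mul_le_mul_of_nonneg_left h (S.w_pos S.b).le
      have h3 := hwle S.b S.isEnd_b _ (mul_nonneg (by positivity : 0 ≤ (1 : ℝ) / 2)
        (hpos S.b fun i => op k S.D (φ i)))
      rw [← mul_neg]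
      refine h2.trans ?_
      rw [mul_add]
      refine add_le_add (le_of_eq ?_) (le_trans (le_of_eq ?_) (h3.trans (le_of_eq ?_)))
      · ring
      · norm_num
      · ring)
    (by
      have h := S.neg_nrm_young lam mu k S.a (fun i => op k S.D (op k S.D (φ i)))
        (fun i => op k S.D (φ i)) (r := 2 / mu) (by positivity)
      have h2 := mul_le_mul_of_nonneg_left h (S.w_pos S.a).le
      have h3 := hwle S.a S.isEnd_a _ (mul_nonneg (by positivity : 0 ≤ mu / 4)
        (hpos S.a fun i => op k S.D (φ i)))
      rw [← mul_neg]
      refine h2.trans ?_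
      rw [mul_add]
      refine add_le_add (le_of_eq ?_) (le_trans (le_of_eq ?_) h3)
      · field_simp
      · rw [hq])
    (by
      rw [← S.fip_obsF hφ k]
      have h : ∀ i, S.fip k S.b (S.obsF lam mu k φ i) (op k S.D (φ i)) ≤ _ := fun i =>
        S.fip_young k S.b (S.obsF lam mu k φ i) (op k S.D (φ i)) (t := 2 / mu) (by positivity)
      refine (Finset.sum_le_sum fun i _ => h i).trans (le_of_eq ?_)
      rw [Finset.sum_add_distrib, ← Finset.mul_sum, ← Finset.mul_sum]
      rw [hq]; ring)
    (S.fip_el_P_le hlam hmu hφ k S.isEnd_b hR0)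
    (S.fip_el_P_le hlam hmu hφ k S.isEnd_a hR0)
  refine key.trans (le_of_eq ?_)
  have e : (2 * (lam + mu) + 1) / R = mu / (8 * d) := by
    rw [hR]; field_simp
  rw [e, obsC, ← hR]

theorem virial {lam mu : ℝ} (hd : 0 < d) (hlam : 0 < lam) (hmu : 0 < mu)
    {φ χ : Fin d → (Fin d → n) → ℝ} (hφ : S.Di φ) (hχ : S.Di χ) :
    3 / 8 * S.en2 lam mu φ χ ≤
      -∑ i, (S.ip (S.inn (S.el lam mu φ i)) (S.Mt φ i) + S.ip (χ i) (S.Mt χ i)) -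
      virialC d lam mu / S.N * ∑ i, (S.ip (S.inn (S.el lam mu φ i)) (∑ k, op k S.D (φ i)) +
        S.ip (χ i) (∑ k, op k S.D (χ i))) + obsC d lam mu * S.obs lam mu φ φ := by
  have hd' : (0 : ℝ) < d := by exact_mod_cast hd
  have h1 : ∑ i, S.ip (χ i) (∑ k, op k S.D (χ i)) = 0 := by
    refine Finset.sum_eq_zero fun i _ => ?_
    rw [map_sum]
    refine Finset.sum_eq_zero fun k _ => ?_
    have h := S.ip_skew_D (hχ i k) (hχ i k)
    rw [gip_comm d S.w (op k S.D (χ i))] at h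
    linarith
  have h2 : ∑ i, S.ip (χ i) (S.Mt χ i) = -(∑ i, S.ip (χ i) (χ i)) / 2 := by
    rw [← Finset.sum_neg_distrib, Finset.sum_div]
    refine Finset.sum_congr rfl fun i _ => ?_
    rw [Mt, map_sub, map_sum, Finset.sum_eq_zero, map_smul, smul_eq_mul]
    · ring
    · intro k _
      have h := S.ip_skew_M (u := χ i) (hχ i k)
      rw [gip_comm d S.w (op k S.M (χ i))] at h
      linarith
  have h3 : ∑ i, S.ip (S.inn (S.el lam mu φ i)) (S.Mt φ i) =
      ∑ k, ∑ i, S.ip (S.inn (S.el lam mu φ i)) (op k S.M (φ i)) + S.af lam mu φ φ / 2 := by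
    have h := S.ip_el_eq_neg_af (lam := lam) (mu := mu) (φ := φ) hφ
    simp only [Mt, map_sub, map_sum, map_smul, smul_eq_mul, Finset.sum_sub_distrib,
      ← Finset.mul_sum]
    rw [h, Finset.sum_comm]; ring
  have h4 : ∑ i, S.ip (S.inn (S.el lam mu φ i)) (∑ k, op k S.D (φ i)) =
      ∑ k, ∑ i, S.ip (S.inn (S.el lam mu φ i)) (op k S.D (φ i)) := by
    simp only [map_sum]; rw [Finset.sum_comm]
  have h5 : ∑ k, (mu * ∑ i, S.ip (op k S.D (φ i)) (op k S.D (φ i)) +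
      (lam + mu) * S.ip (S.dv φ) (op k S.D (φ k))) = S.af lam mu φ φ := by
    rw [Finset.sum_add_distrib, ← Finset.mul_sum, ← Finset.mul_sum, ← map_sum]; rfl
  have h6 := Finset.sum_le_sum fun k (_ : k ∈ Finset.univ) => S.face_bound hd hlam hmu hφ k
  have h7 : mu * ∑ j, ∑ i, S.ip (op j S.D (φ i)) (op j S.D (φ i)) ≤ S.en2 lam mu φ χ := by
    have a1 : 0 ≤ ∑ i, S.ip (χ i) (χ i) :=
      Finset.sum_nonneg fun i _ => gip_self_nonneg S.w_pos _
    have a2 : 0 ≤ (lam + mu) * S.ip (S.dv φ) (S.dv φ) :=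
      mul_nonneg (by positivity) (gip_self_nonneg S.w_pos _)
    rw [en2, af]; linarith
  have h8 := Finset.sum_congr rfl fun k (_ : k ∈ Finset.univ) =>
    S.ip_inn_el_M (lam := lam) (mu := mu) hφ k
  simp only [Finset.sum_add_distrib (s := (Finset.univ : Finset (Fin d))), Finset.sum_sub_distrib,
    ← Finset.mul_sum] at h8 h6 h5
  rw [Finset.sum_const, Finset.card_univ, Fintype.card_fin, nsmul_eq_mul] at h6
  have e : mu / (8 * d) * (d * ∑ j, ∑ i, S.ip (op j S.D (φ i)) (op j S.D (φ i))) =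
      (mu * ∑ j, ∑ i, S.ip (op j S.D (φ i)) (op j S.D (φ i))) / 8 := by field_simp
  rw [e] at h6
  have h9 : S.obs lam mu φ φ = ∑ k, (∑ i, S.fip k S.b (S.obsF lam mu k φ i) (S.obsF lam mu k φ i) +
      S.w S.a * ∑ i, cf lam mu k i ^ 2 *
        S.fip k S.a (op k S.D (op k S.D (φ i))) (op k S.D (op k S.D (φ i))) +
      S.w S.b * ∑ i, cf lam mu k i ^ 2 *
        S.fip k S.b (op k S.D (op k S.D (φ i))) (op k S.D (op k S.D (φ i)))) := by
    simp only [obs, Finset.sum_add_distrib, ← Finset.mul_sum]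
  simp only [Finset.sum_add_distrib, ← Finset.mul_sum] at h9 h6
  rw [Finset.sum_add_distrib, Finset.sum_add_distrib, h1, h2, h3, h4, h9]
  have h10 : S.en2 lam mu φ χ = ∑ i, S.ip (χ i) (χ i) + S.af lam mu φ φ := rfl
  simp only [← Finset.sum_div] at h8 h6
  simp only [Finset.sum_add_distrib] at h8 h6
  linarith

end LGLData

section Flow

variable {V : Type*} [NormedAddCommGroup V] [NormedSpace ℝ V] [FiniteDimensional ℝ V]

theorem continuous_bilin (B : V →ₗ[ℝ] V →ₗ[ℝ] ℝ) {x y : ℝ → V} (hx : Continuous x)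
    (hy : Continuous y) : Continuous fun t => B (x t) (y t) := by
  have h := ((LinearMap.toContinuousLinearMap
    ((LinearMap.toContinuousLinearMap : (V →ₗ[ℝ] ℝ) ≃ₗ[ℝ] (V →L[ℝ] ℝ)).toLinearMap ∘ₗ B)).continuous.comp
      hx).clm_apply hy
  exact h

theorem hasDerivAt_bilin (B : V →ₗ[ℝ] V →ₗ[ℝ] ℝ) {x y : ℝ → V} {x' y' : V} {t : ℝ}
    (hx : HasDerivAt x x' t) (hy : HasDerivAt y y' t) :
    HasDerivAt (fun t => B (x t) (y t)) (B x' (y t) + B (x t) y') t := by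
  have h := (((LinearMap.toContinuousLinearMap
    ((LinearMap.toContinuousLinearMap : (V →ₗ[ℝ] ℝ) ≃ₗ[ℝ] (V →L[ℝ] ℝ)).toLinearMap ∘ₗ
      B)).hasFDerivAt.comp_hasDerivAt t hx).clm_apply hy)
  exact h

theorem analyticOnNhd_bilin (B : V →ₗ[ℝ] V →ₗ[ℝ] ℝ) {x y : ℝ → V}
    (hx : AnalyticOnNhd ℝ x Set.univ) (hy : AnalyticOnNhd ℝ y Set.univ) :
    AnalyticOnNhd ℝ (fun t => B (x t) (y t)) Set.univ := by
  have h1 : AnalyticOnNhd ℝ (fun t => LinearMap.toContinuousLinearMap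
      ((LinearMap.toContinuousLinearMap : (V →ₗ[ℝ] ℝ) ≃ₗ[ℝ] (V →L[ℝ] ℝ)).toLinearMap ∘ₗ B) (x t))
      Set.univ :=
    (ContinuousLinearMap.analyticOnNhd _ Set.univ).comp hx (Set.mapsTo_univ _ _)
  exact fun t ht => (ContinuousLinearMap.analyticAt_bilinear
    (ContinuousLinearMap.id ℝ (V →L[ℝ] ℝ)) _).comp ((h1 t ht).prod (hy t ht))

/-- The generator `(u, v) ↦ (v, K u)`. -/
def waveGen (K : V →ₗ[ℝ] V) : (V × V) →L[ℝ] (V × V) :=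
  LinearMap.toContinuousLinearMap
    ((LinearMap.snd ℝ V V).prod (K ∘ₗ LinearMap.fst ℝ V V))

@[simp] theorem waveGen_apply (K : V →ₗ[ℝ] V) (z : V × V) : waveGen K z = (z.2, K z.1) := rfl

/-- The free flow of `u'' = K u`. -/
def waveFlow (K : V →ₗ[ℝ] V) (t : ℝ) : (V × V) →L[ℝ] (V × V) :=
  NormedSpace.exp (t • waveGen K)

variable [CompleteSpace V]

omit [CompleteSpace V] in
theorem waveFlow_zero (K : V →ₗ[ℝ] V) : waveFlow K 0 = 1 := by
  simp [waveFlow, NormedSpace.exp_zero]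

theorem waveFlow_mul_neg (K : V →ₗ[ℝ] V) (t : ℝ) : waveFlow K t * waveFlow K (-t) = 1 := by
  let _ : NormedAlgebra ℚ (V × V →L[ℝ] V × V) := NormedAlgebra.restrictScalars ℚ ℝ _
  rw [waveFlow, waveFlow, ← NormedSpace.exp_add_of_commute, ← add_smul, add_neg_cancel, zero_smul,
    NormedSpace.exp_zero]
  exact (Commute.refl _).smul_left _ |>.smul_right _

theorem hasDerivAt_waveFlow (K : V →ₗ[ℝ] V) (t : ℝ) :
    HasDerivAt (waveFlow K) (waveGen K * waveFlow K t) t :=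
  hasDerivAt_exp_smul_const' (waveGen K) t

theorem continuous_waveFlow (K : V →ₗ[ℝ] V) : Continuous (waveFlow K) :=
  continuous_iff_continuousAt.2 fun t => (hasDerivAt_waveFlow K t).continuousAt

theorem analyticOnNhd_waveFlow (K : V →ₗ[ℝ] V) (z : V × V) :
    AnalyticOnNhd ℝ (fun t => waveFlow K t z) Set.univ := by
  intro t _
  have h1 : AnalyticAt ℝ (fun t : ℝ => t • waveGen K) t := by fun_prop
  have h2 : AnalyticAt ℝ (waveFlow K) t :=
    AnalyticAt.fun_comp (f := fun t : ℝ => t • waveGen K) (g := NormedSpace.exp) (x := t)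
      (NormedSpace.exp_analytic (𝕂 := ℝ) (t • waveGen K)) h1
  exact ((ContinuousLinearMap.apply ℝ (V × V) z).analyticAt _).comp h2

/-- Solutions of `φ'' = K φ`, as pairs `(φ, φ')`. -/
def IsWave (K : V →ₗ[ℝ] V) (φ χ : ℝ → V) : Prop :=
  (∀ t, HasDerivAt φ (χ t) t) ∧ ∀ t, HasDerivAt χ (K (φ t)) t

theorem isWave_waveFlow (K : V →ₗ[ℝ] V) (z : V × V) :
    IsWave K (fun t => (waveFlow K t z).1) (fun t => (waveFlow K t z).2) := by
  have h : ∀ t, HasDerivAt (fun t => waveFlow K t z) (waveGen K (waveFlow K t z)) t := fun t => by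
    simpa using (hasDerivAt_waveFlow K t).clm_apply (hasDerivAt_const t z)
  exact ⟨fun t => (ContinuousLinearMap.fst ℝ V V).hasFDerivAt.comp_hasDerivAt t (h t),
    fun t => (ContinuousLinearMap.snd ℝ V V).hasFDerivAt.comp_hasDerivAt t (h t)⟩

omit [FiniteDimensional ℝ V] [CompleteSpace V] in
theorem IsWave.continuous {K : V →ₗ[ℝ] V} {φ χ : ℝ → V} (h : IsWave K φ χ) :
    Continuous φ ∧ Continuous χ :=
  ⟨continuous_iff_continuousAt.2 fun t => (h.1 t).continuousAt,
    continuous_iff_continuousAt.2 fun t => (h.2 t).continuousAt⟩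

theorem exists_forced (K : V →ₗ[ℝ] V) {h : ℝ → V × V} (hh : Continuous h) (z : V × V) :
    ∃ Z : ℝ → V × V, Z 0 = z ∧ ∀ t, HasDerivAt Z (waveGen K (Z t) + h t) t := by
  have hc : Continuous fun s => waveFlow K (-s) (h s) :=
    ((continuous_waveFlow K).comp continuous_neg).clm_apply hh
  refine ⟨fun t => waveFlow K t (z + ∫ s in (0 : ℝ)..t, waveFlow K (-s) (h s)), ?_, fun t => ?_⟩
  · simp [waveFlow_zero]
  · have h1 : HasDerivAt (fun t => z + ∫ s in (0 : ℝ)..t, waveFlow K (-s) (h s))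
        (waveFlow K (-t) (h t)) t :=
      (intervalIntegral.integral_hasDerivAt_right (hc.intervalIntegrable _ _)
        (hc.stronglyMeasurableAtFilter _ _) hc.continuousAt).const_add z
    have h2 := (hasDerivAt_waveFlow K t).clm_apply h1
    have h3 : waveFlow K t (waveFlow K (-t) (h t)) = h t := by
      rw [← mul_apply_eq_comp, waveFlow_mul_neg]; rfl
    rw [h3] at h2
    exact h2

variable {K : V →ₗ[ℝ] V} {ip al be : V →ₗ[ℝ] V →ₗ[ℝ] ℝ}

omit [CompleteSpace V] in
theorem energy_const (hips : ∀ u v, ip u v = ip v u) (hals : ∀ u v, al u v = al v u)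
    (hK : ∀ u v, ip (K u) v = -al u v) {φ χ : ℝ → V} (h : IsWave K φ χ) (t : ℝ) :
    ip (χ t) (χ t) + al (φ t) (φ t) = ip (χ 0) (χ 0) + al (φ 0) (φ 0) := by
  have hd : ∀ t, HasDerivAt (fun t => ip (χ t) (χ t) + al (φ t) (φ t)) 0 t := fun t => by
    have h1 := (hasDerivAt_bilin ip (h.2 t) (h.2 t)).add (hasDerivAt_bilin al (h.1 t) (h.1 t))
    refine h1.congr_deriv ?_
    rw [hips (χ t) (K (φ t)), hK, hals (χ t) (φ t)]; ring
  exact is_const_of_deriv_eq_zero (fun t => (hd t).differentiableAt) (fun t => (hd t).deriv) t 0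

omit [CompleteSpace V] in
theorem observability_of_virial (hips : ∀ u v, ip u v = ip v u) (hals : ∀ u v, al u v = al v u)
    (hK : ∀ u v, ip (K u) v = -al u v) (m : V →ₗ[ℝ] V →ₗ[ℝ] ℝ) {e c c1 : ℝ}
    (vir : ∀ φ χ, e * (ip χ χ + al φ φ) ≤ -(m φ (K φ) + m χ χ) + c * be φ φ)
    (bd : ∀ φ χ, |m φ χ| ≤ c1 * (ip χ χ + al φ φ)) {φ χ : ℝ → V} (h : IsWave K φ χ)
    {T : ℝ} (hT : 0 ≤ T) :
    (e * T - 2 * c1) * (ip (χ 0) (χ 0) + al (φ 0) (φ 0)) ≤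
      c * ∫ t in (0 : ℝ)..T, be (φ t) (φ t) := by
  have hE := energy_const hips hals hK h
  set E := ip (χ 0) (χ 0) + al (φ 0) (φ 0) with hEdef
  have hm : ∀ t, HasDerivAt (fun t => m (φ t) (χ t))
      (m (χ t) (χ t) + m (φ t) (K (φ t))) t := fun t => hasDerivAt_bilin m (h.1 t) (h.2 t)
  obtain ⟨hφ, hχ⟩ := h.continuous
  have hKφ : Continuous fun t => K (φ t) :=
    (LinearMap.toContinuousLinearMap K).continuous.comp hφ
  have hc1 : Continuous fun t => m (χ t) (χ t) + m (φ t) (K (φ t)) :=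
    (continuous_bilin m hχ hχ).add (continuous_bilin m hφ hKφ)
  have hc2 : Continuous fun t => be (φ t) (φ t) := continuous_bilin be hφ hφ
  have hparts := intervalIntegral.integral_eq_sub_of_hasDerivAt (fun t _ => hm t)
    (hc1.intervalIntegrable 0 T)
  have hmono : ∫ t in (0 : ℝ)..T, e * E ≤
      ∫ t in (0 : ℝ)..T, (-(m (χ t) (χ t) + m (φ t) (K (φ t))) + c * be (φ t) (φ t)) := by
    refine intervalIntegral.integral_mono_on hT (continuous_const.intervalIntegrable _ _)
      ((hc1.neg.add (hc2.const_mul c)).intervalIntegrable _ _) fun t _ => ?_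
    have h1 := vir (φ t) (χ t)
    rw [hE t] at h1
    linarith
  rw [intervalIntegral.integral_const, intervalIntegral.integral_add
    (f := fun t => -(m (χ t) (χ t) + m (φ t) (K (φ t))))
    (hc1.neg.intervalIntegrable _ _) ((hc2.const_mul c).intervalIntegrable _ _),
    intervalIntegral.integral_neg, hparts, intervalIntegral.integral_const_mul] at hmono
  have b1 := bd (φ 0) (χ 0)
  have b2 := bd (φ T) (χ T)
  rw [hE T] at b2
  rw [← hEdef] at b1
  have b3 := abs_le.1 b1
  have b4 := abs_le.1 b2
  simp only [smul_eq_mul, sub_zero] at hmono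
  nlinarith [b3.1, b3.2, b4.1, b4.2]

/-- The Gram form of the free flow. -/
def waveGram (K : V →ₗ[ℝ] V) (be : V →ₗ[ℝ] V →ₗ[ℝ] ℝ) (T : ℝ) :
    (V × V) →ₗ[ℝ] (V × V) →ₗ[ℝ] ℝ :=
  LinearMap.mk₂ ℝ (fun z z' => ∫ t in (0 : ℝ)..T, be (waveFlow K t z).1 (waveFlow K t z').1)
    (fun z₁ z₂ z' => by
      simp only [map_add, Prod.fst_add, LinearMap.add_apply]
      exact intervalIntegral.integral_add
        ((continuous_bilin be (isWave_waveFlow K _).continuous.1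
          (isWave_waveFlow K _).continuous.1).intervalIntegrable _ _)
        ((continuous_bilin be (isWave_waveFlow K _).continuous.1
          (isWave_waveFlow K _).continuous.1).intervalIntegrable _ _))
    (fun r z z' => by
      simp only [map_smul, Prod.smul_fst, LinearMap.smul_apply]
      exact intervalIntegral.integral_smul _ _)
    (fun z z₁ z₂ => by
      simp only [map_add, Prod.fst_add]
      exact intervalIntegral.integral_add
        ((continuous_bilin be (isWave_waveFlow K _).continuous.1
          (isWave_waveFlow K _).continuous.1).intervalIntegrable _ _)
        ((continuous_bilin be (isWave_waveFlow K _).continuous.1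
          (isWave_waveFlow K _).continuous.1).intervalIntegrable _ _))
    (fun r z z' => by
      simp only [map_smul, Prod.smul_fst]
      exact intervalIntegral.integral_smul _ _)

theorem waveGram_apply (z z' : V × V) (T : ℝ) :
    waveGram K be T z z' = ∫ t in (0 : ℝ)..T, be (waveFlow K t z).1 (waveFlow K t z').1 := rfl

theorem exists_bound_of_injective (hbe : ∀ u, 0 ≤ be u u) {T : ℝ} (hT : 0 ≤ T)
    (hinj : ∀ z, waveGram K be T z z = 0 → z = 0) :
    ∃ C > 0, ∀ z : V × V, ip z.2 z.2 + al z.1 z.1 ≤ C * waveGram K be T z z := by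
  have hcont : Continuous fun z : V × V => waveGram K be T z z := by
    have := ((LinearMap.toContinuousLinearMap
      ((LinearMap.toContinuousLinearMap : (V × V →ₗ[ℝ] ℝ) ≃ₗ[ℝ] (V × V →L[ℝ] ℝ)).toLinearMap ∘ₗ
        waveGram K be T)).continuous).clm_apply continuous_id
    exact this
  have hcont2 : Continuous fun z : V × V => ip z.2 z.2 + al z.1 z.1 := by
    have h1 := ((LinearMap.toContinuousLinearMap
      ((LinearMap.toContinuousLinearMap : (V →ₗ[ℝ] ℝ) ≃ₗ[ℝ] (V →L[ℝ] ℝ)).toLinearMap ∘ₗ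
        ip)).continuous).comp (continuous_snd (X := V)) |>.clm_apply continuous_snd
    have h2 := ((LinearMap.toContinuousLinearMap
      ((LinearMap.toContinuousLinearMap : (V →ₗ[ℝ] ℝ) ≃ₗ[ℝ] (V →L[ℝ] ℝ)).toLinearMap ∘ₗ
        al)).continuous).comp (continuous_fst (Y := V)) |>.clm_apply continuous_fst
    exact h1.add h2
  have hnn : ∀ z, 0 ≤ waveGram K be T z z := fun z => by
    rw [waveGram_apply]; exact intervalIntegral.integral_nonneg hT fun t _ => hbe _
  have hcpt : IsCompact (Metric.sphere (0 : V × V) 1) := by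
    have : ProperSpace (V × V) := FiniteDimensional.proper ℝ _
    exact isCompact_sphere _ _
  rcases (Metric.sphere (0 : V × V) 1).eq_empty_or_nonempty with he | hne
  · refine ⟨1, one_pos, fun z => ?_⟩
    have hz : z = 0 := by
      by_contra hz
      have : (‖z‖⁻¹ • z) ∈ Metric.sphere (0 : V × V) 1 := by
        simp [norm_smul, inv_mul_cancel₀ (norm_ne_zero_iff.2 hz)]
      rw [he] at this; exact this
    subst hz; simp
  obtain ⟨z0, hz0, hmin⟩ := hcpt.exists_isMinOn hne hcont.continuousOn
  obtain ⟨z1, hz1, hmax⟩ := hcpt.exists_isMaxOn hne hcont2.continuousOn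
  have hq : 0 < waveGram K be T z0 z0 := by
    refine lt_of_le_of_ne (hnn z0) fun h => ?_
    have := hinj z0 h.symm
    rw [this] at hz0; simp at hz0
  set q := waveGram K be T z0 z0
  set p := ip z1.2 z1.2 + al z1.1 z1.1
  refine ⟨(|p| + 1) / q, by positivity, fun z => ?_⟩
  by_cases hz : z = 0
  · subst hz; simp
  have hzn : 0 < ‖z‖ := norm_pos_iff.2 hz
  have hmem : (‖z‖⁻¹ • z) ∈ Metric.sphere (0 : V × V) 1 := by
    simp [norm_smul, inv_mul_cancel₀ hzn.ne']
  have a1 : q ≤ waveGram K be T (‖z‖⁻¹ • z) (‖z‖⁻¹ • z) := hmin hmem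
  have a2 : ip (‖z‖⁻¹ • z).2 (‖z‖⁻¹ • z).2 + al (‖z‖⁻¹ • z).1 (‖z‖⁻¹ • z).1 ≤ p := hmax hmem
  simp only [map_smul, LinearMap.smul_apply, smul_eq_mul, Prod.smul_fst, Prod.smul_snd] at a1 a2
  have e1 : ‖z‖ ^ 2 * (‖z‖⁻¹ * (‖z‖⁻¹ * waveGram K be T z z)) = waveGram K be T z z := by
    field_simp
  have e2 : ‖z‖ ^ 2 * (‖z‖⁻¹ * (‖z‖⁻¹ * ip z.2 z.2) + ‖z‖⁻¹ * (‖z‖⁻¹ * al z.1 z.1)) =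
      ip z.2 z.2 + al z.1 z.1 := by field_simp
  rw [← e1, ← e2]
  have a3 : p ≤ (|p| + 1) / q * (‖z‖⁻¹ * (‖z‖⁻¹ * waveGram K be T z z)) := by
    have := mul_le_mul_of_nonneg_left a1 (by positivity : 0 ≤ (|p| + 1) / q)
    rw [div_mul_cancel₀ _ hq.ne'] at this
    linarith [le_abs_self p]
  have := mul_le_mul_of_nonneg_left (a2.trans a3) (sq_nonneg ‖z‖)
  linarith

theorem waveGram_injective (hips : ∀ u v, ip u v = ip v u) (hals : ∀ u v, al u v = al v u)
    (hK : ∀ u v, ip (K u) v = -al u v) (m : V →ₗ[ℝ] V →ₗ[ℝ] ℝ) {e c c1 : ℝ} (he : 0 < e)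
    (vir : ∀ φ χ, e * (ip χ χ + al φ φ) ≤ -(m φ (K φ) + m χ χ) + c * be φ φ)
    (bd : ∀ φ χ, |m φ χ| ≤ c1 * (ip χ χ + al φ φ)) (hbe : ∀ u, 0 ≤ be u u)
    (hpos : ∀ z : V × V, ip z.2 z.2 + al z.1 z.1 ≤ 0 → z = 0)
    {T : ℝ} (hT : 0 < T) (z : V × V) (hz : waveGram K be T z z = 0) : z = 0 := by
  have hw := isWave_waveFlow K z
  have hc : Continuous fun t => be (waveFlow K t z).1 (waveFlow K t z).1 :=
    continuous_bilin be hw.continuous.1 hw.continuous.1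
  have hzero : ∀ t ∈ Set.Ioo 0 T, be (waveFlow K t z).1 (waveFlow K t z).1 = 0 := by
    by_contra! hcon
    obtain ⟨t, ht, hne⟩ := hcon
    have : 0 < ∫ t in (0 : ℝ)..T, be (waveFlow K t z).1 (waveFlow K t z).1 :=
      intervalIntegral.integral_pos hT hc.continuousOn (fun t _ => hbe _)
        ⟨t, Set.Ioo_subset_Icc_self ht, lt_of_le_of_ne (hbe _) (Ne.symm hne)⟩
    rw [waveGram_apply] at hz
    linarith
  have han : AnalyticOnNhd ℝ (fun t => be (waveFlow K t z).1 (waveFlow K t z).1) Set.univ := by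
    have h1 : AnalyticOnNhd ℝ (fun t => (waveFlow K t z).1) Set.univ := fun t ht =>
      ((ContinuousLinearMap.fst ℝ V V).analyticAt _).comp (analyticOnNhd_waveFlow K z t ht)
    exact analyticOnNhd_bilin be h1 h1
  have hall : (fun t => be (waveFlow K t z).1 (waveFlow K t z).1) = fun _ => (0 : ℝ) := by
    refine han.eq_of_eventuallyEq (z₀ := T / 2) (fun t _ => analyticAt_const) ?_
    filter_upwards [Ioo_mem_nhds (show 0 < T / 2 by linarith) (show T / 2 < T by linarith)] with t ht
    exact hzero t ht
  have hob := observability_of_virial hips hals hK m vir bd hw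
    (T := (2 * |c1| + 1) / e) (by positivity)
  have hi : ∫ t in (0 : ℝ)..((2 * |c1| + 1) / e), be (waveFlow K t z).1 (waveFlow K t z).1 = 0 := by
    rw [hall]; simp
  rw [hi, mul_zero, mul_div_cancel₀ _ he.ne', waveFlow_zero] at hob
  refine hpos z ?_
  simp only [one_apply_eq_self] at hob
  have h1 := le_abs_self c1
  by_contra! hgt
  nlinarith

theorem hilbert_uniqueness (hips : ∀ u v, ip u v = ip v u)
    (hip : ∀ u, ip u u = 0 → u = 0) (hals : ∀ u v, al u v = al v u)
    (hK : ∀ u v, ip (K u) v = -al u v) {B : V →ₗ[ℝ] V} (hB : ∀ u v, ip (B u) v = be u v)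
    {T : ℝ} (hinj : ∀ z, waveGram K be T z z = 0 → z = 0) (u0 u1 : V) {C : ℝ} (hC0 : 0 ≤ C)
    (hC : ∀ z : V × V, (ip u1 z.1 - ip u0 z.2) ^ 2 ≤ C * waveGram K be T z z)
    (hnn : ∀ z, 0 ≤ waveGram K be T z z) :
    ∃ φ χ U W : ℝ → V, IsWave K φ χ ∧ (∀ t, HasDerivAt U (W t) t) ∧
      (∀ t, HasDerivAt W (K (U t) + B (φ t)) t) ∧ U 0 = u0 ∧ W 0 = u1 ∧ U T = 0 ∧ W T = 0 ∧
      ∫ t in (0 : ℝ)..T, be (φ t) (φ t) ≤ C := by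
  have hbij : Function.Injective (waveGram K be T) := by
    rw [← LinearMap.ker_eq_bot, LinearMap.ker_eq_bot']
    exact fun z hz => hinj z (by rw [hz]; rfl)
  have hsurj : Function.Surjective (waveGram K be T) := by
    refine (LinearMap.injective_iff_surjective_of_finrank_eq_finrank ?_).1 hbij
    exact (Subspace.dual_finrank_eq).symm
  let b : (V × V) →ₗ[ℝ] ℝ := ip u1 ∘ₗ LinearMap.fst ℝ V V - ip u0 ∘ₗ LinearMap.snd ℝ V V
  obtain ⟨z, hz⟩ := hsurj (-b)
  have hz' : ∀ z', waveGram K be T z z' = -(ip u1 z'.1 - ip u0 z'.2) := fun z' => by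
    rw [hz]; rfl
  have hw := isWave_waveFlow K z
  have hφ := hw.continuous.1
  have hBφ : Continuous fun t => ((0 : V), B (waveFlow K t z).1) :=
    continuous_const.prodMk ((LinearMap.toContinuousLinearMap B).continuous.comp hφ)
  obtain ⟨Z, hZ0, hZ⟩ := exists_forced K hBφ (u0, u1)
  have hU : ∀ t, HasDerivAt (fun t => (Z t).1) (Z t).2 t := fun t => by
    refine ((ContinuousLinearMap.fst ℝ V V).hasFDerivAt.comp_hasDerivAt t (hZ t)).congr_deriv ?_
    simp
  have hW : ∀ t, HasDerivAt (fun t => (Z t).2) (K (Z t).1 + B (waveFlow K t z).1) t := fun t => by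
    refine ((ContinuousLinearMap.snd ℝ V V).hasFDerivAt.comp_hasDerivAt t (hZ t)).congr_deriv ?_
    simp
  have hdual : ∀ z', ip (Z T).2 (waveFlow K T z').1 - ip (Z T).1 (waveFlow K T z').2 = 0 := by
    intro z'
    have hw' := isWave_waveFlow K z'
    have hd : ∀ t, HasDerivAt (fun t => ip (Z t).2 (waveFlow K t z').1 -
        ip (Z t).1 (waveFlow K t z').2) (be (waveFlow K t z).1 (waveFlow K t z').1) t := fun t => by
      refine ((hasDerivAt_bilin ip (hW t) (hw'.1 t)).sub
        (hasDerivAt_bilin ip (hU t) (hw'.2 t))).congr_deriv ?_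
      simp only [map_add, LinearMap.add_apply, hB, hK]
      rw [hips (Z t).1 (K _), hK, hals (waveFlow K t z').1]
      ring
    have hparts := intervalIntegral.integral_eq_sub_of_hasDerivAt (fun t _ => hd t)
      ((continuous_bilin be hφ hw'.continuous.1).intervalIntegrable 0 T)
    rw [← waveGram_apply, hz', hZ0, waveFlow_zero] at hparts
    simp only [one_apply_eq_self] at hparts
    linarith
  have hsj : ∀ y : V × V, ∃ z', waveFlow K T z' = y := fun y => ⟨waveFlow K (-T) y, by
    rw [← mul_apply_eq_comp, waveFlow_mul_neg]; rfl⟩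
  refine ⟨_, _, fun t => (Z t).1, fun t => (Z t).2, hw, hU, hW, congrArg Prod.fst hZ0, congrArg Prod.snd hZ0, ?_, ?_, ?_⟩
  · obtain ⟨z', hz'⟩ := hsj (0, (Z T).1)
    have := hdual z'
    rw [hz'] at this
    simp only [map_zero, zero_sub, neg_eq_zero] at this
    exact hip _ this
  · obtain ⟨z', hz'⟩ := hsj ((Z T).2, 0)
    have := hdual z'
    rw [hz'] at this
    simp only [map_zero, sub_zero] at this
    exact hip _ this
  · change waveGram K be T z z ≤ C
    have h1 := hC z
    have h2 := hz' z
    have h3 := hnn z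
    rcases h3.lt_or_eq with h | h
    · refine le_of_mul_le_mul_right ?_ h
      rw [h2] at h1 ⊢
      linarith [h1]
    · rw [← h]; exact hC0

end Flow

namespace LGLData

variable {n : Type} [Fintype n] [DecidableEq n] (S : LGLData n) {d : ℕ}

theorem dv_add (φ ψ : Fin d → (Fin d → n) → ℝ) : S.dv (φ + ψ) = S.dv φ + S.dv ψ := by
  simp only [dv, Pi.add_apply, map_add, Finset.sum_add_distrib]

theorem dv_smul (c : ℝ) (φ : Fin d → (Fin d → n) → ℝ) : S.dv (c • φ) = c • S.dv φ := by
  simp only [dv, Pi.smul_apply, map_smul, Finset.smul_sum]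

/-- The discrete elasticity operator as a linear map. -/
def elL (lam mu : ℝ) : (Fin d → (Fin d → n) → ℝ) →ₗ[ℝ] (Fin d → (Fin d → n) → ℝ) where
  toFun := S.el lam mu
  map_add' φ ψ := by
    funext i
    simp only [el, dv_add, Pi.add_apply, map_add, Finset.sum_add_distrib, smul_add]
    abel
  map_smul' c φ := by
    funext i
    simp only [el, dv_smul, Pi.smul_apply, map_smul, ← Finset.smul_sum, RingHom.id_apply, smul_add,
      smul_comm c]

theorem el_add (lam mu : ℝ) (φ ψ : Fin d → (Fin d → n) → ℝ) (i : Fin d) :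
    S.el lam mu (φ + ψ) i = S.el lam mu φ i + S.el lam mu ψ i :=
  congrFun ((S.elL lam mu).map_add φ ψ) i

theorem el_smul (lam mu : ℝ) (c : ℝ) (φ : Fin d → (Fin d → n) → ℝ) (i : Fin d) :
    S.el lam mu (c • φ) i = c • S.el lam mu φ i :=
  congrFun ((S.elL lam mu).map_smul c φ) i

theorem obsF_add (lam mu : ℝ) (k : Fin d) (φ ψ : Fin d → (Fin d → n) → ℝ) (i : Fin d) :
    S.obsF lam mu k (φ + ψ) i = S.obsF lam mu k φ i + S.obsF lam mu k ψ i := by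
  simp only [obsF, el_add, Pi.add_apply, ← map_add]
  congr 1
  simp only [map_add, smul_add]; abel

theorem obsF_smul (lam mu : ℝ) (k : Fin d) (c : ℝ) (φ : Fin d → (Fin d → n) → ℝ) (i : Fin d) :
    S.obsF lam mu k (c • φ) i = c • S.obsF lam mu k φ i := by
  simp only [obsF, el_smul, Pi.smul_apply, ← map_smul]
  congr 1
  simp only [map_smul, smul_sub, smul_comm c]

/-- The Dirichlet lift of the first observation. -/
def lift (lam mu : ℝ) : (Fin d → (Fin d → n) → ℝ) →ₗ[ℝ] (Fin d → (Fin d → n) → ℝ) where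
  toFun φ i := -(S.w S.b • ∑ k, op k (S.F S.b) (S.obsF lam mu k φ i))
  map_add' φ ψ := by
    funext i
    simp only [obsF_add, Pi.add_apply, map_add, Finset.sum_add_distrib, smul_add]
    abel
  map_smul' c φ := by
    funext i
    simp only [obsF_smul, Pi.smul_apply, map_smul, ← Finset.smul_sum, RingHom.id_apply, smul_neg,
      smul_comm c]

theorem lift_apply (lam mu : ℝ) (φ : Fin d → (Fin d → n) → ℝ) (i : Fin d) :
    S.lift lam mu φ i = -(S.w S.b • ∑ k, op k (S.F S.b) (S.obsF lam mu k φ i)) := rfl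

theorem obsF_van (lam mu : ℝ) {k j : Fin d} (hj : j ≠ k) (φ : Fin d → (Fin d → n) → ℝ)
    (i : Fin d) : S.Van j (S.obsF lam mu k φ i) := fun K hK => by
  rw [obsF, tmask_apply, if_neg]
  exact fun h => h j hj hK

theorem op_F_F (k : Fin d) (c : n) (u : (Fin d → n) → ℝ) :
    op k (S.F c) (op k (S.F c) u) = (1 / S.w c) • op k (S.F c) u := by
  funext K
  simp only [F, op_diagonal_apply, Pi.smul_apply, smul_eq_mul]
  split_ifs <;> ring

theorem op_F_F_ne (k : Fin d) {c c' : n} (h : c ≠ c') (u : (Fin d → n) → ℝ) :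
    op k (S.F c) (op k (S.F c') u) = 0 := by
  funext K
  simp only [F, op_diagonal_apply, Pi.zero_apply]
  split_ifs with h1 h2
  · exact absurd (h1.symm.trans h2) h
  all_goals simp

theorem fip_b_lift (lam mu : ℝ) (φ : Fin d → (Fin d → n) → ℝ) (k i : Fin d)
    (p : (Fin d → n) → ℝ) :
    S.fip k S.b (S.lift lam mu φ i) p = -S.fip k S.b (S.obsF lam mu k φ i) p := by
  have hw := (S.w_pos S.b).ne'
  rw [fip_def, lift_apply, map_neg, map_smul, map_sum, Finset.sum_eq_single k]
  · rw [op_F_F, smul_smul, mul_one_div_cancel hw, one_smul, map_neg, LinearMap.neg_apply, fip_def]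
  · intro j _ hj
    rw [op_comm hj.symm, op_F_of_van S.isEnd_b (S.obsF_van lam mu hj.symm φ i), map_zero]
  · simp

theorem fip_a_lift (lam mu : ℝ) (φ : Fin d → (Fin d → n) → ℝ) (k i : Fin d)
    (p : (Fin d → n) → ℝ) :
    S.fip k S.a (S.lift lam mu φ i) p = 0 := by
  rw [fip_def, lift_apply, map_neg, map_smul, map_sum, Finset.sum_eq_zero]
  · simp
  · intro j _
    by_cases hj : j = k
    · subst hj; exact S.op_F_F_ne j S.a_ne_b _
    · rw [op_comm (Ne.symm hj), op_F_of_van S.isEnd_a (S.obsF_van lam mu (Ne.symm hj) φ i), map_zero]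

theorem ip_lift (lam mu : ℝ) (φ : Fin d → (Fin d → n) → ℝ) (i : Fin d)
    (p : (Fin d → n) → ℝ) :
    S.ip (S.lift lam mu φ i) p = -(S.w S.b * ∑ k, S.fip k S.b (S.obsF lam mu k φ i) p) := by
  simp only [lift_apply, map_neg, map_smul, map_sum, LinearMap.neg_apply, LinearMap.smul_apply,
    LinearMap.sum_apply, smul_eq_mul, fip_def]

theorem ip_el_lift {lam mu : ℝ} (φ : Fin d → (Fin d → n) → ℝ) {ψ : Fin d → (Fin d → n) → ℝ}
    (hψ : S.Di ψ) :
    ∑ i, S.ip (S.inn (S.el lam mu (S.lift lam mu φ) i)) (ψ i) =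
      ∑ k, ∑ i, S.fip k S.b (S.obsF lam mu k φ i) (S.obsF lam mu k ψ i) := by
  rw [S.ip_el_eq_neg_af hψ]
  have hob : ∀ k i, S.fip k S.b (S.obsF lam mu k φ i) (S.obsF lam mu k ψ i) =
      cf lam mu k i * S.fip k S.b (S.obsF lam mu k φ i) (op k S.D (ψ i)) -
      S.w S.b * S.fip k S.b (S.obsF lam mu k φ i) (S.el lam mu ψ i) := fun k i => by
    rw [fip_comm]
    conv_lhs => rw [obsF]
    rw [S.fip_tmask (fun j hj => S.obsF_van lam mu hj φ i), fip_comm]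
    simp only [map_sub, map_smul, smul_eq_mul]
  have hD : ∀ k i p, S.ip (op k S.D (S.lift lam mu φ i)) p =
      -S.ip (S.lift lam mu φ i) (op k S.D p) - S.fip k S.b (S.obsF lam mu k φ i) p := fun k i p => by
    rw [ip_D_left, fip_b_lift, fip_a_lift]; ring
  have hdv : ∀ k, S.fip k S.b (S.obsF lam mu k φ k) (S.dv ψ) =
      S.fip k S.b (S.obsF lam mu k φ k) (op k S.D (ψ k)) := fun k => by
    rw [S.dv_eq ψ k, map_add, fip_right _ _ _ _ (S.dvErase k ψ),
      op_F_of_van S.isEnd_b (van_dvErase hψ k), map_zero, add_zero]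
  have hel : ∑ i, S.ip (S.lift lam mu φ i) (S.el lam mu ψ i) =
      mu * ∑ k, ∑ i, S.ip (S.lift lam mu φ i) (op k S.D (op k S.D (ψ i))) +
      (lam + mu) * ∑ k, S.ip (S.lift lam mu φ k) (op k S.D (S.dv ψ)) := by
    simp only [el, map_add, map_smul, smul_eq_mul, map_sum, Finset.sum_add_distrib,
      ← Finset.mul_sum]
    rw [Finset.sum_comm]
  have hel2 : ∑ i, S.ip (S.lift lam mu φ i) (S.el lam mu ψ i) =
      -(S.w S.b * ∑ k, ∑ i, S.fip k S.b (S.obsF lam mu k φ i) (S.el lam mu ψ i)) := by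
    simp only [ip_lift, Finset.sum_neg_distrib, ← Finset.mul_sum]
    rw [Finset.sum_comm]
  simp only [hob, Finset.sum_sub_distrib, sum_cf, ← Finset.mul_sum, Finset.sum_add_distrib]
  have hdvl : S.ip (S.dv (S.lift lam mu φ)) (S.dv ψ) =
      ∑ k, S.ip (op k S.D (S.lift lam mu φ k)) (S.dv ψ) := by
    rw [dv, map_sum, LinearMap.sum_apply]
  rw [af, hdvl]
  simp only [hD, hdv, Finset.sum_sub_distrib, Finset.sum_neg_distrib]
  linarith

/-- Nodal values of the kernel `√ω h̃` attached to the end point `c`, with `σ = 1` at `b` and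
`σ = -1` at `a`. -/
def hk (σ : ℝ) (c : n) : Matrix n n ℝ := -(S.w c) • (S.D * (S.D * S.F c)) + σ • (S.D * S.F c)

theorem hk_apply (σ : ℝ) (c m l : n) : S.hk σ c m l =
    if l = c then -(S.D * S.D) m c + σ * S.D m c / S.w c else 0 := by
  have hw := (S.w_pos c).ne'
  rw [hk, ← Matrix.mul_assoc]
  simp only [F, Matrix.add_apply, Matrix.smul_apply, Matrix.mul_diagonal, smul_eq_mul]
  split_ifs with h
  · subst h; field_simp
  · simp

theorem ip_hk_b {k : Fin d} {ψ : (Fin d → n) → ℝ} (hψ : S.Van k ψ) (u : (Fin d → n) → ℝ) :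
    S.ip (op k (S.hk 1 S.b) u) ψ = -(S.w S.b * S.fip k S.b u (op k S.D (op k S.D ψ))) := by
  have hw := (S.w_pos S.b).ne'
  simp only [hk, op_add, op_smul, op_mul, map_add, map_smul, LinearMap.add_apply,
    LinearMap.smul_apply, smul_eq_mul, ip_D_left_of_van S _ hψ]
  rw [ip_D_left, fip_def _ k S.b (op k (S.F S.b) u), fip_def _ k S.a (op k (S.F S.b) u), op_F_F, op_F_F_ne _ _ S.a_ne_b]
  simp only [map_zero, map_smul, LinearMap.zero_apply, LinearMap.smul_apply, smul_eq_mul, fip_def]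
  field_simp
  ring

theorem ip_hk_a {k : Fin d} {ψ : (Fin d → n) → ℝ} (hψ : S.Van k ψ) (u : (Fin d → n) → ℝ) :
    S.ip (op k (S.hk (-1) S.a) u) ψ = -(S.w S.a * S.fip k S.a u (op k S.D (op k S.D ψ))) := by
  have hw := (S.w_pos S.a).ne'
  simp only [hk, op_add, op_smul, op_mul, map_add, map_smul, LinearMap.add_apply,
    LinearMap.smul_apply, smul_eq_mul, ip_D_left_of_van S _ hψ]
  rw [ip_D_left, fip_def _ k S.b (op k (S.F S.a) u), fip_def _ k S.a (op k (S.F S.a) u), op_F_F, op_F_F_ne _ _ S.a_ne_b.symm]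
  simp only [map_zero, map_smul, LinearMap.zero_apply, LinearMap.smul_apply, smul_eq_mul, fip_def]
  field_simp
  ring

/-- The source term generated by the second family of controls. -/
def src (lam mu : ℝ) : (Fin d → (Fin d → n) → ℝ) →ₗ[ℝ] (Fin d → (Fin d → n) → ℝ) where
  toFun φ i := -∑ k, cf lam mu k i ^ 2 • (op k (S.hk 1 S.b) (op k S.D (op k S.D (φ i))) +
    op k (S.hk (-1) S.a) (op k S.D (op k S.D (φ i))))
  map_add' φ ψ := by
    funext i
    simp only [Pi.add_apply, map_add, Finset.sum_add_distrib, smul_add]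
    abel
  map_smul' c φ := by
    funext i
    simp only [Pi.smul_apply, map_smul, ← Finset.smul_sum, RingHom.id_apply, smul_neg,
      ← smul_add, smul_comm _ c]

theorem src_apply (lam mu : ℝ) (φ : Fin d → (Fin d → n) → ℝ) (i : Fin d) :
    S.src lam mu φ i = -∑ k, cf lam mu k i ^ 2 •
      (op k (S.hk 1 S.b) (op k S.D (op k S.D (φ i))) +
        op k (S.hk (-1) S.a) (op k S.D (op k S.D (φ i)))) := rfl

theorem ip_control {lam mu : ℝ} (φ : Fin d → (Fin d → n) → ℝ) {ψ : Fin d → (Fin d → n) → ℝ}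
    (hψ : S.Di ψ) :
    ∑ i, S.ip (S.inn (S.el lam mu (S.lift lam mu φ) i + S.src lam mu φ i)) (ψ i) =
      S.obs lam mu φ ψ := by
  simp only [map_add, LinearMap.add_apply, Finset.sum_add_distrib]
  rw [ip_el_lift S φ hψ]
  simp only [S.ip_inn_of_di (hψ _), src_apply, map_neg, map_sum, map_smul, map_add,
    LinearMap.neg_apply, LinearMap.sum_apply, LinearMap.smul_apply, LinearMap.add_apply,
    S.ip_hk_a (hψ _ _), S.ip_hk_b (hψ _ _), smul_eq_mul]
  rw [obs, Finset.sum_comm]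
  conv_rhs => rw [Finset.sum_comm]
  simp only [← Finset.sum_neg_distrib, ← Finset.sum_add_distrib]
  refine Finset.sum_congr rfl fun k _ => Finset.sum_congr rfl fun i _ => ?_
  ring

end LGLData

namespace LGLData

variable {n : Type} [Fintype n] [DecidableEq n] (S : LGLData n) {d : ℕ}

theorem gip_sum_le {ι : Type*} (s : Finset ι) (z : ι → (Fin d → n) → ℝ) :
    S.ip (∑ k ∈ s, z k) (∑ k ∈ s, z k) ≤ s.card * ∑ k ∈ s, S.ip (z k) (z k) := by
  simp only [gip_apply]
  rw [Finset.sum_comm, Finset.mul_sum]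
  refine Finset.sum_le_sum fun K _ => ?_
  rw [← Finset.mul_sum, mul_left_comm (s.card : ℝ)]
  refine mul_le_mul_of_nonneg_left ?_ (Finset.prod_nonneg fun _ _ => (S.w_pos _).le)
  have := sq_sum_le_card_mul_sum_sq (s := s) (f := fun k => z k K)
  simp only [Finset.sum_apply]
  calc _ = (∑ k ∈ s, z k K) ^ 2 := by ring
    _ ≤ _ := this
    _ = _ := by simp only [sq]

theorem Mt_eq (hd : 0 < d) (φ : Fin d → (Fin d → n) → ℝ) (i : Fin d) :
    S.Mt φ i = ∑ k, (op k S.M (φ i) - (1 / (2 * d) : ℝ) • φ i) := by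
  have hd' : (d : ℝ) ≠ 0 := by exact_mod_cast hd.ne'
  rw [Mt, Finset.sum_sub_distrib, Finset.sum_const, Finset.card_univ, Fintype.card_fin]
  rw [← Nat.cast_smul_eq_nsmul ℝ, smul_smul]
  congr 2
  field_simp

theorem sum_ip_Mt_le (hd : 0 < d) {φ : Fin d → (Fin d → n) → ℝ} (hφ : S.Di φ) :
    ∑ i, S.ip (S.Mt φ i) (S.Mt φ i) ≤
      18 * d * ∑ k, ∑ i, S.ip (op k S.D (φ i)) (op k S.D (φ i)) := by
  have hd' : (1 : ℝ) ≤ d := by exact_mod_cast hd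
  rw [Finset.sum_comm, Finset.mul_sum]
  refine Finset.sum_le_sum fun i _ => ?_
  rw [S.Mt_eq hd]
  refine (S.gip_sum_le _ _).trans ?_
  rw [Finset.card_univ, Fintype.card_fin, mul_comm (18 : ℝ), mul_assoc]
  refine mul_le_mul_of_nonneg_left ?_ (by linarith)
  rw [Finset.mul_sum]
  refine Finset.sum_le_sum fun k _ => S.ip_M_aux (hφ i k) (by positivity) ?_
  rw [div_le_div_iff₀ (by positivity) (by norm_num)]
  linarith

theorem le_af {lam mu : ℝ} (hlam : 0 < lam) (hmu : 0 < mu) (φ : Fin d → (Fin d → n) → ℝ) :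
    mu * ∑ k, ∑ i, S.ip (op k S.D (φ i)) (op k S.D (φ i)) ≤ S.af lam mu φ φ := by
  rw [af]
  have := gip_self_nonneg S.w_pos (S.dv φ)
  have h2 : 0 ≤ (lam + mu) * S.ip (S.dv φ) (S.dv φ) := mul_nonneg (by linarith) this
  linarith

theorem abs_sum_ip_le {lam mu : ℝ} {c : ℝ} (hc : 0 < c) {φ χ ζ : Fin d → (Fin d → n) → ℝ}
    (h : ∑ i, S.ip (ζ i) (ζ i) ≤ c ^ 2 * S.af lam mu φ φ) :
    |∑ i, S.ip (χ i) (ζ i)| ≤ c / 2 * S.en2 lam mu φ χ := by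
  have key : ∀ χ : Fin d → (Fin d → n) → ℝ, ∑ i, S.ip (χ i) (ζ i) ≤ c / 2 * S.en2 lam mu φ χ := by
    intro χ
    calc ∑ i, S.ip (χ i) (ζ i) ≤ ∑ i, (c / 2 * S.ip (χ i) (χ i) + 1 / (2 * c) * S.ip (ζ i) (ζ i)) :=
          Finset.sum_le_sum fun i _ => S.ip_young _ _ hc
      _ = c / 2 * ∑ i, S.ip (χ i) (χ i) + 1 / (2 * c) * ∑ i, S.ip (ζ i) (ζ i) := by
          rw [Finset.sum_add_distrib, Finset.mul_sum, Finset.mul_sum]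
      _ ≤ c / 2 * ∑ i, S.ip (χ i) (χ i) + 1 / (2 * c) * (c ^ 2 * S.af lam mu φ φ) := by
          gcongr
      _ = _ := by rw [en2]; field_simp
  rw [abs_le]
  refine ⟨?_, key χ⟩
  have := key (-χ)
  simp only [en2, Pi.neg_apply, map_neg, LinearMap.neg_apply, Finset.sum_neg_distrib, neg_neg] at this
  rw [en2]; linarith

/-- The multiplier functional of the virial inequality. -/
def mult (lam mu : ℝ) (φ χ : Fin d → (Fin d → n) → ℝ) : ℝ :=
  ∑ i, S.ip (χ i) (S.Mt φ i) +
    virialC d lam mu / S.N * ∑ i, S.ip (χ i) (∑ k, op k S.D (φ i))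

theorem abs_mult_le {lam mu : ℝ} (hd : 0 < d) (hlam : 0 < lam) (hmu : 0 < mu)
    {φ χ : Fin d → (Fin d → n) → ℝ} (hφ : S.Di φ) :
    |S.mult lam mu φ χ| ≤
      (Real.sqrt (18 * d / mu) + virialC d lam mu / S.N * Real.sqrt (d / mu)) / 2 *
        S.en2 lam mu φ χ := by
  have hd' : (0 : ℝ) < d := by exact_mod_cast hd
  have hv := virialC_nonneg (d := d) hlam hmu
  have hN := S.N_pos
  have ha := S.le_af hlam hmu φ
  set G := ∑ k, ∑ i, S.ip (op k S.D (φ i)) (op k S.D (φ i)) with hG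
  have e1 : ∑ i, S.ip (S.Mt φ i) (S.Mt φ i) ≤ Real.sqrt (18 * d / mu) ^ 2 * S.af lam mu φ φ := by
    rw [Real.sq_sqrt (by positivity)]
    refine (S.sum_ip_Mt_le hd hφ).trans ?_
    rw [← hG, div_mul_eq_mul_div, le_div_iff₀ hmu]
    nlinarith
  have e2 : ∑ i, S.ip (∑ k, op k S.D (φ i)) (∑ k, op k S.D (φ i)) ≤
      Real.sqrt (d / mu) ^ 2 * S.af lam mu φ φ := by
    rw [Real.sq_sqrt (by positivity)]
    calc _ ≤ ∑ i, (d : ℝ) * ∑ k, S.ip (op k S.D (φ i)) (op k S.D (φ i)) := by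
            refine Finset.sum_le_sum fun i _ => (S.gip_sum_le _ _).trans ?_
            rw [Finset.card_univ, Fintype.card_fin]
      _ = d * G := by rw [← Finset.mul_sum, Finset.sum_comm]
      _ ≤ _ := by
            rw [div_mul_eq_mul_div, le_div_iff₀ hmu]
            nlinarith
  have b1 := S.abs_sum_ip_le (χ := χ) (Real.sqrt_pos.2 (by positivity)) e1
  have b2 := S.abs_sum_ip_le (χ := χ) (Real.sqrt_pos.2 (by positivity)) e2
  rw [mult]
  refine (abs_add_le _ _).trans ?_
  rw [abs_mul, abs_of_nonneg (by positivity : 0 ≤ virialC d lam mu / (S.N : ℝ))]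
  have b3 := mul_le_mul_of_nonneg_left b2 (by positivity : 0 ≤ virialC d lam mu / (S.N : ℝ))
  calc _ ≤ _ := add_le_add b1 b3
    _ = _ := by ring

theorem obs_self_nonneg (lam mu : ℝ) (φ : Fin d → (Fin d → n) → ℝ) : 0 ≤ S.obs lam mu φ φ := by
  rw [obs]
  have := fun k c u => S.fip_self_nonneg (d := d) k c u
  refine Finset.sum_nonneg fun k _ => Finset.sum_nonneg fun i _ => ?_
  have ha := S.w_pos S.a
  have hb := S.w_pos S.b
  exact add_nonneg (add_nonneg (this _ _ _) (mul_nonneg ha.le (mul_nonneg (sq_nonneg _) (this _ _ _))))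
    (mul_nonneg hb.le (mul_nonneg (sq_nonneg _) (this _ _ _)))

theorem af_comm (lam mu : ℝ) (φ ψ : Fin d → (Fin d → n) → ℝ) :
    S.af lam mu φ ψ = S.af lam mu ψ φ := by
  simp only [af]
  rw [gip_comm]
  congr 2
  exact Finset.sum_congr rfl fun k _ => Finset.sum_congr rfl fun i _ => gip_comm _ _ _ _

/-- The space of Dirichlet grid fields. -/
def diS (d : ℕ) : Submodule ℝ (Fin d → (Fin d → n) → ℝ) where
  carrier := {φ | S.Di φ}
  add_mem' hφ hψ i k := (hφ i k).add (hψ i k)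
  zero_mem' _ _ _ _ := rfl
  smul_mem' c _ hφ i k := (hφ i k).smul c

theorem di_inn (φ : Fin d → (Fin d → n) → ℝ) : S.Di fun i => S.inn (φ i) := fun i k K hK => by
  change S.inn (φ i) K = 0
  rw [inn_apply, if_neg]
  exact fun h => h k hK

/-- Interior restriction of a field, as a map into the Dirichlet fields. -/
def innS : (Fin d → (Fin d → n) → ℝ) →ₗ[ℝ] S.diS d where
  toFun φ := ⟨fun i => S.inn (φ i), S.di_inn φ⟩
  map_add' φ ψ := by ext1; funext i; exact map_add S.inn _ _
  map_smul' c φ := by ext1; funext i; exact map_smul S.inn _ _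

/-- The generator of the collocation wave equation. -/
def Kop (lam mu : ℝ) : S.diS d →ₗ[ℝ] S.diS d := S.innS ∘ₗ S.elL lam mu ∘ₗ (S.diS d).subtype

/-- The control operator. -/
def Bop (lam mu : ℝ) : S.diS d →ₗ[ℝ] S.diS d :=
  S.innS ∘ₗ (S.elL lam mu ∘ₗ S.lift lam mu + S.src lam mu) ∘ₗ (S.diS d).subtype

/-- The inner product of Dirichlet fields. -/
def ipV : S.diS d →ₗ[ℝ] S.diS d →ₗ[ℝ] ℝ :=
  LinearMap.mk₂ ℝ (fun φ ψ => ∑ i, S.ip (φ.1 i) (ψ.1 i))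
    (fun _ _ _ => by simp [Finset.sum_add_distrib])
    (fun _ _ _ => by simp [Finset.mul_sum])
    (fun _ _ _ => by simp [Finset.sum_add_distrib])
    (fun _ _ _ => by simp [Finset.mul_sum])

/-- The elastic energy form. -/
def afV (lam mu : ℝ) : S.diS d →ₗ[ℝ] S.diS d →ₗ[ℝ] ℝ :=
  -(S.ipV ∘ₗ S.Kop lam mu)

theorem ipV_apply (φ ψ : S.diS d) : S.ipV φ ψ = ∑ i, S.ip (φ.1 i) (ψ.1 i) := rfl

theorem afV_apply (lam mu : ℝ) (φ ψ : S.diS d) : S.afV lam mu φ ψ = S.af lam mu φ.1 ψ.1 := by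
  have := S.ip_el_eq_neg_af (lam := lam) (mu := mu) (φ := φ.1) ψ.2
  rw [← neg_eq_iff_eq_neg] at this
  rw [← this]; rfl

/-- The observation form on Dirichlet fields. -/
def obsV (lam mu : ℝ) : S.diS d →ₗ[ℝ] S.diS d →ₗ[ℝ] ℝ := S.ipV ∘ₗ S.Bop lam mu

theorem obsV_apply (lam mu : ℝ) (φ ψ : S.diS d) : S.obsV lam mu φ ψ = S.obs lam mu φ.1 ψ.1 :=
  S.ip_control φ.1 ψ.2

/-- The multiplier functional on Dirichlet fields. -/
def multV (lam mu : ℝ) : S.diS d →ₗ[ℝ] S.diS d →ₗ[ℝ] ℝ :=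
  LinearMap.mk₂ ℝ (fun φ χ => S.mult lam mu φ.1 χ.1)
    (fun _ _ _ => by
      simp only [mult, Mt, Submodule.coe_add, Pi.add_apply, map_add, smul_add, map_sub, map_smul,
        Finset.sum_add_distrib, Finset.sum_sub_distrib]
      ring)
    (fun _ _ _ => by
      simp only [mult, Mt, Submodule.coe_smul, Pi.smul_apply, map_sub, map_smul, ← Finset.smul_sum,
        Finset.sum_sub_distrib, smul_eq_mul, ← Finset.mul_sum]
      ring)
    (fun _ _ _ => by
      simp only [mult, Submodule.coe_add, Pi.add_apply, map_add, LinearMap.add_apply,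
        Finset.sum_add_distrib]
      ring)
    (fun _ _ _ => by
      simp only [mult, Submodule.coe_smul, Pi.smul_apply, map_smul, LinearMap.smul_apply,
        smul_eq_mul, ← Finset.mul_sum]
      ring)

theorem multV_apply (lam mu : ℝ) (φ χ : S.diS d) : S.multV lam mu φ χ = S.mult lam mu φ.1 χ.1 :=
  rfl

theorem virialV {lam mu : ℝ} (hd : 0 < d) (hlam : 0 < lam) (hmu : 0 < mu) (φ χ : S.diS d) :
    3 / 8 * (S.ipV χ χ + S.afV lam mu φ φ) ≤
      -(S.multV lam mu φ (S.Kop lam mu φ) + S.multV lam mu χ χ) +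
        obsC d lam mu * S.obsV lam mu φ φ := by
  have h := S.virial (lam := lam) (mu := mu) hd hlam hmu φ.2 χ.2
  rw [obsV_apply, afV_apply, ipV_apply, multV_apply, multV_apply]
  have e : ((S.Kop lam mu φ : S.diS d) : Fin d → (Fin d → n) → ℝ) =
    fun i => S.inn (S.el lam mu φ.1 i) := rfl
  rw [e]
  simp only [mult, en2, Finset.sum_add_distrib] at *
  linarith

theorem ipV_self_eq_zero {φ : S.diS d} (h : S.ipV φ φ ≤ 0) : φ = 0 := by
  ext1; funext i
  by_contra hne
  have h1 := gip_self_pos S.w_pos hne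
  have h2 := Finset.single_le_sum (f := fun i => S.ip (φ.1 i) (φ.1 i))
    (fun i _ => gip_self_nonneg S.w_pos (φ.1 i)) (Finset.mem_univ i)
  rw [ipV_apply] at h
  simp only [ip] at *
  linarith

theorem ipV_comm (φ ψ : S.diS d) : S.ipV φ ψ = S.ipV ψ φ := by
  rw [ipV_apply, ipV_apply]
  exact Finset.sum_congr rfl fun _ _ => gip_comm _ _ _ _

theorem afV_self_eq_zero {lam mu : ℝ} (hd : 0 < d) (hlam : 0 < lam) (hmu : 0 < mu) {φ : S.diS d}
    (h : S.afV lam mu φ φ ≤ 0) : φ = 0 := by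
  refine S.ipV_self_eq_zero ?_
  rw [afV_apply] at h
  have h1 := S.le_af hlam hmu φ.1
  have h2 := S.sum_ip_D_le φ.1 ⟨0, hd⟩
  have h3 : ∑ i, S.ip (φ.1 i) (φ.1 i) ≤
      ∑ i, 11 / 2 * S.ip (op ⟨0, hd⟩ S.D (φ.1 i)) (op ⟨0, hd⟩ S.D (φ.1 i)) :=
    Finset.sum_le_sum fun i _ => S.poincare (φ.2 i ⟨0, hd⟩)
  rw [← Finset.mul_sum] at h3
  rw [ipV_apply]
  have h4 : ∑ k, ∑ i, S.ip (op k S.D (φ.1 i)) (op k S.D (φ.1 i)) ≤ 0 := by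
    by_contra! hc
    have := mul_pos hmu hc
    linarith
  linarith

instance : CompleteSpace (S.diS d) := FiniteDimensional.complete ℝ _

theorem energy_eq_zero {lam mu : ℝ} (hd : 0 < d) (hlam : 0 < lam) (hmu : 0 < mu)
    (z : S.diS d × S.diS d) (h : S.ipV z.2 z.2 + S.afV lam mu z.1 z.1 ≤ 0) : z = 0 := by
  have h1 : 0 ≤ S.ipV z.2 z.2 := by
    rw [ipV_apply]; exact Finset.sum_nonneg fun i _ => gip_self_nonneg S.w_pos _
  have h2 : 0 ≤ S.afV lam mu z.1 z.1 := by
    rw [afV_apply]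
    refine le_trans ?_ (S.le_af hlam hmu _)
    exact mul_nonneg hmu.le (Finset.sum_nonneg fun _ _ => Finset.sum_nonneg fun _ _ =>
      gip_self_nonneg S.w_pos _)
  exact Prod.ext (S.afV_self_eq_zero hd hlam hmu (by linarith)) (S.ipV_self_eq_zero (by linarith))

theorem hK {lam mu : ℝ} (u v : S.diS d) : S.ipV (S.Kop lam mu u) v = -S.afV lam mu u v := by
  simp [afV]

theorem afV_comm (lam mu : ℝ) (u v : S.diS d) : S.afV lam mu u v = S.afV lam mu v u := by
  rw [afV_apply, afV_apply, af_comm]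

theorem obsV_nonneg (lam mu : ℝ) (u : S.diS d) : 0 ≤ S.obsV lam mu u u := by
  rw [obsV_apply]; exact S.obs_self_nonneg _ _ _

theorem abs_multV_le {lam mu : ℝ} (hd : 0 < d) (hlam : 0 < lam) (hmu : 0 < mu)
    (φ χ : S.diS d) :
    |S.multV lam mu φ χ| ≤
      (Real.sqrt (18 * d / mu) + virialC d lam mu / S.N * Real.sqrt (d / mu)) / 2 *
        (S.ipV χ χ + S.afV lam mu φ φ) := by
  rw [afV_apply]
  exact S.abs_mult_le hd hlam hmu φ.2

theorem gram_injective {lam mu : ℝ} (hd : 0 < d) (hlam : 0 < lam) (hmu : 0 < mu) {T : ℝ}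
    (hT : 0 < T) (z : S.diS d × S.diS d)
    (hz : waveGram (S.Kop lam mu) (S.obsV lam mu) T z z = 0) : z = 0 :=
  waveGram_injective S.ipV_comm (S.afV_comm lam mu) S.hK (S.multV lam mu) (by norm_num)
    (S.virialV hd hlam hmu) (S.abs_multV_le hd hlam hmu) (S.obsV_nonneg lam mu)
    (S.energy_eq_zero hd hlam hmu) hT z hz

/-- The inverse observability inequality with constant `C`. -/
def Observable (d : ℕ) (lam mu T C : ℝ) : Prop :=
  ∀ z : S.diS d × S.diS d, S.ipV z.2 z.2 + S.afV lam mu z.1 z.1 ≤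
    C * waveGram (S.Kop lam mu) (S.obsV lam mu) T z z

theorem gram_nonneg {lam mu T : ℝ} (hT : 0 ≤ T) (z : S.diS d × S.diS d) :
    0 ≤ waveGram (S.Kop lam mu) (S.obsV lam mu) T z z := by
  rw [waveGram_apply]
  exact intervalIntegral.integral_nonneg hT fun t _ => S.obsV_nonneg _ _ _

theorem Observable.mono {lam mu T C C' : ℝ} (hT : 0 ≤ T) (h : S.Observable d lam mu T C)
    (hC : C ≤ C') : S.Observable d lam mu T C' := fun z =>
  (h z).trans (mul_le_mul_of_nonneg_right hC (S.gram_nonneg hT z))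

theorem exists_observable {lam mu : ℝ} (hd : 0 < d) (hlam : 0 < lam) (hmu : 0 < mu) {T : ℝ}
    (hT : 0 < T) : ∃ C > 0, S.Observable d lam mu T C :=
  exists_bound_of_injective (S.obsV_nonneg lam mu) hT.le (S.gram_injective hd hlam hmu hT)

theorem observable_of_large {lam mu : ℝ} (hd : 0 < d) (hlam : 0 < lam) (hmu : 0 < mu) {T : ℝ}
    (hN : virialC d lam mu ≤ S.N) (hT : 16 * Real.sqrt (d / mu) ≤ T) :
    S.Observable d lam mu T (obsC d lam mu / (3 / 4 * Real.sqrt (d / mu))) := by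
  intro z
  have hd' : (0 : ℝ) < d := by exact_mod_cast hd
  set r := Real.sqrt (d / mu) with hr
  have hr0 : 0 < r := Real.sqrt_pos.2 (by positivity)
  have hT0 : 0 ≤ T := by linarith
  have h := observability_of_virial S.ipV_comm (S.afV_comm lam mu) S.hK (S.multV lam mu)
    (S.virialV hd hlam hmu) (S.abs_multV_le hd hlam hmu) (isWave_waveFlow (S.Kop lam mu) z) hT0
  rw [← hr, ← waveGram_apply, waveFlow_zero] at h
  simp only [one_apply_eq_self] at h
  have h18 : Real.sqrt (18 * d / mu) ≤ 17 / 4 * r := by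
    rw [mul_div_assoc, Real.sqrt_mul (by norm_num)]
    refine mul_le_mul_of_nonneg_right ?_ hr0.le
    rw [Real.sqrt_le_left (by norm_num)]
    norm_num
  have hv : virialC d lam mu / S.N * r ≤ r := by
    refine mul_le_of_le_one_left hr0.le ?_
    rw [div_le_one S.N_pos]; exact hN
  have hE : 0 ≤ S.ipV z.2 z.2 + S.afV lam mu z.1 z.1 := by
    by_contra! hc
    have := S.energy_eq_zero hd hlam hmu z hc.le
    subst this; simp at hc
  rw [div_mul_eq_mul_div, le_div_iff₀ (by positivity)]
  refine le_trans ?_ h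
  rw [mul_comm]
  refine mul_le_mul_of_nonneg_right ?_ hE
  linarith

theorem exists_control {lam mu : ℝ} (hd : 0 < d) (hlam : 0 < lam) (hmu : 0 < mu) {T C X : ℝ}
    (hT : 0 < T) (hC0 : 0 ≤ C) (hC : S.Observable d lam mu T C) (hX0 : 0 ≤ X) (u0 u1 : S.diS d)
    (hX : ∀ z : S.diS d × S.diS d, (S.ipV u1 z.1 - S.ipV u0 z.2) ^ 2 ≤
      X * (S.ipV z.2 z.2 + S.afV lam mu z.1 z.1)) :
    ∃ φ χ U W : ℝ → S.diS d, IsWave (S.Kop lam mu) φ χ ∧ (∀ t, HasDerivAt U (W t) t) ∧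
      (∀ t, HasDerivAt W (S.Kop lam mu (U t) + S.Bop lam mu (φ t)) t) ∧ U 0 = u0 ∧ W 0 = u1 ∧
      U T = 0 ∧ W T = 0 ∧ ∫ t in (0 : ℝ)..T, S.obs lam mu (φ t).1 (φ t).1 ≤ X * C := by
  have hXC : ∀ z : S.diS d × S.diS d, (S.ipV u1 z.1 - S.ipV u0 z.2) ^ 2 ≤
      X * C * waveGram (S.Kop lam mu) (S.obsV lam mu) T z z := fun z => by
    rw [mul_assoc]
    exact (hX z).trans (mul_le_mul_of_nonneg_left (hC z) hX0)
  have hB : ∀ u v : S.diS d, S.ipV (S.Bop lam mu u) v = S.obsV lam mu u v := fun u v => by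
    rw [obsV, LinearMap.comp_apply]
  have hXC0 : 0 ≤ X * C := mul_nonneg hX0 hC0
  have h0 : ∀ u : S.diS d, S.ipV u u = 0 → u = 0 := fun u hu => S.ipV_self_eq_zero hu.le
  have h := hilbert_uniqueness S.ipV_comm h0 (S.afV_comm lam mu) S.hK hB
    (S.gram_injective hd hlam hmu hT) u0 u1 hXC0 hXC (S.gram_nonneg hT.le)
  simp only [obsV_apply] at h
  exact h

end LGLData

/-- Integration of a real polynomial over `[-1, 1]`. -/
def pint : Polynomial ℝ →ₗ[ℝ] ℝ where
  toFun p := ∫ x in (-1 : ℝ)..(1 : ℝ), p.eval x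
  map_add' p q := by
    simp only [eval_add]
    exact intervalIntegral.integral_add (p.continuous.intervalIntegrable _ _)
      (q.continuous.intervalIntegrable _ _)
  map_smul' c p := by
    simp only [eval_smul, smul_eq_mul, RingHom.id_apply]
    exact intervalIntegral.integral_const_mul _ _

theorem pint_apply (p : Polynomial ℝ) : pint p = ∫ x in (-1 : ℝ)..(1 : ℝ), p.eval x := rfl

theorem pint_derivative (p : Polynomial ℝ) : pint (derivative p) = p.eval 1 - p.eval (-1) :=
  intervalIntegral.integral_eq_sub_of_hasDerivAt (fun x _ => p.hasDerivAt x)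
    ((derivative p).continuous.intervalIntegrable _ _)

theorem pint_derivative_mul (p q : Polynomial ℝ) : pint (derivative p * q) =
    p.eval 1 * q.eval 1 - p.eval (-1) * q.eval (-1) - pint (p * derivative q) := by
  have := pint_derivative (p * q)
  rw [derivative_mul, map_add, eval_mul, eval_mul] at this
  linarith

theorem pint_C_mul (c : ℝ) (p : Polynomial ℝ) : pint (C c * p) = c * pint p := by
  rw [← smul_eq_C_mul, map_smul, smul_eq_mul]

theorem pint_sq_nonneg (p : Polynomial ℝ) : 0 ≤ pint (p * p) := by
  rw [pint_apply]
  refine intervalIntegral.integral_nonneg (by norm_num) fun x _ => ?_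
  rw [eval_mul]; exact mul_self_nonneg _

theorem eval_iterate_derivative_pow_mul (c : ℝ) (n : ℕ) (g : Polynomial ℝ) :
    (derivative^[n] ((X - C c) ^ n * g)).eval c = n.factorial * g.eval c := by
  induction n generalizing g with
  | zero => simp
  | succ n ih =>
    have : derivative ((X - C c) ^ (n + 1) * g) =
        (X - C c) ^ n * (C (n + 1 : ℝ) * g + (X - C c) * derivative g) := by
      rw [derivative_mul, derivative_X_sub_C_pow, Nat.add_sub_cancel]
      simp only [Nat.cast_add, Nat.cast_one, map_add, map_natCast, map_one]
      ring
    rw [Function.iterate_succ_apply, this, ih]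
    simp [Nat.factorial_succ]
    ring

theorem legendre_eval_one (N : ℕ) : (legendre N).eval 1 = 1 := by
  have h : ((X : Polynomial ℝ) ^ 2 - 1) ^ N = (X - C 1) ^ N * (X + 1) ^ N := by
    rw [← mul_pow]; congr 1; rw [C_1]; ring
  rw [legendre, h, eval_mul, eval_C, eval_iterate_derivative_pow_mul]
  have := N.factorial_ne_zero
  simp only [eval_pow, eval_add, eval_X, eval_one]
  rw [show (1 : ℝ) + 1 = 2 by norm_num]
  field_simp

theorem legendre_eval_neg_one (N : ℕ) : (legendre N).eval (-1) = (-1) ^ N := by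
  have h : ((X : Polynomial ℝ) ^ 2 - 1) ^ N = (X - C (-1)) ^ N * (X - 1) ^ N := by
    rw [← mul_pow]; congr 1; rw [C_neg, C_1]; ring
  rw [legendre, h, eval_mul, eval_C, eval_iterate_derivative_pow_mul]
  have := N.factorial_ne_zero
  simp only [eval_pow, eval_sub, eval_X, eval_one]
  rw [show (-1 : ℝ) - 1 = (-1) * 2 by norm_num, mul_pow]
  field_simp

theorem legendre_natDegree_le (N : ℕ) : (legendre N).natDegree ≤ N := by
  refine (natDegree_C_mul_le _ _).trans ((natDegree_iterate_derivative _ _).trans ?_)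
  have : ((X : Polynomial ℝ) ^ 2 - 1).natDegree ≤ 2 := by
    refine (natDegree_sub_le _ _).trans ?_
    simp
  have h2 := natDegree_pow_le_of_le N this
  omega

theorem eval_iterate_derivative_of_lt {N j : ℕ} (hj : j < N) {c : ℝ} (hc : c ^ 2 = 1) :
    (derivative^[j] (((X : Polynomial ℝ) ^ 2 - 1) ^ N)).eval c = 0 := by
  obtain ⟨q, hq⟩ := pow_sub_dvd_iterate_derivative_pow ((X : Polynomial ℝ) ^ 2 - 1) N j
  rw [hq, eval_mul, eval_pow]
  simp only [eval_sub, eval_pow, eval_X, eval_one, hc, sub_self]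
  rw [zero_pow (by omega), zero_mul]

theorem pint_legendre_mul {N : ℕ} {p : Polynomial ℝ} (hp : p.natDegree < N) :
    pint (legendre N * p) = 0 := by
  have key : ∀ j ≤ N, ∃ σ : ℝ, pint (derivative^[N] (((X : Polynomial ℝ) ^ 2 - 1) ^ N) * p) =
      σ * pint (derivative^[N - j] (((X : Polynomial ℝ) ^ 2 - 1) ^ N) * derivative^[j] p) := by
    intro j
    induction j with
    | zero => exact fun _ => ⟨1, by simp⟩
    | succ j ih =>
      intro hj
      obtain ⟨σ, hσ⟩ := ih (by omega)
      refine ⟨-σ, ?_⟩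
      rw [hσ, show N - j = (N - (j + 1)) + 1 by omega, Function.iterate_succ_apply',
        pint_derivative_mul, eval_iterate_derivative_of_lt (by omega) (by norm_num),
        eval_iterate_derivative_of_lt (by omega) (by norm_num),
        Function.iterate_succ_apply' (⇑derivative) j p]
      ring
  obtain ⟨σ, hσ⟩ := key N le_rfl
  rw [legendre, mul_assoc, pint_C_mul, hσ, iterate_derivative_eq_zero hp, mul_zero, map_zero]
  ring

theorem legendre_ode (N : ℕ) :
    derivative ((1 - X ^ 2) * derivative (legendre N)) = -C ((N : ℝ) * (N + 1)) * legendre N := by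
  set q : Polynomial ℝ := ((X : Polynomial ℝ) ^ 2 - 1) ^ N with hq
  have h0 : (X ^ 2 - 1) * derivative q = C (2 * N : ℝ) * X * q := by
    rcases N with _ | N
    · simp [hq]
    · rw [hq, derivative_pow]
      simp only [derivative_sub, derivative_X_pow, derivative_one, Nat.cast_add, Nat.cast_one,
        map_add, map_natCast, map_mul, map_one, Nat.add_sub_cancel]
      norm_num [C_ofNat]
      ring
  have key : ∀ j : ℕ, (X ^ 2 - 1) * derivative^[j + 2] q +
      C (2 - 2 * N + 2 * j : ℝ) * X * derivative^[j + 1] q +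
      C (-2 * N + j * (2 - 2 * N) + j * (j - 1) : ℝ) * derivative^[j] q = 0 := by
    intro j
    induction j with
    | zero =>
      have := congrArg derivative h0
      simp only [derivative_mul, derivative_sub, derivative_X_pow, derivative_one,
        derivative_C, derivative_X] at this
      simp only [Function.iterate_succ_apply', Function.iterate_zero, id]
      simp [C_ofNat] at this ⊢
      linear_combination this
    | succ j ih =>
      have := congrArg derivative ih
      simp only [derivative_mul, derivative_sub, derivative_add, derivative_X_pow, derivative_one,
        derivative_C, derivative_X, derivative_zero, ← Function.iterate_succ_apply' (f := derivative)] at this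
      simp [C_ofNat] at this ⊢
      linear_combination this
  have h := key N
  have e1 : legendre N = C (1 / (2 ^ N * (N.factorial : ℝ))) * derivative^[N] q := rfl
  have e2 : derivative (derivative^[N] q) = derivative^[N + 1] q := (Function.iterate_succ_apply' _ _ _).symm
  have e3 : derivative (derivative^[N + 1] q) = derivative^[N + 2] q := (Function.iterate_succ_apply' _ _ _).symm
  rw [e1]
  generalize 1 / (2 ^ N * (N.factorial : ℝ)) = c at *
  rw [derivative_C_mul, e2]
  simp only [derivative_mul, derivative_sub, derivative_X_pow, derivative_one, derivative_C, e3]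
  simp [C_ofNat] at h ⊢
  linear_combination (-C c) * h

theorem legendre_euler_natDegree_lt {N : ℕ} (hN : 1 ≤ N) :
    (X * derivative (legendre N) - C (N : ℝ) * legendre N).natDegree < N := by
  have hle : (X * derivative (legendre N) - C (N : ℝ) * legendre N).natDegree ≤ N := by
    refine (natDegree_sub_le _ _).trans (max_le ?_ ?_)
    · refine natDegree_mul_le.trans ?_
      have := natDegree_derivative_le (legendre N)
      have := legendre_natDegree_le N
      rw [natDegree_X]; omega
    · exact (natDegree_C_mul_le _ _).trans (legendre_natDegree_le N)
  have hc : (X * derivative (legendre N) - C (N : ℝ) * legendre N).coeff N = 0 := by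
    obtain ⟨M, rfl⟩ : ∃ M, N = M + 1 := ⟨N - 1, by omega⟩
    rw [coeff_sub, coeff_X_mul, coeff_derivative, coeff_C_mul]
    push_cast; ring
  rcases hle.lt_or_eq with h | h
  · exact h
  · have h0 : (X * derivative (legendre N) - C (N : ℝ) * legendre N) = 0 := by
      rw [← leadingCoeff_eq_zero, leadingCoeff, h, hc]
    rw [h0, natDegree_zero]; omega

theorem pint_legendre_sq {N : ℕ} (hN : 1 ≤ N) :
    pint (legendre N * legendre N) * (2 * N + 1) = 2 := by
  have h1 := pint_legendre_mul (legendre_euler_natDegree_lt hN)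
  rw [mul_sub, map_sub, show legendre N * (C (N : ℝ) * legendre N) =
    C (N : ℝ) * (legendre N * legendre N) by ring, pint_C_mul] at h1
  have h2 := pint_derivative (X * (legendre N * legendre N))
  simp only [derivative_mul, derivative_X, one_mul, eval_mul, eval_X, legendre_eval_one,
    legendre_eval_neg_one] at h2
  rw [show legendre N * legendre N + X * (derivative (legendre N) * legendre N +
    legendre N * derivative (legendre N)) = legendre N * legendre N +
      C 2 * (legendre N * (X * derivative (legendre N))) by rw [C_ofNat]; ring, map_add,
    pint_C_mul] at h2
  have h3 : ((-1 : ℝ) ^ N) * (-1) ^ N = 1 := by rw [← mul_pow]; norm_num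
  linarith

theorem pint_bubble_mul {N : ℕ} {q : Polynomial ℝ} (hq : q.natDegree + 1 < N) :
    pint ((1 - X ^ 2) * derivative (legendre N) * q) = 0 := by
  have h := pint_derivative_mul (legendre N) ((1 - X ^ 2) * q)
  simp only [eval_mul, eval_sub, eval_one, eval_pow, eval_X] at h
  rw [pint_legendre_mul (p := derivative ((1 - X ^ 2) * q))] at h
  · rw [show (1 - X ^ 2) * derivative (legendre N) * q =
      derivative (legendre N) * ((1 - X ^ 2) * q) by ring, h]
    norm_num
  · have h1 := natDegree_derivative_le ((1 - X ^ 2) * q)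
    have h2 : ((1 - X ^ 2) * q).natDegree ≤ 2 + q.natDegree := by
      refine natDegree_mul_le.trans ?_
      gcongr
      exact (natDegree_sub_le _ _).trans (by simp)
    omega

theorem legendre_deriv_eval_one (N : ℕ) :
    (derivative (legendre N)).eval 1 = (N : ℝ) * (N + 1) / 2 := by
  have h := congrArg (eval (1 : ℝ)) (legendre_ode N)
  simp [derivative_mul, legendre_eval_one] at h
  linarith

theorem legendre_deriv_eval_neg_one (N : ℕ) :
    (derivative (legendre N)).eval (-1) =
      -((N : ℝ) * (N + 1) / 2) * (legendre N).eval (-1) := by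
  have h := congrArg (eval (-1 : ℝ)) (legendre_ode N)
  simp [derivative_mul] at h
  linarith

section LGL

variable {N : ℕ} (hN : 2 ≤ N) {nd : Fin (N + 1) → ℝ} (hnd : IsLGL N nd)
  {Ψ : Fin (N + 1) → Polynomial ℝ} (hΨ : IsLagrange N nd Ψ)

include hnd in
theorem IsLGL.sq_le (k : Fin (N + 1)) : nd k ^ 2 ≤ 1 := by
  have h0 : nd 0 ≤ nd k := hnd.1.monotone (Fin.zero_le k)
  have h1 : nd k ≤ nd (Fin.last N) := hnd.1.monotone (Fin.le_last k)
  rw [hnd.2.1] at h0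
  rw [hnd.2.2.1] at h1
  nlinarith

include hnd in
theorem IsLGL.sq_lt {k : Fin (N + 1)} (h0 : k ≠ 0) (h1 : k ≠ Fin.last N) : nd k ^ 2 < 1 := by
  have h0 : nd 0 < nd k := hnd.1 (Fin.pos_iff_ne_zero.mpr h0)
  have h1 : nd k < nd (Fin.last N) := hnd.1 (Fin.lt_last_iff_ne_last.mpr h1)
  rw [hnd.2.1] at h0
  rw [hnd.2.2.1] at h1
  nlinarith

include hnd in
theorem IsLGL.bubble_eval (k : Fin (N + 1)) :
    ((1 - X ^ 2) * derivative (legendre N)).eval (nd k) = 0 := by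
  have := (hnd.2.2.2 (nd k)).mpr ⟨k, rfl⟩
  simpa using this

include hnd hΨ in
theorem IsLagrange.eq_sum {p : Polynomial ℝ} (hp : p.natDegree ≤ N) :
    p = ∑ k, C (p.eval (nd k)) * Ψ k := by
  refine Polynomial.eq_of_natDegree_lt_card_of_eval_eq p _ hnd.1.injective ?_ ?_
  · intro i
    simp [eval_finsetSum, (hΨ _).2]
  · rw [Fintype.card_fin]
    refine max_lt (by omega) (Nat.lt_succ_of_le ?_)
    refine natDegree_sum_le_of_forall_le _ _ fun k _ => ?_
    exact (natDegree_C_mul_le _ _).trans (hΨ k).1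

include hN in
theorem bubble_ne_zero : (1 - X ^ 2) * derivative (legendre N) ≠ 0 := by
  have hN0 : (0 : ℝ) < N := by exact_mod_cast (by omega : 0 < N)
  refine mul_ne_zero (fun h => ?_) fun h => ?_
  · have := congrArg (eval 0) h
    simp at this
  · have := congrArg (eval (1 : ℝ)) h
    rw [legendre_deriv_eval_one, eval_zero] at this
    have : 0 < (N : ℝ) * (N + 1) / 2 := by positivity
    linarith

include hN hnd in
theorem IsLGL.bubble_natDegree :
    N + 1 ≤ ((1 - X ^ 2) * derivative (legendre N)).natDegree := by
  have := card_le_degree_of_subset_roots (p := (1 - X ^ 2) * derivative (legendre N))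
    (Z := Finset.univ.image nd) ?_
  · rwa [Finset.card_image_of_injective _ hnd.1.injective, Finset.card_fin] at this
  · intro x hx
    obtain ⟨k, -, rfl⟩ := Finset.mem_image.mp (Finset.mem_val.mp hx)
    exact (mem_roots (bubble_ne_zero hN)).mpr (hnd.bubble_eval k)

theorem bubble_natDegree_le : ((1 - X ^ 2) * derivative (legendre N)).natDegree ≤ N + 1 := by
  rcases N with _ | N
  · simp [legendre]
  have h1 := natDegree_derivative_le (legendre (N + 1))
  have h2 := legendre_natDegree_le (N + 1)
  have h3 : ((1 : Polynomial ℝ) - X ^ 2).natDegree ≤ 2 :=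
    (natDegree_sub_le _ _).trans (by simp)
  have := natDegree_mul_le (p := (1 : Polynomial ℝ) - X ^ 2) (q := derivative (legendre (N + 1)))
  omega

include hN hnd hΨ in
/-- Exactness of the Legendre–Gauss–Lobatto quadrature. -/
theorem lgl_quadrature {p : Polynomial ℝ} (hp : p.natDegree + 1 ≤ 2 * N) :
    pint p = ∑ k, lglW N Ψ k * p.eval (nd k) := by
  set G : Polynomial ℝ := (1 - X ^ 2) * derivative (legendre N) with hG
  have hG0 : G ≠ 0 := bubble_ne_zero hN
  have hGd : N + 1 ≤ G.natDegree := hnd.bubble_natDegree hN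
  have hGd' : G.natDegree ≤ N + 1 := bubble_natDegree_le
  have hdm := EuclideanDomain.div_add_mod p G
  set q := p / G with hq
  set r := p % G with hr
  have hrd : r.natDegree ≤ N := by
    have := degree_mod_lt p hG0
    by_cases hr0 : r = 0
    · rw [hr0]; simp
    · have := natDegree_lt_natDegree hr0 this
      omega
  have hqd : q.natDegree + 1 < N := by
    by_cases hq0 : q = 0
    · rw [hq0, natDegree_zero]; omega
    · have h1 := natDegree_mul hG0 hq0
      have h2 : (G * q).natDegree ≤ max p.natDegree r.natDegree := by
        rw [show G * q = p - r by rw [← hdm]; ring]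
        exact natDegree_sub_le _ _
      have := max_le_iff.mpr ⟨(by omega : p.natDegree ≤ 2 * N - 1), (by omega : r.natDegree ≤ 2 * N - 1)⟩
      omega
  have h1 : pint p = pint r := by
    rw [← hdm, map_add, pint_bubble_mul hqd, zero_add]
  have h2 : ∀ k, p.eval (nd k) = r.eval (nd k) := fun k => by
    rw [← hdm, eval_add, eval_mul, hnd.bubble_eval, zero_mul, zero_add]
  rw [h1]
  conv_lhs => rw [hΨ.eq_sum hnd hrd]
  rw [map_sum]
  refine Finset.sum_congr rfl fun k _ => ?_
  rw [pint_C_mul, h2, mul_comm]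
  rfl

include hN hnd hΨ in
theorem lgl_sbp {p q : Polynomial ℝ} (hp : p.natDegree ≤ N) (hq : q.natDegree ≤ N) :
    (∑ k, lglW N Ψ k * ((derivative p).eval (nd k) * q.eval (nd k))) +
      (∑ k, lglW N Ψ k * (p.eval (nd k) * (derivative q).eval (nd k))) =
      p.eval 1 * q.eval 1 - p.eval (-1) * q.eval (-1) := by
  have h := pint_derivative (p * q)
  rw [lgl_quadrature hN hnd hΨ] at h
  · rw [← Finset.sum_add_distrib, ← eval_mul, ← eval_mul, ← h]
    refine Finset.sum_congr rfl fun k _ => ?_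
    rw [derivative_mul, eval_add, eval_mul, eval_mul]; ring
  · have h1 := natDegree_derivative_le (p * q)
    have h2 := natDegree_mul_le (p := p) (q := q)
    omega

end LGL

theorem exists_eq_bubble_mul {p : Polynomial ℝ} (h1 : p.eval 1 = 0) (h2 : p.eval (-1) = 0) :
    ∃ y : Polynomial ℝ, p = (1 - X ^ 2) * y ∧ y.natDegree ≤ p.natDegree - 2 := by
  obtain ⟨q, hq⟩ := dvd_iff_isRoot.mpr (show p.IsRoot 1 from h1)
  have hq2 : q.eval (-1) = 0 := by
    rw [hq] at h2
    simp at h2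
    rcases h2 with h | h
    · norm_num at h
    · exact h
  obtain ⟨y, hy⟩ := dvd_iff_isRoot.mpr (show q.IsRoot (-1) from hq2)
  have he : p = (1 - X ^ 2) * (-y) := by
    rw [hq, hy]; simp; ring
  refine ⟨-y, he, ?_⟩
  by_cases hy0 : y = 0
  · simp [hy0]
  · have hX : ((1 : Polynomial ℝ) - X ^ 2).natDegree = 2 := by
      compute_degree!
    have hX0 : ((1 : Polynomial ℝ) - X ^ 2) ≠ 0 := by
      intro h
      rw [h] at hX
      simp at hX
    have := natDegree_mul hX0 (neg_ne_zero.mpr hy0)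
    rw [← he, hX] at this
    omega

theorem pint_bubble_sq_pos {y : Polynomial ℝ} {c : ℝ} (hc : c ^ 2 < 1) (hy : y.eval c ≠ 0) :
    0 < pint ((1 - X ^ 2) * (y * y)) := by
  rw [pint_apply]
  refine intervalIntegral.integral_pos (by norm_num) (Polynomial.continuous _).continuousOn ?_ ?_
  · intro x hx
    simp only [eval_mul, eval_sub, eval_one, eval_pow, eval_X]
    refine mul_nonneg ?_ (mul_self_nonneg _)
    nlinarith [hx.1, hx.2]
  · refine ⟨c, ⟨by nlinarith, by nlinarith⟩, ?_⟩
    simp only [eval_mul, eval_sub, eval_one, eval_pow, eval_X]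
    exact mul_pos (by linarith) (mul_self_pos.mpr hy)

section LGL

variable {N : ℕ} (hN : 2 ≤ N) {nd : Fin (N + 1) → ℝ} (hnd : IsLGL N nd)
  {Ψ : Fin (N + 1) → Polynomial ℝ} (hΨ : IsLagrange N nd Ψ)

include hnd hΨ in
theorem IsLagrange.eval_one (k : Fin (N + 1)) :
    (Ψ k).eval 1 = if k = Fin.last N then 1 else 0 := by
  have := (hΨ k).2 (Fin.last N)
  rw [hnd.2.2.1] at this
  rw [this]
  simp only [eq_comm]

include hnd hΨ in
theorem IsLagrange.eval_neg_one (k : Fin (N + 1)) :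
    (Ψ k).eval (-1) = if k = 0 then 1 else 0 := by
  have := (hΨ k).2 0
  rw [hnd.2.1] at this
  rw [this]
  simp only [eq_comm]

include hN in
theorem zero_ne_last' : (0 : Fin (N + 1)) ≠ Fin.last N := by
  intro h
  have := congrArg Fin.val h
  simp at this
  omega

include hnd in
theorem IsLGL.legendre_deriv_eval {k : Fin (N + 1)} (h0 : k ≠ 0) (h1 : k ≠ Fin.last N) :
    (derivative (legendre N)).eval (nd k) = 0 := by
  have h := hnd.bubble_eval k
  have := hnd.sq_lt h0 h1
  simp only [eval_mul, eval_sub, eval_one, eval_pow, eval_X] at h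
  rcases mul_eq_zero.mp h with h | h
  · linarith
  · exact h

theorem legendre_eval_neg_one_sq (N : ℕ) : (legendre N).eval (-1) ^ 2 = 1 := by
  rw [legendre_eval_neg_one, ← pow_mul, mul_comm, pow_mul]; norm_num

include hN hnd hΨ in
theorem lglW_last : lglW N Ψ (Fin.last N) * ((N : ℝ) * (N + 1) / 2) = 1 := by
  have h := lgl_quadrature hN hnd hΨ (p := (1 + X) * derivative (legendre N)) ?_
  · rw [Finset.sum_eq_single (Fin.last N)] at h
    · have h2 := pint_derivative_mul (legendre N) (1 + X)
      have h3 := pint_legendre_mul (N := N) (p := derivative (1 + X : Polynomial ℝ)) (by simp; omega)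
      rw [mul_comm, h2, h3, hnd.2.2.1] at h
      simp [legendre_eval_one, legendre_deriv_eval_one] at h
      linarith
    · intro k _ hk
      by_cases h0 : k = 0
      · rw [h0, hnd.2.1]; simp
      · rw [eval_mul, hnd.legendre_deriv_eval h0 hk]; ring
    · simp
  · have h1 := natDegree_derivative_le (legendre N)
    have h2 := legendre_natDegree_le N
    have h3 := natDegree_mul_le (p := (1 + X : Polynomial ℝ)) (q := derivative (legendre N))
    have h4 : (1 + X : Polynomial ℝ).natDegree ≤ 1 := (natDegree_add_le _ _).trans (by simp)
    omega

include hN hnd hΨ in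
theorem lglW_zero : lglW N Ψ 0 * ((N : ℝ) * (N + 1) / 2) = 1 := by
  have h := lgl_quadrature hN hnd hΨ (p := (1 - X) * derivative (legendre N)) ?_
  · rw [Finset.sum_eq_single 0] at h
    · have h2 := pint_derivative_mul (legendre N) (1 - X)
      have h3 := pint_legendre_mul (N := N) (p := derivative (1 - X : Polynomial ℝ)) (by simp; omega)
      rw [mul_comm, h2, h3, hnd.2.1] at h
      simp [legendre_deriv_eval_neg_one] at h
      have h4 := legendre_eval_neg_one_sq N
      have h5 := congrArg (· * (legendre N).eval (-1)) h
      linear_combination (-1/2 : ℝ) * h5 + (1 - lglW N Ψ 0 * ((N : ℝ) * (N + 1) / 2)) * h4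
    · intro k _ hk
      by_cases h0 : k = Fin.last N
      · rw [h0, hnd.2.2.1]; simp
      · rw [eval_mul, hnd.legendre_deriv_eval hk h0]; ring
    · simp
  · have h1 := natDegree_derivative_le (legendre N)
    have h2 := legendre_natDegree_le N
    have h3 := natDegree_mul_le (p := (1 - X : Polynomial ℝ)) (q := derivative (legendre N))
    have h4 : (1 - X : Polynomial ℝ).natDegree ≤ 1 := (natDegree_sub_le _ _).trans (by simp)
    omega

include hN hnd hΨ in
theorem lglW_pos (k : Fin (N + 1)) : 0 < lglW N Ψ k := by
  have hN0 : (0 : ℝ) < (N : ℝ) * (N + 1) / 2 := by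
    have : (0 : ℝ) < N := by exact_mod_cast (by omega : 0 < N)
    positivity
  by_cases h0 : k = 0
  · have := lglW_zero hN hnd hΨ
    rw [h0]
    by_contra! hc
    nlinarith
  by_cases h1 : k = Fin.last N
  · have := lglW_last hN hnd hΨ
    rw [h1]
    by_contra! hc
    nlinarith
  obtain ⟨y, hy, hyd⟩ := exists_eq_bubble_mul (p := Ψ k) (by rw [hΨ.eval_one hnd, if_neg h1])
    (by rw [hΨ.eval_neg_one hnd, if_neg h0])
  have hev : ∀ m, (1 - nd m ^ 2) * y.eval (nd m) = if m = k then 1 else 0 := fun m => by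
    rw [← (hΨ k).2 m, hy]; simp
  have hk := hev k
  rw [if_pos rfl] at hk
  have hyk : y.eval (nd k) ≠ 0 := fun h => by rw [h] at hk; simp at hk
  have hpos := pint_bubble_sq_pos (hnd.sq_lt h0 h1) hyk
  rw [lgl_quadrature hN hnd hΨ] at hpos
  · rw [Finset.sum_eq_single k] at hpos
    · have h3 := mul_pos (sub_pos.mpr (hnd.sq_lt h0 h1)) (mul_self_pos.mpr hyk)
      simp only [eval_mul, eval_sub, eval_one, eval_pow, eval_X] at hpos
      exact pos_of_mul_pos_left hpos h3.le
    · intro m _ hm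
      have := hev m
      rw [if_neg hm] at this
      simp only [eval_mul, eval_sub, eval_one, eval_pow, eval_X]
      linear_combination (lglW N Ψ m * y.eval (nd m)) * this
    · simp
  · have h3 := natDegree_mul_le (p := y) (q := y)
    have h4 := natDegree_mul_le (p := (1 - X ^ 2 : Polynomial ℝ)) (q := y * y)
    have h5 : ((1 : Polynomial ℝ) - X ^ 2).natDegree ≤ 2 :=
      (natDegree_sub_le _ _).trans (by simp)
    have := (hΨ k).1
    omega

include hN hnd hΨ in
theorem lgl_sbp_basis (m l : Fin (N + 1)) :
    lglW N Ψ m * (derivative (Ψ l)).eval (nd m) + lglW N Ψ l * (derivative (Ψ m)).eval (nd l) =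
      (if m = Fin.last N ∧ l = Fin.last N then 1 else 0) - (if m = 0 ∧ l = 0 then 1 else 0) := by
  have h := lgl_sbp hN hnd hΨ (hΨ l).1 (hΨ m).1
  simp only [(hΨ _).2, mul_ite, ite_mul, mul_one, one_mul, mul_zero, zero_mul,
    Finset.sum_ite_eq', Finset.mem_univ, if_true] at h
  rw [h, hΨ.eval_one hnd, hΨ.eval_one hnd, hΨ.eval_neg_one hnd, hΨ.eval_neg_one hnd]
  congr 1
  · by_cases h1 : m = Fin.last N <;> by_cases h2 : l = Fin.last N <;> simp [h1, h2]
  · by_cases h1 : m = 0 <;> by_cases h2 : l = 0 <;> simp [h1, h2]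

include hN hnd hΨ in
theorem lgl_commutator_aux (l : Fin (N + 1)) : ∃ c : ℝ, ∀ m,
    (nd l - nd m) * (derivative (Ψ l)).eval (nd m) =
      (if m = l then 1 else 0) - c * ((N : ℝ) * (N + 1)) * (legendre N).eval (nd m) := by
  set G : Polynomial ℝ := (1 - X ^ 2) * derivative (legendre N) with hG
  have hGd : G.natDegree = N + 1 :=
    le_antisymm bubble_natDegree_le (hnd.bubble_natDegree hN)
  have hGc : G.coeff (N + 1) ≠ 0 := by
    rw [← hGd]
    exact leadingCoeff_ne_zero.mpr (bubble_ne_zero hN)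
  set A : Polynomial ℝ := (C (nd l) - X) * Ψ l with hA
  have hAd : A.natDegree ≤ N + 1 := by
    have h1 : (C (nd l) - X : Polynomial ℝ).natDegree ≤ 1 := (natDegree_sub_le _ _).trans (by simp)
    have := natDegree_mul_le (p := (C (nd l) - X : Polynomial ℝ)) (q := Ψ l)
    have := (hΨ l).1
    rw [hA]
    omega
  set c := A.coeff (N + 1) / G.coeff (N + 1) with hc
  have hd : (A - C c * G).natDegree ≤ N := by
    have hle : (A - C c * G).natDegree ≤ N + 1 :=
      (natDegree_sub_le _ _).trans (max_le hAd ((natDegree_C_mul_le _ _).trans hGd.le))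
    have h0 : (A - C c * G).coeff (N + 1) = 0 := by
      rw [coeff_sub, coeff_C_mul, hc, div_mul_cancel₀ _ hGc, sub_self]
    refine natDegree_le_iff_coeff_eq_zero.mpr fun j hj => ?_
    rcases (Nat.succ_le_of_lt hj).eq_or_lt with h | h
    · rw [← h]; exact h0
    · exact coeff_eq_zero_of_natDegree_lt (lt_of_le_of_lt hle h)
  have hz : A = C c * G := by
    have := hΨ.eq_sum hnd hd
    rw [Finset.sum_eq_zero] at this
    · exact sub_eq_zero.mp this
    · intro k _
      rw [eval_sub, eval_mul (p := C c), hnd.bubble_eval, hA]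
      simp only [eval_mul, eval_sub, eval_C, eval_X, (hΨ l).2]
      by_cases h : k = l <;> simp [h]
  refine ⟨c, fun m => ?_⟩
  have := congrArg (fun p => (derivative p).eval (nd m)) hz
  simp only [hA, derivative_mul, hG, ← mul_assoc] at this
  have h2 := congrArg (eval (nd m)) (legendre_ode N)
  rw [← hG] at h2
  have h3 := congrArg (fun p => (derivative p).eval (nd m)) hz
  simp only [eval_mul, eval_C, h2, hA, derivative_mul, derivative_sub,
    derivative_C, derivative_X, eval_add, eval_sub, eval_X, eval_neg, eval_one, eval_zero,
    (hΨ l).2] at h3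
  linarith

include hN hnd hΨ in
theorem lgl_commutator (m l : Fin (N + 1)) :
    (derivative (Ψ l)).eval (nd m) * (1 + nd l) - (1 + nd m) * (derivative (Ψ l)).eval (nd m) =
      (if m = l then 1 else 0) - ((N : ℝ) * (N + 1) / 2) *
        ((legendre N).eval (nd m) * (legendre N).eval (nd l) * lglW N Ψ l) := by
  choose c hc using lgl_commutator_aux hN hnd hΨ
  have hb := lglW_last hN hnd hΨ
  have hLb : (legendre N).eval (nd (Fin.last N)) = 1 := by rw [hnd.2.2.1, legendre_eval_one]
  have hcb : c (Fin.last N) * ((N : ℝ) * (N + 1)) = 1 := by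
    have := hc (Fin.last N) (Fin.last N)
    rw [if_pos rfl, hLb] at this
    linarith
  have hcl : c l * ((N : ℝ) * (N + 1)) =
      ((N : ℝ) * (N + 1) / 2) * (legendre N).eval (nd l) * lglW N Ψ l := by
    by_cases hl : l = Fin.last N
    · rw [hl, hLb, hcb]; linarith
    · have h1 := hc l (Fin.last N)
      have h2 := hc (Fin.last N) l
      have h3 := lgl_sbp_basis hN hnd hΨ l (Fin.last N)
      have h4 : ¬ (l = 0 ∧ Fin.last N = 0) := fun h => zero_ne_last' hN h.2.symm
      rw [if_neg (fun h => hl h.1), if_neg h4] at h3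
      rw [if_neg (Ne.symm hl), hLb] at h1
      rw [if_neg hl] at h2
      have h5 : lglW N Ψ (Fin.last N) * (c l * ((N : ℝ) * (N + 1))) =
          lglW N Ψ l * (c (Fin.last N) * ((N : ℝ) * (N + 1))) * (legendre N).eval (nd l) := by
        linear_combination lglW N Ψ (Fin.last N) * h1 - lglW N Ψ l * h2 -
          (nd l - nd (Fin.last N)) * h3
      rw [hcb] at h5
      linear_combination (-(c l * ((N : ℝ) * (N + 1)))) * hb + ((N : ℝ) * (N + 1) / 2) * h5
  have := hc l m
  rw [hcl] at this
  linarith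

include hN hnd hΨ in
theorem lgl_sum_legendre_sq :
    ∑ k, lglW N Ψ k * (legendre N).eval (nd k) ^ 2 = 2 / N := by
  have hN0 : (0 : ℝ) < N := by exact_mod_cast (by omega : 0 < N)
  have h1 := natDegree_derivative_le (legendre N)
  have h2 := legendre_natDegree_le N
  have h := lgl_quadrature hN hnd hΨ
    (p := legendre N * (X * derivative (legendre N) - C (N : ℝ) * legendre N)) ?_
  · rw [pint_legendre_mul (legendre_euler_natDegree_lt (by omega))] at h
    have h3 : ∑ k, lglW N Ψ k * ((legendre N).eval (nd k) *
        (nd k * (derivative (legendre N)).eval (nd k))) = 2 := by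
      rw [Finset.sum_eq_add (0 : Fin (N + 1)) (Fin.last N) (zero_ne_last' hN)]
      · rw [hnd.2.1, hnd.2.2.1, legendre_eval_one, legendre_deriv_eval_one,
          legendre_deriv_eval_neg_one]
        have h4 := legendre_eval_neg_one_sq N
        linear_combination lglW_zero hN hnd hΨ + lglW_last hN hnd hΨ +
          (lglW N Ψ 0 * ((N : ℝ) * (N + 1) / 2)) * h4
      · intro k _ hk
        rw [hnd.legendre_deriv_eval hk.1 hk.2]; ring
      · simp
      · simp
    rw [eq_div_iff hN0.ne', ← h3, Finset.sum_mul, eq_comm, ← sub_eq_zero,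
      ← Finset.sum_sub_distrib, h]
    refine Finset.sum_congr rfl fun k _ => ?_
    simp only [eval_mul, eval_sub, eval_C, eval_X]
    ring
  · have h3 := legendre_euler_natDegree_lt (by omega : 1 ≤ N)
    have := natDegree_mul_le (p := legendre N)
      (q := X * derivative (legendre N) - C (N : ℝ) * legendre N)
    omega

include hN hnd hΨ in
theorem lgl_sum_legendre_mul {p : Polynomial ℝ} (hp : p.natDegree < N) :
    ∑ m, lglW N Ψ m * (legendre N).eval (nd m) * p.eval (nd m) = 0 := by
  have h2 := legendre_natDegree_le N
  have h := lgl_quadrature hN hnd hΨ (p := legendre N * p) (by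
    have := natDegree_mul_le (p := legendre N) (q := p); omega)
  rw [pint_legendre_mul hp] at h
  rw [h]
  refine Finset.sum_congr rfl fun k _ => ?_
  rw [eval_mul]; ring

/-- The Legendre–Gauss–Lobatto collocation data of order `N`. -/
def lglData : LGLData (Fin (N + 1)) where
  N := N
  two_le := hN
  w := lglW N Ψ
  s := nd
  L := fun m => (legendre N).eval (nd m)
  D := fun m l => (derivative (Ψ l)).eval (nd m)
  a := 0
  b := Fin.last N
  w_pos := lglW_pos hN hnd hΨ
  a_ne_b := zero_ne_last' hN
  s_a := hnd.2.1
  s_b := hnd.2.2.1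
  s_sq_le := hnd.sq_le
  L_a := by rw [hnd.2.1]; exact legendre_eval_neg_one_sq N
  L_b := by rw [hnd.2.2.1, legendre_eval_one]; norm_num
  w_a := lglW_zero hN hnd hΨ
  w_b := lglW_last hN hnd hΨ
  sum_L := lgl_sum_legendre_sq hN hnd hΨ
  sum_L_D := fun l => by
    refine lgl_sum_legendre_mul hN hnd hΨ ?_
    have := natDegree_derivative_le (Ψ l)
    have := (hΨ l).1
    omega
  sbp := lgl_sbp_basis hN hnd hΨ
  commutator := lgl_commutator hN hnd hΨ

end LGL

open scoped MatrixOrder in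
theorem Matrix.PosSemidef.exists_eq_transpose_mul {n : Type} [Fintype n] {A : Matrix n n ℝ}
    (hA : A.PosSemidef) : ∃ B : Matrix n n ℝ, A = B.transpose * B := by
  obtain ⟨B, hB⟩ := CStarAlgebra.nonneg_iff_eq_star_mul_self.mp hA.nonneg
  refine ⟨B, hB.trans ?_⟩
  rw [Matrix.star_eq_conjTranspose, Matrix.conjTranspose_eq_transpose_of_trivial]

section Tensor

variable {d : ℕ} {n : Type} [Fintype n]

/-- The tensor product function with coefficients `F` built from one-variable functions. -/
def tens (f : Fin d → n → ℝ → ℝ) (F : (Fin d → n) → ℝ) (x : Fin d → ℝ) : ℝ :=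
  ∑ K, F K * ∏ j, f j (K j) (x j)

/-- The bilinear form with kernel the tensor product of the matrices `A j`. -/
def qf (A : Fin d → Matrix n n ℝ) (F G : (Fin d → n) → ℝ) : ℝ :=
  ∑ K, ∑ L, (∏ j, A j (K j) (L j)) * (F K * G L)

theorem posSemidef_of_sum_nonneg {A : Matrix n n ℝ} (hs : ∀ a b, A a b = A b a)
    (h : ∀ z : n → ℝ, 0 ≤ ∑ a, ∑ b, A a b * (z a * z b)) : A.PosSemidef := by
  refine Matrix.PosSemidef.of_dotProduct_mulVec_nonneg ?_ fun z => ?_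
  · exact Matrix.IsHermitian.ext fun a b => by rw [star_trivial, hs]
  · refine (h z).trans_eq ?_
    simp only [dotProduct, Matrix.mulVec, Finset.mul_sum, Pi.star_apply, star_trivial]
    exact Finset.sum_congr rfl fun a _ => Finset.sum_congr rfl fun b _ => by ring

theorem qf_nonneg {A : Fin d → Matrix n n ℝ} (hA : ∀ j, (A j).PosSemidef)
    (F : (Fin d → n) → ℝ) : 0 ≤ qf A F F := by
  have : ∀ j, ∃ B : Matrix n n ℝ, A j = B.transpose * B := fun j => by
    obtain ⟨B, hB⟩ := (hA j).exists_eq_transpose_mul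
    exact ⟨B, hB⟩
  choose B hB using this
  have key : qf A F F = ∑ M : Fin d → n, (∑ K, (∏ j, B j (M j) (K j)) * F K) ^ 2 := by
    have hl : qf A F F = ∑ K, ∑ L, ∑ M : Fin d → n,
        ((∏ j, B j (M j) (K j)) * F K) * ((∏ j, B j (M j) (L j)) * F L) := by
      refine Finset.sum_congr rfl fun K _ => Finset.sum_congr rfl fun L _ => ?_
      simp only [hB, Matrix.mul_apply, Matrix.transpose_apply, Finset.prod_univ_sum,
        Fintype.piFinset_univ, Finset.sum_mul, Finset.prod_mul_distrib]
      exact Finset.sum_congr rfl fun M _ => by ring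
    simp only [hl, sq, Finset.sum_mul_sum]
    symm
    rw [Finset.sum_comm]
    exact Finset.sum_congr rfl fun K _ => Finset.sum_comm
  rw [key]
  exact Finset.sum_nonneg fun M _ => sq_nonneg _

theorem qf_update_add (A : Fin d → Matrix n n ℝ) (k : Fin d) (B C : Matrix n n ℝ)
    (F G : (Fin d → n) → ℝ) :
    qf (Function.update A k (B + C)) F G =
      qf (Function.update A k B) F G + qf (Function.update A k C) F G := by
  have h : ∀ (M : Matrix n n ℝ) (K L : Fin d → n),
      ∏ j, (Function.update A k M) j (K j) (L j) =
        M (K k) (L k) * ∏ j ∈ Finset.univ.erase k, A j (K j) (L j) := fun M K L => by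
    rw [← Finset.mul_prod_erase Finset.univ _ (Finset.mem_univ k), Function.update_self]
    congr 1
    refine Finset.prod_congr rfl fun j hj => ?_
    rw [Function.update_of_ne (Finset.ne_of_mem_erase hj)]
  simp only [qf, h, Matrix.add_apply, add_mul, Finset.sum_add_distrib]

theorem qf_mono {A B : Fin d → Matrix n n ℝ} (hA : ∀ j, (A j).PosSemidef)
    (hAB : ∀ j, (B j - A j).PosSemidef) (F : (Fin d → n) → ℝ) : qf A F F ≤ qf B F F := by
  have hB : ∀ j, (B j).PosSemidef := fun j => by
    have := (hA j).add (hAB j)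
    rwa [add_sub_cancel] at this
  have key : ∀ s : Finset (Fin d), qf A F F ≤ qf (fun j => if j ∈ s then B j else A j) F F := by
    intro s
    induction s using Finset.induction_on with
    | empty => simp
    | insert k s hk ih =>
      refine ih.trans ?_
      have h1 : (fun j => if j ∈ insert k s then B j else A j) =
          Function.update (fun j => if j ∈ s then B j else A j) k (A k + (B k - A k)) := by
        funext j
        by_cases hj : j = k
        · subst hj; simp
        · simp [hj]
      have h2 : (fun j => if j ∈ s then B j else A j) =
          Function.update (fun j => if j ∈ s then B j else A j) k (A k) := by
        rw [Function.eq_update_iff]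
        simp [hk]
      rw [h1, qf_update_add, ← h2]
      have := qf_nonneg (A := Function.update (fun j => if j ∈ s then B j else A j) k (B k - A k))
        (fun j => ?_) F
      · linarith
      · by_cases hj : j = k
        · subst hj; simpa using hAB j
        · rw [Function.update_of_ne hj]
          split_ifs
          · exact hB j
          · exact hA j
  simpa using key Finset.univ

theorem qf_smul (c : Fin d → ℝ) (A : Fin d → Matrix n n ℝ) (F G : (Fin d → n) → ℝ) :
    qf (fun j => c j • A j) F G = (∏ j, c j) * qf A F G := by
  simp only [qf, Matrix.smul_apply, smul_eq_mul, Finset.prod_mul_distrib, Finset.mul_sum, mul_assoc]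

theorem qf_update_diagonal [DecidableEq n] (w : n → ℝ) (k : Fin d) (A : Matrix n n ℝ)
    (F G : (Fin d → n) → ℝ) :
    qf (Function.update (fun _ => Matrix.diagonal w) k (Matrix.diagonal w * A)) F G =
      gip d w F (op k A G) := by
  rw [qf, gip_apply]
  refine Finset.sum_congr rfl fun K _ => ?_
  have hsub : ∑ L, (∏ j, (Function.update (fun _ => Matrix.diagonal w) k
        (Matrix.diagonal w * A) : Fin d → Matrix n n ℝ) j (K j) (L j)) * (F K * G L) =
      ∑ m, (∏ j, (Function.update (fun _ => Matrix.diagonal w) k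
        (Matrix.diagonal w * A) : Fin d → Matrix n n ℝ) j (K j) (Function.update K k m j)) *
          (F K * G (Function.update K k m)) := by
    have hinj : Function.Injective fun m => Function.update K k m := fun a b h => by
      have := congrFun h k
      simpa using this
    rw [← Finset.sum_image (f := fun L => (∏ j, (Function.update (fun _ => Matrix.diagonal w) k
        (Matrix.diagonal w * A) : Fin d → Matrix n n ℝ) j (K j) (L j)) * (F K * G L))
        (g := fun m => Function.update K k m) (s := Finset.univ) hinj.injOn]
    symm
    refine Finset.sum_subset (Finset.subset_univ _) fun L _ hL => ?_
    have : ∃ j, j ≠ k ∧ K j ≠ L j := by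
      by_contra! hc
      apply hL
      refine Finset.mem_image.mpr ⟨L k, Finset.mem_univ _, ?_⟩
      rw [Function.update_eq_iff]
      exact ⟨rfl, fun j hj => hc j hj⟩
    obtain ⟨j, hj, hne⟩ := this
    rw [Finset.prod_eq_zero (Finset.mem_univ j), zero_mul]
    rw [Function.update_of_ne hj, Matrix.diagonal_apply_ne _ hne]
  rw [hsub, op_apply, Finset.mul_sum, Finset.mul_sum]
  refine Finset.sum_congr rfl fun m _ => ?_
  have : ∏ j, (Function.update (fun _ => Matrix.diagonal w) k
      (Matrix.diagonal w * A) : Fin d → Matrix n n ℝ) j (K j) (Function.update K k m j) =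
      (∏ j, w (K j)) * A (K k) m := by
    rw [← Finset.mul_prod_erase Finset.univ _ (Finset.mem_univ k),
      ← Finset.mul_prod_erase Finset.univ (fun j => w (K j)) (Finset.mem_univ k),
      Function.update_self, Function.update_self, Matrix.diagonal_mul]
    have : ∏ j ∈ Finset.univ.erase k, (Function.update (fun _ => Matrix.diagonal w) k
        (Matrix.diagonal w * A) : Fin d → Matrix n n ℝ) j (K j) (Function.update K k m j) =
        ∏ j ∈ Finset.univ.erase k, w (K j) :=
      Finset.prod_congr rfl fun j hj => by
        rw [Function.update_of_ne (Finset.ne_of_mem_erase hj),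
          Function.update_of_ne (Finset.ne_of_mem_erase hj), Matrix.diagonal_apply_eq]
    rw [this]; ring
  rw [this]; ring

theorem qf_diagonal [DecidableEq n] (w : n → ℝ) (F G : (Fin d → n) → ℝ) :
    qf (fun _ => Matrix.diagonal w) F G = gip d w F G := by
  rw [qf, gip_apply]
  refine Finset.sum_congr rfl fun K _ => ?_
  rw [Finset.sum_eq_single K]
  · simp
  · intro L _ hL
    obtain ⟨j, hj⟩ := Function.ne_iff.mp hL
    rw [Finset.prod_eq_zero (Finset.mem_univ j), zero_mul]
    exact Matrix.diagonal_apply_ne _ (Ne.symm hj)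
  · simp

theorem integrable_tens_mul {ν : Measure ℝ} [SigmaFinite ν] {f g : Fin d → n → ℝ → ℝ}
    (h : ∀ j k l, Integrable (fun x => f j k x * g j l x) ν) (F G : (Fin d → n) → ℝ) :
    Integrable (fun x => tens f F x * tens g G x) (Measure.pi fun _ => ν) := by
  have : (fun x => tens f F x * tens g G x) = fun x => ∑ K, ∑ L, (F K * G L) *
      ∏ j, (f j (K j) (x j) * g j (L j) (x j)) := by
    funext x
    simp only [tens, Finset.sum_mul_sum, Finset.prod_mul_distrib]
    exact Finset.sum_congr rfl fun K _ => Finset.sum_congr rfl fun L _ => by ring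
  rw [this]
  refine integrable_finsetSum _ fun K _ => integrable_finsetSum _ fun L _ => ?_
  exact (Integrable.fintype_prod fun j => h j (K j) (L j)).const_mul _

theorem integral_tens_mul {ν : Measure ℝ} [SigmaFinite ν] {f g : Fin d → n → ℝ → ℝ}
    (h : ∀ j k l, Integrable (fun x => f j k x * g j l x) ν) (F G : (Fin d → n) → ℝ) :
    ∫ x, tens f F x * tens g G x ∂(Measure.pi fun _ => ν) =
      qf (fun j k l => ∫ x, f j k x * g j l x ∂ν) F G := by
  have : (fun x => tens f F x * tens g G x) = fun x => ∑ K, ∑ L, (F K * G L) *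
      ∏ j, (f j (K j) (x j) * g j (L j) (x j)) := by
    funext x
    simp only [tens, Finset.sum_mul_sum, Finset.prod_mul_distrib]
    exact Finset.sum_congr rfl fun K _ => Finset.sum_congr rfl fun L _ => by ring
  have hi : ∀ K L : Fin d → n, Integrable (fun x : Fin d → ℝ => (F K * G L) *
      ∏ j, (f j (K j) (x j) * g j (L j) (x j))) (Measure.pi fun _ => ν) := fun K L =>
    (Integrable.fintype_prod fun j => h j (K j) (L j)).const_mul _
  rw [this, integral_finsetSum _ fun K _ => integrable_finsetSum _ fun L _ => hi K L]
  refine Finset.sum_congr rfl fun K _ => ?_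
  rw [integral_finsetSum _ fun L _ => hi K L]
  refine Finset.sum_congr rfl fun L _ => ?_
  rw [integral_const_mul, mul_comm,
    integral_fintype_prod_eq_prod (fun j x => f j (K j) x * g j (L j) x)]

theorem pd_eq_of_hasDerivAt {f : (Fin d → ℝ) → ℝ} {x : Fin d → ℝ} {k : Fin d} {c : ℝ}
    (hf : DifferentiableAt ℝ f x)
    (h : HasDerivAt (fun t => f (Function.update x k t)) c (x k)) : pd k f x = c := by
  have h1 := hasDerivAt_update x k (x k)
  have h2 : HasFDerivAt f (fderiv ℝ f x) (Function.update x k (x k)) := by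
    rw [Function.update_eq_self]; exact hf.hasFDerivAt
  exact (h2.comp_hasDerivAt (x k) h1).unique h

theorem tens_differentiable {f : Fin d → n → ℝ → ℝ} (hf : ∀ j k, Differentiable ℝ (f j k))
    (F : (Fin d → n) → ℝ) : Differentiable ℝ (tens f F) := by
  unfold tens
  refine Differentiable.fun_sum fun K _ => Differentiable.const_mul ?_ _
  intro x
  exact (HasFDerivAt.finsetProd (u := Finset.univ)
    (g := fun (j : Fin d) (x : Fin d → ℝ) => f j (K j) (x j))
    fun j _ => (((hf j (K j)).comp (f := fun x : Fin d → ℝ => x j)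
      (differentiable_apply j)) x).hasFDerivAt).differentiableAt

theorem tens_contDiff {f : Fin d → n → ℝ → ℝ} {m : WithTop ℕ∞}
    (hf : ∀ j k, ContDiff ℝ m (f j k)) (F : (Fin d → n) → ℝ) : ContDiff ℝ m (tens f F) := by
  unfold tens
  refine ContDiff.sum fun K _ => contDiff_const.mul ?_
  exact contDiff_prod fun j _ => (hf j (K j)).comp (contDiff_apply ℝ ℝ j)

theorem prod_update_erase (g : Fin d → ℝ → ℝ) (x : Fin d → ℝ) (k : Fin d) (t : ℝ) :
    ∏ j, g j (Function.update x k t j) = g k t * ∏ j ∈ Finset.univ.erase k, g j (x j) := by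
  rw [← Finset.mul_prod_erase Finset.univ _ (Finset.mem_univ k), Function.update_self]
  congr 1
  refine Finset.prod_congr rfl fun j hj => ?_
  rw [Function.update_of_ne (Finset.ne_of_mem_erase hj)]

theorem tens_update_left (f : Fin d → n → ℝ → ℝ) (k : Fin d) (g : n → ℝ → ℝ)
    (F : (Fin d → n) → ℝ) (x : Fin d → ℝ) :
    tens (Function.update f k g) F x =
      ∑ K, F K * (g (K k) (x k) * ∏ j ∈ Finset.univ.erase k, f j (K j) (x j)) := by
  refine Finset.sum_congr rfl fun K _ => ?_
  rw [← Finset.mul_prod_erase Finset.univ _ (Finset.mem_univ k), Function.update_self]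
  congr 2
  refine Finset.prod_congr rfl fun j hj => ?_
  rw [Function.update_of_ne (Finset.ne_of_mem_erase hj)]

theorem tens_update_right (f : Fin d → n → ℝ → ℝ) (k : Fin d) (t : ℝ)
    (F : (Fin d → n) → ℝ) (x : Fin d → ℝ) :
    tens f F (Function.update x k t) =
      tens (Function.update f k fun a _ => f k a t) F x := by
  rw [tens_update_left]
  refine Finset.sum_congr rfl fun K _ => ?_
  rw [prod_update_erase (fun j => f j (K j))]

theorem pd_tens {f : Fin d → n → ℝ → ℝ} (hf : ∀ j k, Differentiable ℝ (f j k)) (k : Fin d)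
    (F : (Fin d → n) → ℝ) :
    pd k (tens f F) = tens (Function.update f k fun a => deriv (f k a)) F := by
  funext x
  refine pd_eq_of_hasDerivAt (tens_differentiable hf F x) ?_
  have h1 : (fun t => tens f F (Function.update x k t)) = fun t =>
      ∑ K, F K * (f k (K k) t * ∏ j ∈ Finset.univ.erase k, f j (K j) (x j)) := by
    funext t
    rw [tens_update_right, tens_update_left]
  rw [h1, tens_update_left]
  exact HasDerivAt.fun_sum fun K _ => (((hf k (K k) (x k)).hasDerivAt).mul_const _).const_mul _

end Tensor

section Interp

variable {d N : ℕ}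

theorem MemPolyN.sum {ι : Type} {s : Finset ι} {p : ι → Vec d → ℝ}
    (h : ∀ i ∈ s, MemPolyN d N (p i)) : MemPolyN d N fun x => ∑ i ∈ s, p i x := by
  choose! q hq hqe using h
  refine ⟨∑ i ∈ s, q i, fun j => ?_, fun x => ?_⟩
  · exact (MvPolynomial.degreeOf_sum_le j s q).trans (Finset.sup_le fun i hi => hq i hi j)
  · rw [map_sum]
    exact Finset.sum_congr rfl fun i hi => hqe i hi x

theorem MemPolyN.const_mul {p : Vec d → ℝ} (h : MemPolyN d N p) (c : ℝ) :
    MemPolyN d N fun x => c * p x := by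
  obtain ⟨q, hq, hqe⟩ := h
  refine ⟨MvPolynomial.C c * q, fun j => ?_, fun x => ?_⟩
  · exact (MvPolynomial.degreeOf_C_mul_le q j c).trans (hq j)
  · rw [map_mul, MvPolynomial.eval_C, hqe]

theorem memPolyN_prod {p : Fin d → Polynomial ℝ} (hp : ∀ j, (p j).natDegree ≤ N) :
    MemPolyN d N fun x => ∏ j, (p j).eval (x j) := by
  have hdeg : ∀ i j, (Polynomial.aeval (MvPolynomial.X j : MvPolynomial (Fin d) ℝ) (p j)).degreeOf i
      ≤ if i = j then N else 0 := by
    intro i j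
    rw [Polynomial.aeval_eq_sum_range]
    refine (MvPolynomial.degreeOf_sum_le _ _ _).trans (Finset.sup_le fun m hm => ?_)
    rw [MvPolynomial.smul_eq_C_mul]
    refine (MvPolynomial.degreeOf_C_mul_le _ _ _).trans ((MvPolynomial.degreeOf_pow_le _ _ _).trans ?_)
    have := Finset.mem_range.mp hm
    have := hp j
    rw [MvPolynomial.degreeOf_X]
    split_ifs <;> omega
  refine ⟨∏ j, Polynomial.aeval (MvPolynomial.X j) (p j), fun i => ?_, fun x => ?_⟩
  · refine (MvPolynomial.degreeOf_prod_le _ _ _).trans ?_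
    refine (Finset.sum_le_sum fun j _ => hdeg i j).trans ?_
    simp
  · rw [map_prod]
    refine Finset.prod_congr rfl fun j _ => ?_
    rw [Polynomial.eval_eq_sum_range, Polynomial.aeval_eq_sum_range, map_sum]
    refine Finset.sum_congr rfl fun m _ => ?_
    rw [MvPolynomial.smul_eval, map_pow, MvPolynomial.eval_X]

/-- Tensor-product Lagrange interpolation of a grid function. -/
def interp (Ψ : Fin (N + 1) → Polynomial ℝ) (F : (Fin d → Fin (N + 1)) → ℝ) : Vec d → ℝ :=
  tens (fun _ k x => (Ψ k).eval x) F

variable {nd : Fin (N + 1) → ℝ} (hnd : IsLGL N nd)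
  {Ψ : Fin (N + 1) → Polynomial ℝ} (hΨ : IsLagrange N nd Ψ)

include hΨ in
theorem interp_memPolyN (F : (Fin d → Fin (N + 1)) → ℝ) : MemPolyN d N (interp Ψ F) :=
  MemPolyN.sum fun _ _ => (memPolyN_prod fun _ => (hΨ _).1).const_mul _

include hΨ in
theorem interp_nodeP (F : (Fin d → Fin (N + 1)) → ℝ) (K : Fin d → Fin (N + 1)) :
    interp Ψ F (nodeP nd K) = F K := by
  unfold interp tens nodeP
  rw [Finset.sum_eq_single K]
  · simp [(hΨ _).2]
  · intro L _ hL
    obtain ⟨j, hj⟩ := Function.ne_iff.mp hL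
    rw [Finset.prod_eq_zero (Finset.mem_univ j), mul_zero]
    change (Ψ (L j)).eval (nd (K j)) = 0
    rw [(hΨ _).2, if_neg (Ne.symm hj)]
  · simp

include hnd hΨ in
theorem MemPolyN.eq_interp {p : Vec d → ℝ} (hp : MemPolyN d N p) :
    p = interp Ψ fun K => p (nodeP nd K) := by
  obtain ⟨q, hq, hqe⟩ := hp
  obtain ⟨r, hr, hre⟩ := interp_memPolyN hΨ fun K => p (nodeP nd K)
  have : q - r = 0 := by
    refine MvPolynomial.eq_zero_of_eval_zero_at_prod_finset (q - r)
      (fun _ => Finset.univ.image nd) (fun j => ?_) fun x hx => ?_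
    · rw [Finset.card_image_of_injective _ hnd.1.injective, Finset.card_fin]
      exact Nat.lt_succ_of_le ((MvPolynomial.degreeOf_sub_le _ _ _).trans (max_le (hq j) (hr j)))
    · have : ∀ j, ∃ k, nd k = x j := fun j => by
        obtain ⟨k, -, hk⟩ := Finset.mem_image.mp (hx j)
        exact ⟨k, hk⟩
      choose K hK using this
      have hxK : x = nodeP nd K := funext fun j => (hK j).symm
      rw [map_sub, hqe, hre, hxK, interp_nodeP hΨ, sub_self]
  funext x
  rw [← hqe, ← hre, sub_eq_zero.mp this]

include hnd hΨ in
theorem IsLagrange.deriv_eval (k : Fin (N + 1)) (x : ℝ) :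
    deriv (fun x => (Ψ k).eval x) x =
      ∑ m, (derivative (Ψ k)).eval (nd m) * (Ψ m).eval x := by
  rw [Polynomial.deriv]
  conv_lhs => rw [hΨ.eq_sum hnd (p := derivative (Ψ k)) (by
    have := natDegree_derivative_le (Ψ k)
    have := (hΨ k).1
    omega)]
  simp [eval_finsetSum]

/-- Applying a matrix in the `k`-th coordinate of the grid corresponds to changing the `k`-th
family of functions. -/
theorem tens_op {n : Type} [Fintype n] (f : Fin d → n → ℝ → ℝ) (k : Fin d) (A : Matrix n n ℝ)
    (F : (Fin d → n) → ℝ) :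
    tens f (op k A F) = tens (Function.update f k fun a x => ∑ m, A m a * f k m x) F := by
  funext x
  rw [tens_update_left]
  simp only [tens, op_apply, Finset.sum_mul, Finset.mul_sum]
  rw [← Fintype.sum_prod_type', ← Fintype.sum_prod_type']
  refine Fintype.sum_equiv (swapEntry k) _ _ fun p => ?_
  obtain ⟨K, m⟩ := p
  have hs : swapEntry k (K, m) = (Function.update K k m, K k) := rfl
  have he : ∏ j ∈ Finset.univ.erase k, f j (Function.update K k m j) (x j) =
      ∏ j ∈ Finset.univ.erase k, f j (K j) (x j) :=
    Finset.prod_congr rfl fun j hj => by rw [Function.update_of_ne (Finset.ne_of_mem_erase hj)]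
  simp only [hs, Function.update_self, he]
  rw [← Finset.mul_prod_erase _ _ (Finset.mem_univ k)]
  ring

include hnd hΨ in
theorem pd_interp (k : Fin d) (F : (Fin d → Fin (N + 1)) → ℝ) :
    pd k (interp Ψ F) = interp Ψ (op k (Matrix.of fun m l => (derivative (Ψ l)).eval (nd m)) F) := by
  unfold interp
  rw [pd_tens (fun _ k => (Ψ k).differentiable), tens_op]
  congr 2
  funext a x
  rw [hΨ.deriv_eval hnd]
  rfl

theorem restrict_cubeO (d : ℕ) : (volume : Measure (Vec d)).restrict (cubeO d) =
    Measure.pi fun _ => (volume : Measure ℝ).restrict (Set.Ioo (-1) 1) := by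
  rw [cubeO, volume_pi, Measure.restrict_pi_pi]

theorem restrict_cubeC (d : ℕ) : (volume : Measure (Vec d)).restrict (cubeC d) =
    Measure.pi fun _ => (volume : Measure ℝ).restrict (Set.Ioo (-1) 1) := by
  rw [cubeC, volume_pi, Measure.restrict_pi_pi]
  simp only [restrict_Ioo_eq_restrict_Icc]

theorem setIntegral_Ioo_eval (p : Polynomial ℝ) :
    ∫ x in Set.Ioo (-1 : ℝ) 1, p.eval x = pint p := by
  rw [pint_apply, intervalIntegral.integral_of_le (by norm_num), integral_Ioc_eq_integral_Ioo]

theorem integrableOn_Ioo_of_continuous {f : ℝ → ℝ} (hf : Continuous f) :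
    Integrable f ((volume : Measure ℝ).restrict (Set.Ioo (-1) 1)) :=
  (hf.integrableOn_Icc (a := -1) (b := 1)).mono_set Set.Ioo_subset_Icc_self

end Interp

theorem pint_mul_sq_le (p q : Polynomial ℝ) : pint (p * q) ^ 2 ≤ pint (p * p) * pint (q * q) := by
  have h : ∀ t : ℝ, 0 ≤ pint (p * p) * (t * t) + (2 * pint (p * q)) * t + pint (q * q) := by
    intro t
    have h0 := pint_sq_nonneg (C t * p + q)
    have : (C t * p + q) * (C t * p + q) = C (t * t) * (p * p) + C (2 * t) * (p * q) + q * q := by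
      rw [C_mul, C_mul, C_ofNat]; ring
    rw [this, map_add, map_add, pint_C_mul, pint_C_mul] at h0
    linarith
  have := discrim_le_zero h
  rw [discrim] at this
  linarith

theorem natDegree_lt_of_coeff_eq_zero {p : Polynomial ℝ} {N : ℕ} (hN : 1 ≤ N)
    (hp : p.natDegree ≤ N) (h : p.coeff N = 0) : p.natDegree < N := by
  rcases hp.lt_or_eq with h1 | h1
  · exact h1
  · have h2 : p.leadingCoeff = 0 := by rw [leadingCoeff, h1, h]
    rw [leadingCoeff_eq_zero] at h2
    rw [h2, natDegree_zero]
    omega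

theorem legendre_coeff_ne_zero {N : ℕ} (hN : 1 ≤ N) : (legendre N).coeff N ≠ 0 := by
  intro h
  have h1 := pint_legendre_sq hN
  rw [pint_legendre_mul (natDegree_lt_of_coeff_eq_zero hN (legendre_natDegree_le N) h)] at h1
  norm_num at h1

theorem exists_sub_legendre_natDegree_lt {N : ℕ} (hN : 1 ≤ N) {p : Polynomial ℝ}
    (hp : p.natDegree ≤ N) :
    ∃ (c : ℝ) (r : Polynomial ℝ), p = C c * legendre N + r ∧ r.natDegree < N ∧
      p.coeff N = c * (legendre N).coeff N := by
  have h0 := legendre_coeff_ne_zero hN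
  refine ⟨p.coeff N / (legendre N).coeff N, p - C (p.coeff N / (legendre N).coeff N) * legendre N,
    by ring, natDegree_lt_of_coeff_eq_zero hN ?_ ?_, by field_simp⟩
  · exact (natDegree_sub_le _ _).trans
      (max_le hp ((natDegree_C_mul_le _ _).trans (legendre_natDegree_le N)))
  · rw [coeff_sub, coeff_C_mul]
    field_simp
    ring

theorem pint_X_mul_legendre_deriv (N : ℕ) :
    pint (legendre N * (X * derivative (legendre N))) * 2 = 2 - pint (legendre N * legendre N) := by
  have h := pint_derivative (X * (legendre N * legendre N))
  have e : derivative (X * (legendre N * legendre N)) = legendre N * legendre N +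
      (legendre N * (X * derivative (legendre N)) + legendre N * (X * derivative (legendre N))) := by
    simp only [derivative_mul, derivative_X]; ring
  rw [e, map_add, map_add] at h
  have h1 := legendre_eval_neg_one_sq N
  simp only [eval_mul, eval_X, legendre_eval_one] at h
  nlinarith

theorem legendre_coeff_succ {N : ℕ} (hN : 1 ≤ N) :
    ((N : ℝ) + 1) * (legendre (N + 1)).coeff (N + 1) = (2 * N + 1) * (legendre N).coeff N := by
  have hdeg : (derivative (legendre (N + 1))).natDegree ≤ N := by
    have := natDegree_derivative_le (legendre (N + 1))
    have := legendre_natDegree_le (N + 1)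
    omega
  obtain ⟨c, r, hc, hr, hcc⟩ := exists_sub_legendre_natDegree_lt hN hdeg
  have h1 : pint (derivative (legendre (N + 1)) * legendre N) = 2 := by
    rw [pint_derivative_mul, pint_legendre_mul]
    · simp only [legendre_eval_one, legendre_eval_neg_one, pow_succ]
      have := pow_mul_pow_eq_one N (show (-1 : ℝ) * -1 = 1 by norm_num)
      linarith
    · have := natDegree_derivative_le (legendre N)
      have := legendre_natDegree_le N
      omega
  have h2 : pint (derivative (legendre (N + 1)) * legendre N) =
      c * pint (legendre N * legendre N) := by
    rw [hc, add_mul, map_add, mul_comm r, pint_legendre_mul hr, mul_assoc, pint_C_mul, add_zero]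
  have h3 := pint_legendre_sq hN
  rw [coeff_derivative] at hcc
  have h4 : c = 2 * N + 1 := by
    have : (0 : ℝ) < 2 * N + 1 := by positivity
    rw [h1] at h2
    have h5 : c * (pint (legendre N * legendre N) * (2 * N + 1)) = 2 * (2 * N + 1) := by
      rw [← mul_assoc, ← h2]
    rw [h3] at h5
    linarith
  rw [← h4, ← hcc]
  ring

theorem pint_bubble_legendre {N : ℕ} (hN : 1 ≤ N) :
    pint ((1 - X ^ 2) * derivative (legendre (N + 1)) * legendre N) *
      ((2 * N + 1) * (2 * N + 3)) = 2 * (N + 1) * (N + 2) := by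
  obtain ⟨Q, hQ⟩ : ∃ Q : Polynomial ℝ, Q = derivative ((1 - X ^ 2) * legendre N) := ⟨_, rfl⟩
  have h1 : pint ((1 - X ^ 2) * derivative (legendre (N + 1)) * legendre N) =
      -pint (legendre (N + 1) * Q) := by
    rw [show (1 - X ^ 2) * derivative (legendre (N + 1)) * legendre N =
      derivative (legendre (N + 1)) * ((1 - X ^ 2) * legendre N) by ring, pint_derivative_mul, ← hQ]
    simp
  set r : Polynomial ℝ := C (2 * (N : ℝ) + 1) * Q + C ((N : ℝ) + 2) * (X * derivative (legendre (N + 1)))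
    with hr
  have hQc : Q.coeff (N + 1) = -((legendre N).coeff N * (N + 2)) := by
    rw [hQ, coeff_derivative, sub_mul, one_mul, coeff_sub, coeff_X_pow_mul',
      if_pos (by omega), show N + 1 + 1 - 2 = N by omega, coeff_eq_zero_of_natDegree_lt (by have := legendre_natDegree_le N; omega)]
    push_cast
    ring
  have hrd : r.natDegree < N + 1 := by
    refine natDegree_lt_of_coeff_eq_zero (by omega) ?_ ?_
    · refine (natDegree_add_le _ _).trans (max_le ?_ ?_)
      · refine (natDegree_C_mul_le _ _).trans ?_
        have h2 := natDegree_derivative_le ((1 - X ^ 2) * legendre N)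
        rw [← hQ] at h2
        have h3 : ((1 - X ^ 2 : Polynomial ℝ) * legendre N).natDegree ≤ 2 + N :=
          natDegree_mul_le.trans (add_le_add (by compute_degree) (legendre_natDegree_le N))
        omega
      · refine (natDegree_C_mul_le _ _).trans ?_
        have h2 := natDegree_derivative_le (legendre (N + 1))
        have h3 := legendre_natDegree_le (N + 1)
        refine natDegree_mul_le.trans ?_
        rw [natDegree_X]
        omega
    · rw [hr, coeff_add, coeff_C_mul, coeff_C_mul, coeff_X_mul, hQc, coeff_derivative]
      have := legendre_coeff_succ hN
      linear_combination ((N : ℝ) + 2) * this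
  have h2 := pint_legendre_mul hrd
  rw [show legendre (N + 1) * r = C (2 * (N : ℝ) + 1) * (legendre (N + 1) * Q) +
    C ((N : ℝ) + 2) * (legendre (N + 1) * (X * derivative (legendre (N + 1)))) by rw [hr]; ring,
    map_add, pint_C_mul, pint_C_mul] at h2
  have h3 := pint_X_mul_legendre_deriv (N + 1)
  have h4 := pint_legendre_sq (N := N + 1) (by omega)
  push_cast at h4
  rw [h1]
  linear_combination (-(2 * (N : ℝ) + 3)) * h2 + ((N : ℝ) + 2) * (2 * N + 3) / 2 * h3
    - ((N : ℝ) + 2) / 2 * h4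

theorem pint_bubble_sq (N : ℕ) :
    pint ((1 - X ^ 2) * (derivative (legendre N) * derivative (legendre N))) =
      N * (N + 1) * pint (legendre N * legendre N) := by
  have h := pint_derivative_mul ((1 - X ^ 2) * derivative (legendre N)) (legendre N)
  rw [legendre_ode] at h
  rw [show -C ((N : ℝ) * (N + 1)) * legendre N * legendre N =
    C (-((N : ℝ) * (N + 1))) * (legendre N * legendre N) by rw [C_neg]; ring, pint_C_mul] at h
  rw [show (1 - X ^ 2) * (derivative (legendre N) * derivative (legendre N)) =
    (1 - X ^ 2) * derivative (legendre N) * derivative (legendre N) by ring]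
  simp only [eval_mul, eval_sub, eval_one, eval_pow, eval_X] at h
  linarith

theorem pint_mono {p q : Polynomial ℝ} (h : ∀ x ∈ Set.Icc (-1 : ℝ) 1, p.eval x ≤ q.eval x) :
    pint p ≤ pint q :=
  intervalIntegral.integral_mono_on (by norm_num) (p.continuous.intervalIntegrable _ _)
    (q.continuous.intervalIntegrable _ _) h

theorem pint_sq_bubble_le (p : Polynomial ℝ) :
    pint ((1 - X ^ 2) * p * ((1 - X ^ 2) * p)) ≤ pint ((1 - X ^ 2) * (p * p)) := by
  refine pint_mono fun x hx => ?_
  simp only [eval_mul, eval_sub, eval_one, eval_pow, eval_X]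
  have h1 : 0 ≤ 1 - x ^ 2 := by nlinarith [hx.1, hx.2]
  nlinarith [mul_nonneg (mul_nonneg h1 (sq_nonneg x)) (sq_nonneg (p.eval x))]

/-- The bubble function used to turn interpolation into `L²`-projection. -/
def corrector (N : ℕ) : Polynomial ℝ :=
  C ((2 * (N : ℝ) + 3) / (2 * (N + 2))) * ((1 - X ^ 2) * derivative (legendre (N + 1)))

theorem pint_corrector_sq_le (N : ℕ) : pint (corrector N * corrector N) ≤ N + 1 := by
  set c := (2 * (N : ℝ) + 3) / (2 * (N + 2)) with hc
  have e : corrector N * corrector N = C (c * c) * ((1 - X ^ 2) * derivative (legendre (N + 1)) *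
      ((1 - X ^ 2) * derivative (legendre (N + 1)))) := by
    rw [corrector, C_mul]; ring
  have h1 := pint_sq_bubble_le (derivative (legendre (N + 1)))
  rw [pint_bubble_sq] at h1
  have h2 := pint_legendre_sq (N := N + 1) (by omega)
  push_cast at h1 h2
  rw [e, pint_C_mul]
  have h3 : pint (legendre (N + 1) * legendre (N + 1)) = 2 / (2 * N + 3) := by
    field_simp; linarith
  rw [h3] at h1
  refine (mul_le_mul_of_nonneg_left h1 (mul_self_nonneg c)).trans ?_
  rw [hc]
  rw [div_mul_div_comm, mul_div_assoc', div_mul_div_comm, div_le_iff₀ (by positivity)]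
  have : (0 : ℝ) ≤ N := by positivity
  nlinarith [mul_nonneg this this, mul_nonneg (mul_nonneg this this) this,
    mul_nonneg (mul_nonneg this this) (mul_nonneg this this)]

theorem derivative_corrector (N : ℕ) : derivative (corrector N) =
    C (-((2 * (N : ℝ) + 3) * (N + 1) / 2)) * legendre (N + 1) := by
  rw [corrector, derivative_C_mul, legendre_ode, neg_mul, mul_neg, ← mul_assoc, ← C_mul, ← neg_mul,
    ← C_neg]
  congr 2
  push_cast
  field_simp
  ring

theorem pint_derivative_corrector_sq (N : ℕ) :
    pint (derivative (corrector N) * derivative (corrector N)) =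
      (2 * N + 3) * (N + 1) ^ 2 / 2 := by
  have h2 := pint_legendre_sq (N := N + 1) (by omega)
  push_cast at h2
  rw [derivative_corrector, show ∀ (c : ℝ) (L : Polynomial ℝ), C c * L * (C c * L) =
    C (c * c) * (L * L) by intro c L; rw [C_mul]; ring, pint_C_mul]
  linear_combination (2 * (N : ℝ) + 3) * (N + 1) ^ 2 / 4 * h2

section Projection

variable {N : ℕ} (hN : 2 ≤ N) {nd : Fin (N + 1) → ℝ} (hnd : IsLGL N nd)
  {Ψ : Fin (N + 1) → Polynomial ℝ} (hΨ : IsLagrange N nd Ψ)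

/-- The quadrature of `L_N p`. -/
def quadL (N : ℕ) (nd : Fin (N + 1) → ℝ) (Ψ : Fin (N + 1) → Polynomial ℝ) (p : Polynomial ℝ) : ℝ :=
  ∑ k, lglW N Ψ k * (legendre N).eval (nd k) * p.eval (nd k)

theorem quadL_add (p q : Polynomial ℝ) : quadL N nd Ψ (p + q) = quadL N nd Ψ p + quadL N nd Ψ q := by
  simp only [quadL, eval_add, mul_add, Finset.sum_add_distrib]

theorem quadL_C_mul (c : ℝ) (p : Polynomial ℝ) : quadL N nd Ψ (C c * p) = c * quadL N nd Ψ p := by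
  simp only [quadL, eval_mul, eval_C, Finset.mul_sum]
  exact Finset.sum_congr rfl fun k _ => by ring

include hΨ in
theorem quadL_basis (k : Fin (N + 1)) :
    quadL N nd Ψ (Ψ k) = lglW N Ψ k * (legendre N).eval (nd k) := by
  rw [quadL, Finset.sum_eq_single k]
  · rw [(hΨ k).2, if_pos rfl, mul_one]
  · intro m _ hm
    rw [(hΨ k).2, if_neg hm, mul_zero]
  · simp

include hN hnd hΨ in
theorem quadL_legendre : quadL N nd Ψ (legendre N) = 2 / N := by
  rw [← lgl_sum_legendre_sq hN hnd hΨ, quadL]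
  exact Finset.sum_congr rfl fun k _ => by ring

include hN hnd hΨ in
theorem quadL_of_natDegree_lt {p : Polynomial ℝ} (hp : p.natDegree < N) : quadL N nd Ψ p = 0 :=
  lgl_sum_legendre_mul hN hnd hΨ hp

include hN hnd hΨ in
/-- The defect of the quadrature on products of polynomials of degree `≤ N`. -/
theorem pint_mul_eq {p q : Polynomial ℝ} (hp : p.natDegree ≤ N) (hq : q.natDegree ≤ N) :
    pint (p * q) = (∑ k, lglW N Ψ k * (p.eval (nd k) * q.eval (nd k))) -
      (N : ℝ) * (N + 1) / (2 * (2 * N + 1)) * (quadL N nd Ψ p * quadL N nd Ψ q) := by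
  obtain ⟨a, r, rfl, hr, -⟩ := exists_sub_legendre_natDegree_lt (by omega : 1 ≤ N) hp
  obtain ⟨b, t, rfl, ht, -⟩ := exists_sub_legendre_natDegree_lt (by omega : 1 ≤ N) hq
  have hrt := lgl_quadrature hN hnd hΨ (p := r * t) (by
    have := natDegree_mul_le (p := r) (q := t)
    omega)
  have e1 : pint ((C a * legendre N + r) * (C b * legendre N + t)) =
      a * b * pint (legendre N * legendre N) + pint (r * t) := by
    rw [show (C a * legendre N + r) * (C b * legendre N + t) = C (a * b) * (legendre N * legendre N)
      + C a * (legendre N * t) + C b * (legendre N * r) + r * t by rw [C_mul]; ring]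
    simp only [map_add, pint_C_mul, pint_legendre_mul hr, pint_legendre_mul ht]
    ring
  have e2 : ∑ k, lglW N Ψ k * ((C a * legendre N + r).eval (nd k) *
      (C b * legendre N + t).eval (nd k)) =
      a * b * quadL N nd Ψ (legendre N) + a * quadL N nd Ψ t + b * quadL N nd Ψ r +
        ∑ k, lglW N Ψ k * (r * t).eval (nd k) := by
    simp only [quadL, Finset.mul_sum, ← Finset.sum_add_distrib]
    refine Finset.sum_congr rfl fun k _ => ?_
    simp only [eval_add, eval_mul, eval_C]
    ring
  rw [e1, e2, hrt]
  simp only [quadL_add, quadL_C_mul, quadL_legendre hN hnd hΨ, quadL_of_natDegree_lt hN hnd hΨ hr,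
    quadL_of_natDegree_lt hN hnd hΨ ht]
  have h1 := pint_legendre_sq (by omega : 1 ≤ N)
  have hN0 : (N : ℝ) ≠ 0 := by positivity
  have h2 : pint (legendre N * legendre N) = 2 / (2 * N + 1) := by field_simp; linarith
  rw [h2]
  field_simp
  ring

include hN hnd hΨ in
theorem quadL_sq_le (p : Polynomial ℝ) :
    quadL N nd Ψ p ^ 2 ≤ 2 / N * ∑ k, lglW N Ψ k * p.eval (nd k) ^ 2 := by
  rw [← lgl_sum_legendre_sq hN hnd hΨ]
  refine Finset.sum_sq_le_sum_mul_sum_of_sq_le_mul _ (fun k _ => ?_) (fun k _ => ?_) fun k _ => ?_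
  · have := lglW_pos hN hnd hΨ k; positivity
  · have := lglW_pos hN hnd hΨ k; positivity
  · exact le_of_eq (by ring)

include hN hnd hΨ in
theorem pint_sq_le_quad {p : Polynomial ℝ} (hp : p.natDegree ≤ N) :
    pint (p * p) ≤ ∑ k, lglW N Ψ k * p.eval (nd k) ^ 2 := by
  rw [pint_mul_eq hN hnd hΨ hp hp]
  simp only [← sq]
  have : 0 ≤ (N : ℝ) * (N + 1) / (2 * (2 * N + 1)) * quadL N nd Ψ p ^ 2 := by positivity
  linarith

include hN hnd hΨ in
theorem quad_le_pint_sq {p : Polynomial ℝ} (hp : p.natDegree ≤ N) :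
    ∑ k, lglW N Ψ k * p.eval (nd k) ^ 2 ≤ 3 * pint (p * p) := by
  rw [pint_mul_eq hN hnd hΨ hp hp]
  simp only [← sq]
  have h1 := quadL_sq_le hN hnd hΨ p
  have h0 : 0 ≤ ∑ k, lglW N Ψ k * p.eval (nd k) ^ 2 :=
    Finset.sum_nonneg fun k _ => by have := lglW_pos hN hnd hΨ k; positivity
  have hN1 : (2 : ℝ) ≤ N := by exact_mod_cast hN
  have h2 : (N : ℝ) * (N + 1) / (2 * (2 * N + 1)) * quadL N nd Ψ p ^ 2 ≤
      2 / 3 * ∑ k, lglW N Ψ k * p.eval (nd k) ^ 2 := by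
    refine (mul_le_mul_of_nonneg_left h1 (by positivity)).trans ?_
    rw [← mul_assoc]
    refine mul_le_mul_of_nonneg_right ?_ h0
    rw [div_mul_div_comm, div_le_div_iff₀ (by positivity) (by positivity)]
    nlinarith
  linarith

include hN hnd hΨ in
theorem pint_corrector_mul {p : Polynomial ℝ} (hp : p.natDegree ≤ N) :
    pint (corrector N * p) = (N : ℝ) * (N + 1) / (2 * (2 * N + 1)) * quadL N nd Ψ p := by
  obtain ⟨a, r, rfl, hr, -⟩ := exists_sub_legendre_natDegree_lt (by omega : 1 ≤ N) hp
  have hb := pint_bubble_legendre (by omega : 1 ≤ N)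
  have hr0 := pint_bubble_mul (N := N + 1) (q := r) (by omega)
  rw [corrector]
  rw [mul_assoc, pint_C_mul, mul_add ((1 - X ^ 2) * derivative (legendre (N + 1))), map_add, hr0, show ∀ G : Polynomial ℝ, G * (C a * legendre N) =
    C a * (G * legendre N) by intro G; ring, pint_C_mul, quadL_add, quadL_C_mul,
    quadL_legendre hN hnd hΨ, quadL_of_natDegree_lt hN hnd hΨ hr]
  have hN0 : (N : ℝ) ≠ 0 := by positivity
  have h2 : pint ((1 - X ^ 2) * derivative (legendre (N + 1)) * legendre N) =
      2 * (N + 1) * (N + 2) / ((2 * N + 1) * (2 * N + 3)) := by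
    rw [← hb]; field_simp
  rw [h2]
  field_simp
  ring

/-- The dual functions to the Lagrange basis for interior nodes; zero at the end points. -/
def dualR (N : ℕ) (nd : Fin (N + 1) → ℝ) (Ψ : Fin (N + 1) → Polynomial ℝ) (k : Fin (N + 1)) :
    Polynomial ℝ :=
  if k = 0 ∨ k = Fin.last N then 0 else
    Ψ k + C (lglW N Ψ k * (legendre N).eval (nd k)) * corrector N

include hN hnd hΨ in
theorem pint_basis_mul_dualR (l k : Fin (N + 1)) :
    pint (Ψ l * dualR N nd Ψ k) =
      if k = 0 ∨ k = Fin.last N then 0 else if l = k then lglW N Ψ k else 0 := by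
  unfold dualR
  split_ifs with hk hlk
  · simp
  all_goals
    rw [mul_add, map_add, mul_left_comm, pint_C_mul, mul_comm _ (corrector N),
      pint_corrector_mul hN hnd hΨ (hΨ l).1, pint_mul_eq hN hnd hΨ (hΨ l).1 (hΨ k).1,
      quadL_basis hΨ, quadL_basis hΨ, Finset.sum_eq_single k]
  · simp [(hΨ _).2, hlk]; ring
  · intro m _ hm
    simp [(hΨ _).2, hm]
  · simp
  · simp [(hΨ _).2, Ne.symm hlk]; ring
  · intro m _ hm
    simp [(hΨ _).2, hm]
  · simp

include hnd hΨ in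
theorem dualR_eval_end (k : Fin (N + 1)) :
    (dualR N nd Ψ k).eval 1 = 0 ∧ (dualR N nd Ψ k).eval (-1) = 0 := by
  unfold dualR
  split_ifs with hk
  · simp
  · push Not at hk
    simp [hΨ.eval_one hnd, hΨ.eval_neg_one hnd, hk.1, hk.2, corrector]

/-- The interior part of the interpolant. -/
def innP (Ψ : Fin (N + 1) → Polynomial ℝ) (z : Fin (N + 1) → ℝ) : Polynomial ℝ :=
  ∑ k, C (if k = 0 ∨ k = Fin.last N then 0 else z k) * Ψ k

include hΨ in
theorem innP_eval (z : Fin (N + 1) → ℝ) (m : Fin (N + 1)) :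
    (innP Ψ z).eval (nd m) = if m = 0 ∨ m = Fin.last N then 0 else z m := by
  rw [innP, eval_finsetSum, Finset.sum_eq_single m]
  · simp [(hΨ _).2]
  · intro k _ hk
    simp [(hΨ _).2, Ne.symm hk]
  · simp

include hΨ in
theorem innP_natDegree (z : Fin (N + 1) → ℝ) : (innP Ψ z).natDegree ≤ N :=
  natDegree_sum_le_of_forall_le _ _ fun k _ => (natDegree_C_mul_le _ _).trans (hΨ k).1

include hΨ in
theorem sum_C_mul_dualR (z : Fin (N + 1) → ℝ) :
    ∑ k, C (z k) * dualR N nd Ψ k =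
      innP Ψ z + C (quadL N nd Ψ (innP Ψ z)) * corrector N := by
  have h1 : quadL N nd Ψ (innP Ψ z) = ∑ k, (if k = 0 ∨ k = Fin.last N then 0 else z k) *
      (lglW N Ψ k * (legendre N).eval (nd k)) := by
    rw [quadL]
    refine Finset.sum_congr rfl fun k _ => ?_
    rw [innP_eval hΨ]
    ring
  rw [h1, map_sum, Finset.sum_mul, innP, ← Finset.sum_add_distrib]
  refine Finset.sum_congr rfl fun k _ => ?_
  unfold dualR
  split_ifs
  · simp
  · simp only [C_mul]; ring

theorem pint_add_sq_le (p q : Polynomial ℝ) :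
    pint ((p + q) * (p + q)) ≤ 2 * pint (p * p) + 2 * pint (q * q) := by
  have h := pint_sq_nonneg (p - q)
  rw [show (p - q) * (p - q) = C 2 * (p * p) + C 2 * (q * q) - (p + q) * (p + q) by
    rw [C_ofNat]; ring, map_sub, map_add, pint_C_mul, pint_C_mul] at h
  linarith

theorem pint_C_mul_sq (c : ℝ) (p : Polynomial ℝ) :
    pint (C c * p * (C c * p)) = c ^ 2 * pint (p * p) := by
  rw [show C c * p * (C c * p) = C (c ^ 2) * (p * p) by rw [C_pow]; ring, pint_C_mul]

include hN hnd hΨ in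
theorem pint_dualR_sq_le (z : Fin (N + 1) → ℝ) :
    pint ((∑ k, C (z k) * dualR N nd Ψ k) * (∑ k, C (z k) * dualR N nd Ψ k)) ≤
      8 * ∑ k, lglW N Ψ k * z k ^ 2 := by
  rw [sum_C_mul_dualR hΨ]
  set p := innP Ψ z with hp
  have h1 := pint_add_sq_le p (C (quadL N nd Ψ p) * corrector N)
  rw [pint_C_mul_sq] at h1
  have h2 := pint_sq_le_quad hN hnd hΨ (innP_natDegree hΨ z)
  have h3 := quadL_sq_le hN hnd hΨ p
  have h4 := pint_corrector_sq_le N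
  rw [← hp] at h2
  set q := ∑ k, lglW N Ψ k * p.eval (nd k) ^ 2 with hq
  have h0 : 0 ≤ q :=
    Finset.sum_nonneg fun k _ => by have := lglW_pos hN hnd hΨ k; positivity
  have h5 : q ≤ ∑ k, lglW N Ψ k * z k ^ 2 := by
    refine Finset.sum_le_sum fun k _ => mul_le_mul_of_nonneg_left ?_ (lglW_pos hN hnd hΨ k).le
    rw [hp, innP_eval hΨ]
    split_ifs
    · simpa using sq_nonneg (z k)
    · exact le_rfl
  have hN1 : (2 : ℝ) ≤ N := by exact_mod_cast hN
  have h6 : quadL N nd Ψ p ^ 2 * pint (corrector N * corrector N) ≤ 2 / N * q * (N + 1) :=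
    mul_le_mul h3 h4 (pint_sq_nonneg _) (by positivity)
  have h7 : 2 / N * q * (N + 1) ≤ 3 * q := by
    rw [div_mul_eq_mul_div, div_mul_eq_mul_div, div_le_iff₀ (by positivity)]
    nlinarith
  linarith

theorem pint_mul_legendre_sq_le {p : Polynomial ℝ} (hN : 1 ≤ N) (h1 : p.eval 1 = 0)
    (h2 : p.eval (-1) = 0) :
    pint (p * legendre N) ^ 2 * ((N : ℝ) * (N + 1) * (2 * N + 1)) ≤
      2 * pint (derivative p * derivative p) := by
  have h := pint_derivative_mul ((1 - X ^ 2) * derivative (legendre N)) p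
  rw [legendre_ode, show -C ((N : ℝ) * (N + 1)) * legendre N * p =
    C (-((N : ℝ) * (N + 1))) * (p * legendre N) by rw [C_neg]; ring, pint_C_mul, h1, h2] at h
  simp only [mul_zero, sub_zero, zero_sub] at h
  have h3 := pint_mul_sq_le ((1 - X ^ 2) * derivative (legendre N)) (derivative p)
  have h4 := pint_sq_bubble_le (derivative (legendre N))
  rw [pint_bubble_sq] at h4
  have h5 := pint_legendre_sq hN
  have h6 := pint_sq_nonneg (derivative p)
  have h7 := mul_le_mul_of_nonneg_right h4 h6
  have h8 : pint ((1 - X ^ 2) * derivative (legendre N) * derivative p) =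
    (N : ℝ) * (N + 1) * pint (p * legendre N) := by linarith
  rw [h8] at h3
  have hN1 : (1 : ℝ) ≤ N := by exact_mod_cast hN
  have h9 := h3.trans h7
  have hc : (0 : ℝ) < (N : ℝ) * (N + 1) := by positivity
  refine le_of_mul_le_mul_left ?_ hc
  have h10 := mul_le_mul_of_nonneg_right h9 (by positivity : (0 : ℝ) ≤ 2 * N + 1)
  calc _ = ((N : ℝ) * (N + 1) * pint (p * legendre N)) ^ 2 * (2 * N + 1) := by ring
    _ ≤ _ := h10
    _ = _ := by linear_combination (N : ℝ) * (N + 1) * pint (derivative p * derivative p) * h5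

include hN hnd hΨ in
theorem pint_derivative_dualR_sq_le (z : Fin (N + 1) → ℝ) :
    pint ((∑ k, C (z k) * derivative (dualR N nd Ψ k)) *
      (∑ k, C (z k) * derivative (dualR N nd Ψ k))) ≤
      30 * ∑ m, lglW N Ψ m * (∑ k, (if k = 0 ∨ k = Fin.last N then 0 else
        (derivative (Ψ k)).eval (nd m)) * z k) ^ 2 := by
  have e1 : ∑ k, C (z k) * derivative (dualR N nd Ψ k) =
      derivative (∑ k, C (z k) * dualR N nd Ψ k) := by
    rw [derivative_sum]
    exact Finset.sum_congr rfl fun k _ => by rw [derivative_C_mul]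
  rw [e1, sum_C_mul_dualR hΨ, derivative_add, derivative_C_mul]
  set p := innP Ψ z with hp
  have e2 : ∀ m, ∑ k, (if k = 0 ∨ k = Fin.last N then 0 else
        (derivative (Ψ k)).eval (nd m)) * z k = (derivative p).eval (nd m) := by
    intro m
    rw [hp, innP, derivative_sum, eval_finsetSum]
    refine Finset.sum_congr rfl fun k _ => ?_
    rw [derivative_C_mul, eval_mul, eval_C]
    split_ifs <;> ring
  simp only [e2]
  have hdeg := innP_natDegree hΨ z
  have hq := lgl_quadrature hN hnd hΨ (p := derivative p * derivative p) (by
    have := natDegree_mul_le (p := derivative p) (q := derivative p)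
    have := natDegree_derivative_le p
    rw [← hp] at hdeg
    omega)
  simp only [← sq, eval_pow] at hq
  rw [← hq]
  have h1 := pint_add_sq_le (derivative p) (C (quadL N nd Ψ p) * derivative (corrector N))
  rw [pint_C_mul_sq, pint_derivative_corrector_sq] at h1
  have p1 : p.eval 1 = 0 := by
    have := innP_eval hΨ z (Fin.last N)
    rwa [hnd.2.2.1, if_pos (Or.inr rfl)] at this
  have p2 : p.eval (-1) = 0 := by
    have := innP_eval hΨ z 0
    rwa [hnd.2.1, if_pos (Or.inl rfl)] at this
  have h2 := pint_mul_legendre_sq_le (by omega : 1 ≤ N) p1 p2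
  have h3 := pint_mul_eq hN hnd hΨ hdeg (legendre_natDegree_le N)
  rw [← hp, quadL_legendre hN hnd hΨ] at h3
  have e3 : ∑ k, lglW N Ψ k * (p.eval (nd k) * (legendre N).eval (nd k)) = quadL N nd Ψ p :=
    Finset.sum_congr rfl fun k _ => by ring
  rw [e3] at h3
  have hN1 : (2 : ℝ) ≤ N := by exact_mod_cast hN
  have h4 : pint (p * legendre N) = quadL N nd Ψ p * (N / (2 * N + 1)) := by
    rw [h3]; field_simp; ring
  rw [← sq (derivative p)] at h1
  have hP : 0 ≤ pint (derivative p ^ 2) := by rw [sq]; exact pint_sq_nonneg _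
  rw [h4, ← sq] at h2
  set P := pint (derivative p ^ 2)
  set q := quadL N nd Ψ p
  have h5 : q ^ 2 * ((N : ℝ) ^ 3 * (N + 1)) ≤ 2 * (2 * N + 1) * P := by
    have : (q * ((N : ℝ) / (2 * N + 1))) ^ 2 * (N * (N + 1) * (2 * N + 1)) * (2 * N + 1) =
      q ^ 2 * ((N : ℝ) ^ 3 * (N + 1)) := by field_simp
    rw [← this]
    have := mul_le_mul_of_nonneg_right h2 (by positivity : (0 : ℝ) ≤ 2 * N + 1)
    linarith
  have h6 : 2 * (q ^ 2 * ((2 * N + 3) * (N + 1) ^ 2 / 2)) ≤ 28 * P := by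
    have hc : (0 : ℝ) < (N : ℝ) ^ 3 := by positivity
    refine le_of_mul_le_mul_left ?_ hc
    calc _ = q ^ 2 * ((N : ℝ) ^ 3 * (N + 1)) * ((2 * N + 3) * (N + 1)) := by ring
      _ ≤ 2 * (2 * N + 1) * P * ((2 * N + 3) * (N + 1)) := by gcongr
      _ = (2 * (2 * N + 1) * ((2 * N + 3) * (N + 1))) * P := by ring
      _ ≤ ((N : ℝ) ^ 3 * 28) * P := by
        refine mul_le_mul_of_nonneg_right ?_ hP
        obtain ⟨y, hy, hNy⟩ : ∃ y : ℝ, 0 ≤ y ∧ (N : ℝ) = y + 2 := ⟨N - 2, by linarith, by ring⟩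
        rw [hNy]
        nlinarith [pow_nonneg hy 2, pow_nonneg hy 3]
      _ = _ := by ring
  rw [← sq]
  rw [← sq] at h1
  linarith

end Projection

section Norms

variable {d N : ℕ} (hN : 2 ≤ N) {nd : Fin (N + 1) → ℝ} (hnd : IsLGL N nd)
  {Ψ : Fin (N + 1) → Polynomial ℝ} (hΨ : IsLagrange N nd Ψ)

/-- The Gram matrix of a family of polynomials in `L²(-1,1)`. -/
def gram {n : Type} (P : n → Polynomial ℝ) : Matrix n n ℝ := Matrix.of fun a b => pint (P a * P b)

theorem sum_gram {n : Type} [Fintype n] (P : n → Polynomial ℝ) (z : n → ℝ) :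
    ∑ a, ∑ b, gram P a b * (z a * z b) =
      pint ((∑ a, C (z a) * P a) * (∑ a, C (z a) * P a)) := by
  rw [Finset.sum_mul_sum, map_sum]
  refine Finset.sum_congr rfl fun a _ => ?_
  rw [map_sum]
  refine Finset.sum_congr rfl fun b _ => ?_
  rw [show C (z a) * P a * (C (z b) * P b) = C (z a * z b) * (P a * P b) by rw [C_mul]; ring,
    pint_C_mul, gram, Matrix.of_apply]
  ring

theorem gram_comm {n : Type} (P : n → Polynomial ℝ) (a b : n) : gram P a b = gram P b a := by
  rw [gram, Matrix.of_apply, Matrix.of_apply, mul_comm]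

theorem gram_posSemidef {n : Type} [Fintype n] (P : n → Polynomial ℝ) :
    (gram P).PosSemidef :=
  posSemidef_of_sum_nonneg (gram_comm P) fun z => by rw [sum_gram]; exact pint_sq_nonneg _

theorem sum_diagonal_mul {n : Type} [Fintype n] [DecidableEq n] (w z : n → ℝ) :
    ∑ a, ∑ b, Matrix.diagonal w a b * (z a * z b) = ∑ a, w a * z a ^ 2 := by
  refine Finset.sum_congr rfl fun a _ => ?_
  rw [Finset.sum_eq_single a]
  · rw [Matrix.diagonal_apply_eq]; ring
  · intro b _ hb
    rw [Matrix.diagonal_apply_ne _ hb.symm, zero_mul]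
  · simp

theorem diagonal_symm {n : Type} [DecidableEq n] (w : n → ℝ) (a b : n) :
    Matrix.diagonal w a b = Matrix.diagonal w b a := by
  by_cases h : a = b
  · rw [h]
  · rw [Matrix.diagonal_apply_ne _ h, Matrix.diagonal_apply_ne _ (Ne.symm h)]

theorem diagonal_posSemidef {n : Type} [Fintype n] [DecidableEq n] {w : n → ℝ}
    (hw : ∀ i, 0 ≤ w i) : (Matrix.diagonal w).PosSemidef :=
  posSemidef_of_sum_nonneg (diagonal_symm w) fun z => by
    rw [sum_diagonal_mul]
    exact Finset.sum_nonneg fun a _ => mul_nonneg (hw a) (sq_nonneg _)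

include hΨ in
theorem sum_C_mul_basis_eval (z : Fin (N + 1) → ℝ) (m : Fin (N + 1)) :
    (∑ a, C (z a) * Ψ a).eval (nd m) = z m := by
  simp [eval_finsetSum, (hΨ _).2]

include hΨ in
theorem sum_C_mul_basis_natDegree (z : Fin (N + 1) → ℝ) :
    (∑ a, C (z a) * Ψ a).natDegree ≤ N :=
  natDegree_sum_le_of_forall_le _ _ fun k _ => (natDegree_C_mul_le _ _).trans (hΨ k).1

include hN hnd hΨ in
theorem diagonal_sub_gram_posSemidef : (Matrix.diagonal (lglW N Ψ) - gram Ψ).PosSemidef := by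
  refine posSemidef_of_sum_nonneg (fun a b => ?_) fun z => ?_
  · rw [Matrix.sub_apply, Matrix.sub_apply, gram_comm, diagonal_symm]
  · simp only [Matrix.sub_apply, sub_mul, Finset.sum_sub_distrib]
    rw [sum_gram, sum_diagonal_mul, sub_nonneg]
    have := pint_sq_le_quad hN hnd hΨ (sum_C_mul_basis_natDegree hΨ z)
    simpa only [sum_C_mul_basis_eval hΨ] using this

include hN hnd hΨ in
theorem gram_sub_diagonal_posSemidef :
    ((3 : ℝ) • gram Ψ - Matrix.diagonal (lglW N Ψ)).PosSemidef := by
  refine posSemidef_of_sum_nonneg (fun a b => ?_) fun z => ?_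
  · rw [Matrix.sub_apply, Matrix.sub_apply, Matrix.smul_apply, Matrix.smul_apply, gram_comm,
      diagonal_symm]
  · simp only [Matrix.sub_apply, sub_mul, Finset.sum_sub_distrib, Matrix.smul_apply, smul_eq_mul,
      mul_assoc, ← Finset.mul_sum]
    rw [sum_gram, sum_diagonal_mul, sub_nonneg]
    have := quad_le_pint_sq hN hnd hΨ (sum_C_mul_basis_natDegree hΨ z)
    simpa only [sum_C_mul_basis_eval hΨ] using this

theorem integral_interp_mul (F G : (Fin d → Fin (N + 1)) → ℝ) :
    ∫ x in cubeO d, interp Ψ F x * interp Ψ G x = qf (fun _ => gram Ψ) F G := by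
  rw [restrict_cubeO]
  unfold interp
  rw [integral_tens_mul]
  · congr 1
    funext j
    ext a b
    rw [gram, Matrix.of_apply, ← setIntegral_Ioo_eval]
    simp only [eval_mul]
  · intro j k l
    exact integrableOn_Ioo_of_continuous ((Ψ k).continuous.mul (Ψ l).continuous)

include hN hnd hΨ in
theorem gip_le_integral_sq (F : (Fin d → Fin (N + 1)) → ℝ) :
    gip d (lglW N Ψ) F F ≤ 3 ^ d * ∫ x in cubeO d, interp Ψ F x ^ 2 := by
  simp only [sq]
  rw [integral_interp_mul, ← qf_diagonal]
  refine (qf_mono (fun _ => diagonal_posSemidef fun i => (lglW_pos hN hnd hΨ i).le)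
    (B := fun _ => (3 : ℝ) • gram Ψ) (fun _ => gram_sub_diagonal_posSemidef hN hnd hΨ) F).trans_eq ?_
  rw [qf_smul (fun _ => (3 : ℝ)) (fun _ => gram Ψ)]
  simp

include hN hnd hΨ in
theorem faceInt_interp_sq_le (k : Fin d) (e : Fin (N + 1)) (F : (Fin d → Fin (N + 1)) → ℝ) :
    Integrable (fun x => interp Ψ F (Function.update x k (nd e)) ^ 2)
      ((volume : Measure (Vec d)).restrict (cubeC d)) ∧
    faceInt d k (nd e) (fun x => interp Ψ F x ^ 2) ≤
      (lglData hN hnd hΨ).fip k e F F := by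
  set E : Matrix (Fin (N + 1)) (Fin (N + 1)) ℝ := Matrix.diagonal fun m => if m = e then 1 else 0
    with hE
  set f : Fin d → Fin (N + 1) → ℝ → ℝ :=
    Function.update (fun _ k x => (Ψ k).eval x) k fun a _ => (Ψ a).eval (nd e) with hf
  have hupd : ∀ x, interp Ψ F (Function.update x k (nd e)) = tens f F x := fun x => by
    rw [interp, tens_update_right]
  have hcont : ∀ j a, Continuous (f j a) := by
    intro j a
    by_cases h : j = k
    · rw [h, hf, Function.update_self]; exact continuous_const
    · rw [hf, Function.update_of_ne h]; exact (Ψ a).continuous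
  have hparts : ∀ j a b, Integrable (fun x => f j a x * f j b x)
      ((volume : Measure ℝ).restrict (Set.Ioo (-1) 1)) := fun j a b =>
    integrableOn_Ioo_of_continuous ((hcont j a).mul (hcont j b))
  have hEp : E.PosSemidef := diagonal_posSemidef fun m => by split_ifs <;> norm_num
  have hG : (fun j a b => ∫ x in Set.Ioo (-1 : ℝ) 1, f j a x * f j b x) =
      Function.update (fun _ => gram Ψ) k (E + E) := by
    funext j
    by_cases h : j = k
    · subst h
      rw [Function.update_self]
      ext a b
      simp only [hf, Function.update_self]
      rw [setIntegral_const, hE, Matrix.add_apply, Matrix.diagonal_apply, (hΨ _).2, (hΨ _).2]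
      simp only [measureReal_def, Real.volume_Ioo, smul_eq_mul]
      rw [ENNReal.toReal_ofReal (by norm_num)]
      split_ifs <;> simp_all
    · rw [Function.update_of_ne h]
      ext a b
      simp only [hf, Function.update_of_ne h]
      rw [gram, Matrix.of_apply, ← setIntegral_Ioo_eval]
      simp only [eval_mul]
  constructor
  · simp only [hupd, sq]
    rw [restrict_cubeC]
    exact integrable_tens_mul hparts F F
  · rw [faceInt]
    simp only [hupd, sq]
    rw [restrict_cubeC, integral_tens_mul hparts, hG, qf_update_add, ← two_mul, ← mul_assoc]
    norm_num
    have hW : Matrix.diagonal (lglW N Ψ) * (lglData hN hnd hΨ).F e = E := by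
      rw [LGLData.F, Matrix.diagonal_mul_diagonal, hE]
      congr 1
      funext m
      change lglW N Ψ m * (if m = e then 1 / lglW N Ψ e else 0) = _
      split_ifs with h
      · rw [h, mul_one_div_cancel (lglW_pos hN hnd hΨ e).ne']
      · rw [mul_zero]
    rw [LGLData.fip_right]
    change _ ≤ gip d (lglW N Ψ) F _
    rw [← qf_update_diagonal, hW]
    refine qf_mono (fun j => ?_) (fun j => ?_) F
    · by_cases h : j = k
      · rw [h, Function.update_self]; exact hEp
      · rw [Function.update_of_ne h]; exact gram_posSemidef Ψ
    · by_cases h : j = k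
      · rw [h, Function.update_self, Function.update_self, sub_self]
        exact Matrix.PosSemidef.zero
      · rw [Function.update_of_ne h, Function.update_of_ne h]
        exact diagonal_sub_gram_posSemidef hN hnd hΨ

end Norms

section Cutoff

theorem exists_abs_deriv_smoothTransition_le :
    ∃ B : ℝ, 0 ≤ B ∧ ∀ t, |deriv Real.smoothTransition t| ≤ B ∧
      (deriv Real.smoothTransition t ≠ 0 → t ≤ 1 ∧ 0 ≤ t) := by
  have hc : Continuous (deriv Real.smoothTransition) :=
    (Real.smoothTransition.contDiff (n := 1)).continuous_deriv le_rfl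
  obtain ⟨B, hB⟩ := (isCompact_Icc (a := (0 : ℝ)) (b := 1)).exists_bound_of_continuousOn
    hc.continuousOn
  have hz : ∀ t, deriv Real.smoothTransition t ≠ 0 → t ≤ 1 ∧ 0 ≤ t := by
    intro t ht
    by_contra h
    apply ht
    rcases not_and_or.mp h with h | h
    · have : Real.smoothTransition =ᶠ[nhds t] fun _ => 1 := by
        filter_upwards [lt_mem_nhds (not_le.mp h)] with s hs
        exact Real.smoothTransition.one_of_one_le hs.le
      rw [this.deriv_eq, deriv_const]
    · have : Real.smoothTransition =ᶠ[nhds t] fun _ => 0 := by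
        filter_upwards [gt_mem_nhds (not_le.mp h)] with s hs
        exact Real.smoothTransition.zero_of_nonpos hs.le
      rw [this.deriv_eq, deriv_const]
  refine ⟨B, (norm_nonneg _).trans (hB 0 ⟨le_rfl, zero_le_one⟩), fun t => ⟨?_, hz t⟩⟩
  by_cases h : deriv Real.smoothTransition t = 0
  · rw [h, abs_zero]
    exact (norm_nonneg _).trans (hB 0 ⟨le_rfl, zero_le_one⟩)
  · exact hB t ⟨(hz t h).2, (hz t h).1⟩

/-- Smooth cutoffs of a polynomial near the end points of `(-1,1)`. -/
def cutoff (R : Polynomial ℝ) (n : ℕ) (x : ℝ) : ℝ :=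
  Real.smoothTransition (((n : ℝ) + 1) * (1 - x ^ 2) - 1) * R.eval x

theorem cutoff_contDiff (R : Polynomial ℝ) (n : ℕ) : ContDiff ℝ (⊤ : ℕ∞) (cutoff R n) := by
  have hR : ContDiff ℝ (⊤ : ℕ∞) fun x => R.eval x := by
    simpa using R.contDiff_aeval (𝕜 := ℝ) (⊤ : ℕ∞)
  refine ContDiff.mul (Real.smoothTransition.contDiff.comp ?_) hR
  fun_prop

theorem cutoff_eq_zero (R : Polynomial ℝ) {n : ℕ} {x : ℝ} (h : ((n : ℝ) + 1) * (1 - x ^ 2) ≤ 1) :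
    cutoff R n x = 0 := by
  rw [cutoff, Real.smoothTransition.zero_of_nonpos (by linarith), zero_mul]

theorem cutoff_eventually (R : Polynomial ℝ) {x : ℝ} (hx : x ∈ Set.Ioo (-1 : ℝ) 1) :
    ∀ᶠ n in Filter.atTop, cutoff R n x = R.eval x ∧
      deriv (cutoff R n) x = (derivative R).eval x := by
  have h0 : 0 < 1 - x ^ 2 := by nlinarith [hx.1, hx.2]
  obtain ⟨n0, hn0⟩ := exists_nat_gt (2 / (1 - x ^ 2))
  filter_upwards [Filter.eventually_ge_atTop n0] with n hn
  have h1 : (2 : ℝ) < (n + 1) * (1 - x ^ 2) := by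
    rw [div_lt_iff₀ h0] at hn0
    have : (n0 : ℝ) ≤ n := by exact_mod_cast hn
    nlinarith
  have h2 : cutoff R n =ᶠ[nhds x] fun y => R.eval y := by
    have hc : Continuous fun y : ℝ => ((n : ℝ) + 1) * (1 - y ^ 2) := by fun_prop
    filter_upwards [hc.continuousAt.eventually (lt_mem_nhds h1)] with y hy
    rw [cutoff, Real.smoothTransition.one_of_one_le (by linarith), one_mul]
  exact ⟨h2.eq_of_nhds, by rw [h2.deriv_eq, Polynomial.deriv]⟩

theorem cutoff_bound {R : Polynomial ℝ} (h1 : R.eval 1 = 0) (h2 : R.eval (-1) = 0) :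
    ∃ B : ℝ, ∀ n, ∀ x ∈ Set.Ioo (-1 : ℝ) 1, |cutoff R n x| ≤ B ∧ |deriv (cutoff R n) x| ≤ B := by
  obtain ⟨y, hy, -⟩ := exists_eq_bubble_mul h1 h2
  obtain ⟨B, hB0, hB⟩ := exists_abs_deriv_smoothTransition_le
  obtain ⟨C0, hC0⟩ := (isCompact_Icc (a := (-1 : ℝ)) (b := 1)).exists_bound_of_continuousOn
    R.continuous.continuousOn
  obtain ⟨C1, hC1⟩ := (isCompact_Icc (a := (-1 : ℝ)) (b := 1)).exists_bound_of_continuousOn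
    (derivative R).continuous.continuousOn
  obtain ⟨C2, hC2⟩ := (isCompact_Icc (a := (-1 : ℝ)) (b := 1)).exists_bound_of_continuousOn
    y.continuous.continuousOn
  have p0 := (norm_nonneg _).trans (hC0 0 (by norm_num))
  have p1 := (norm_nonneg _).trans (hC1 0 (by norm_num))
  have p2 := (norm_nonneg _).trans (hC2 0 (by norm_num))
  refine ⟨C0 + C1 + B * 4 * C2, fun n x hx => ?_⟩
  have hxI : x ∈ Set.Icc (-1 : ℝ) 1 := Set.Ioo_subset_Icc_self hx
  set s : ℝ := ((n : ℝ) + 1) * (1 - x ^ 2) - 1 with hs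
  have k0 := hC0 x hxI
  have k1 := hC1 x hxI
  have k2 := hC2 x hxI
  rw [Real.norm_eq_abs] at k0 k1 k2
  have hst : |Real.smoothTransition s| ≤ 1 := by
    rw [abs_of_nonneg (Real.smoothTransition.nonneg s)]; exact Real.smoothTransition.le_one s
  have hpos : 0 ≤ B * 4 * C2 := by positivity
  constructor
  · rw [cutoff, abs_mul]
    have := mul_le_mul hst k0 (abs_nonneg _) zero_le_one
    linarith
  · have hd : HasDerivAt (cutoff R n)
        (deriv Real.smoothTransition s * (((n : ℝ) + 1) * (-(2 * x))) * R.eval x +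
          Real.smoothTransition s * (derivative R).eval x) x := by
      have e1 : HasDerivAt (fun x : ℝ => ((n : ℝ) + 1) * (1 - x ^ 2) - 1)
          (((n : ℝ) + 1) * (-(2 * x))) x := by
        have := (((hasDerivAt_pow 2 x).const_sub 1).const_mul ((n : ℝ) + 1)).sub_const 1
        simpa using this
      have e2 : HasDerivAt Real.smoothTransition (deriv Real.smoothTransition s) s :=
        ((Real.smoothTransition.contDiff (n := 1)).differentiable one_ne_zero s).hasDerivAt
      exact (e2.comp x e1).mul (R.hasDerivAt x)
    rw [hd.deriv]
    refine (abs_add_le _ _).trans ?_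
    have t2 : |Real.smoothTransition s * (derivative R).eval x| ≤ C1 := by
      rw [abs_mul]
      have := mul_le_mul hst k1 (abs_nonneg _) zero_le_one
      linarith
    have t1 : |deriv Real.smoothTransition s * (((n : ℝ) + 1) * (-(2 * x))) * R.eval x| ≤
        B * 4 * C2 := by
      by_cases hz : deriv Real.smoothTransition s = 0
      · rw [hz, zero_mul, zero_mul, abs_zero]; exact hpos
      · have hs1 := ((hB s).2 hz).1
        have e : deriv Real.smoothTransition s * (((n : ℝ) + 1) * (-(2 * x))) * R.eval x =
            deriv Real.smoothTransition s * ((s + 1) * (-(2 * x))) * y.eval x := by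
          rw [hy, hs]
          simp only [eval_mul, eval_sub, eval_one, eval_pow, eval_X]
          ring
        rw [e, abs_mul, abs_mul]
        refine mul_le_mul (mul_le_mul (hB s).1 ?_ (abs_nonneg _) hB0) k2 (abs_nonneg _)
          (by positivity)
        rw [abs_mul, show (4 : ℝ) = 2 * 2 by norm_num]
        have hs0 := ((hB s).2 hz).2
        refine mul_le_mul ?_ ?_ (abs_nonneg _) (by norm_num)
        · rw [abs_of_nonneg (by linarith)]; linarith
        · rw [abs_neg, abs_mul, abs_two]
          have : |x| ≤ 1 := abs_le.mpr hxI
          linarith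
    linarith

theorem tendsto_setIntegral_mul {f g : ℕ → ℝ → ℝ} {p q : Polynomial ℝ} {B B' : ℝ}
    (hf : ∀ n, Continuous (f n)) (hg : ∀ n, Continuous (g n))
    (hfB : ∀ n, ∀ x ∈ Set.Ioo (-1 : ℝ) 1, |f n x| ≤ B)
    (hgB : ∀ n, ∀ x ∈ Set.Ioo (-1 : ℝ) 1, |g n x| ≤ B')
    (hfp : ∀ x ∈ Set.Ioo (-1 : ℝ) 1, ∀ᶠ n in Filter.atTop, f n x = p.eval x)
    (hgq : ∀ x ∈ Set.Ioo (-1 : ℝ) 1, ∀ᶠ n in Filter.atTop, g n x = q.eval x) :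
    Filter.Tendsto (fun n => ∫ x in Set.Ioo (-1 : ℝ) 1, f n x * g n x) Filter.atTop
      (nhds (pint (p * q))) := by
  rw [← setIntegral_Ioo_eval]
  refine tendsto_integral_of_dominated_convergence (fun _ => B * B') (fun n => ?_) ?_
    (fun n => ?_) ?_
  · exact ((hf n).mul (hg n)).aestronglyMeasurable
  · exact integrableOn_Ioo_of_continuous continuous_const
  · filter_upwards [ae_restrict_mem measurableSet_Ioo] with x hx
    rw [Real.norm_eq_abs, abs_mul]
    exact mul_le_mul (hfB n x hx) (hgB n x hx) (abs_nonneg _) ((abs_nonneg _).trans (hfB n x hx))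
  · filter_upwards [ae_restrict_mem measurableSet_Ioo] with x hx
    refine tendsto_const_nhds.congr' ?_
    filter_upwards [hfp x hx, hgq x hx] with n h1 h2
    rw [h1, h2, eval_mul]

theorem tendsto_qf {d : ℕ} {n : Type} [Fintype n] {A : ℕ → Fin d → Matrix n n ℝ}
    {A' : Fin d → Matrix n n ℝ}
    (h : ∀ j a b, Filter.Tendsto (fun m => A m j a b) Filter.atTop (nhds (A' j a b)))
    (F G : (Fin d → n) → ℝ) :
    Filter.Tendsto (fun m => qf (A m) F G) Filter.atTop (nhds (qf A' F G)) :=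
  tendsto_finsetSum _ fun K _ => tendsto_finsetSum _ fun L _ =>
    (tendsto_finsetProd _ fun j _ => h j (K j) (L j)).mul_const _

end Cutoff

section Duality

variable {d : ℕ}

theorem isBounded_cubeC : IsCompact (cubeC d) := isCompact_univ_pi fun _ => isCompact_Icc

theorem cubeO_subset_cubeC : cubeO d ⊆ cubeC d :=
  Set.pi_mono fun _ _ => Set.Ioo_subset_Icc_self

theorem abs_le_one_of_mem_cubeO {x : Vec d} (hx : x ∈ cubeO d) (k : Fin d) : |x k| ≤ 1 :=
  abs_le.mpr ⟨(hx k trivial).1.le, (hx k trivial).2.le⟩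

theorem hasCompactSupport_of_subset_cubeO {φ : Vec d → ℝ} (h : tsupport φ ⊆ cubeO d) :
    HasCompactSupport φ :=
  isBounded_cubeC.of_isClosed_subset (isClosed_tsupport φ) (h.trans cubeO_subset_cubeC)

theorem eq_zero_of_tsupport {φ : Vec d → ℝ} (h : tsupport φ ⊆ cubeO d) {x : Vec d}
    (hx : x ∉ cubeO d) : φ x = 0 :=
  image_eq_zero_of_notMem_tsupport fun h' => hx (h h')

theorem integrableOn_cubeO_of_continuous {f : Vec d → ℝ} (hf : Continuous f) :
    IntegrableOn f (cubeO d) :=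
  (hf.continuousOn.integrableOn_compact isBounded_cubeC).mono_set cubeO_subset_cubeC

theorem continuous_pd {f : Vec d → ℝ} (hf : ContDiff ℝ (⊤ : ℕ∞) f) (k : Fin d) :
    Continuous (pd k f) :=
  (hf.continuous_fderiv (by simp)).clm_apply continuous_const

/-- A Poincaré inequality on the cube for compactly supported smooth functions. -/
theorem integral_sq_le_integral_pd_sq {φ : Vec d → ℝ} (hφ : ContDiff ℝ (⊤ : ℕ∞) φ)
    (hs : tsupport φ ⊆ cubeO d) (k : Fin d) :
    ∫ x in cubeO d, φ x ^ 2 ≤ 4 * ∫ x in cubeO d, pd k φ x ^ 2 := by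
  have hc := hasCompactSupport_of_subset_cubeO hs
  have hp : Continuous (pd k φ) := continuous_pd hφ k
  have hpc : HasCompactSupport (pd k φ) := hc.fderiv_apply ℝ _
  have hφc := hφ.continuous
  have h0 : ∀ x, x ∉ cubeO d → φ x = 0 := fun x hx => eq_zero_of_tsupport hs hx
  have hp0 : ∀ x, x ∉ cubeO d → pd k φ x = 0 := fun x hx => by
    rw [pd, fderiv_of_notMem_tsupport _ fun h' => hx (hs h')]; rfl
  have hdiff : Differentiable ℝ φ := hφ.differentiable (by simp)
  have hf1 : ∀ x : Vec d, fderiv ℝ (fun x : Vec d => x k) x (Pi.single k 1) = 1 := fun x => by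
    have : HasFDerivAt (fun x : Vec d => x k)
      (ContinuousLinearMap.proj (R := ℝ) (φ := fun _ : Fin d => ℝ) k) x :=
      (ContinuousLinearMap.proj (R := ℝ) (φ := fun _ : Fin d => ℝ) k).hasFDerivAt
    rw [this.fderiv]; simp
  have hg1 : ∀ x : Vec d, fderiv ℝ (fun x => φ x * φ x) x (Pi.single k 1) =
      2 * (φ x * pd k φ x) := fun x => by
    have h1 : fderiv ℝ (fun x => φ x * φ x) x = φ x • fderiv ℝ φ x + φ x • fderiv ℝ φ x :=
      ((hdiff x).hasFDerivAt.mul (hdiff x).hasFDerivAt).fderiv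
    rw [h1]
    simp only [add_apply, smul_apply, smul_eq_mul, pd]
    ring
  have hcc : HasCompactSupport fun x => φ x * φ x := hc.mul_left
  have i1 : Integrable fun x => φ x * φ x := (hφc.mul hφc).integrable_of_hasCompactSupport hcc
  have i2 : Integrable fun x : Vec d => x k * (2 * (φ x * pd k φ x)) := by
    refine Continuous.integrable_of_hasCompactSupport (by fun_prop) ?_
    exact (hpc.mul_left (f := φ)).mul_left (f := fun _ => (2 : ℝ)) |>.mul_left (f := fun x : Vec d => x k)
  have ibp := integral_mul_fderiv_eq_neg_fderiv_mul_of_integrable (μ := volume)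
    (f := fun x : Vec d => x k) (g := fun x => φ x * φ x) (v := Pi.single k 1)
    (by simpa only [hf1, one_mul] using i1) (by simpa only [hg1] using i2)
    ((by fun_prop : Continuous fun x : Vec d => x k * (φ x * φ x)).integrable_of_hasCompactSupport
      hcc.mul_left)
    (fun x _ => by fun_prop) (fun x _ => (hdiff x).mul (hdiff x))
  simp only [hf1, hg1, one_mul] at ibp
  rw [← setIntegral_eq_integral_of_forall_compl_eq_zero (s := cubeO d)
    (fun x hx => by rw [h0 x hx]; ring), ← setIntegral_eq_integral_of_forall_compl_eq_zero
    (s := cubeO d) (f := fun x => φ x * φ x) (fun x hx => by rw [h0 x hx]; ring)] at ibp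
  have hm : MeasurableSet (cubeO d) := MeasurableSet.univ_pi fun _ => measurableSet_Ioo
  have j1 : IntegrableOn (fun x => φ x * φ x) (cubeO d) := i1.integrableOn
  have j2 : IntegrableOn (fun x => pd k φ x ^ 2) (cubeO d) :=
    integrableOn_cubeO_of_continuous (hp.pow 2)
  have hle : ∫ x in cubeO d, -(x k * (2 * (φ x * pd k φ x))) ≤
      ∫ x in cubeO d, (1 / 2 * (φ x * φ x) + 2 * pd k φ x ^ 2) := by
    refine setIntegral_mono_on i2.integrableOn.neg ((j1.const_mul _).add (j2.const_mul _)) hm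
      fun x hx => ?_
    have hx1 : x k ^ 2 ≤ 1 := (sq_le_one_iff_abs_le_one _).mpr (abs_le_one_of_mem_cubeO hx k)
    nlinarith [sq_nonneg (φ x + 2 * (x k * pd k φ x)), mul_nonneg (sub_nonneg.mpr hx1) (sq_nonneg (pd k φ x))]
  rw [integral_neg, integral_add (j1.const_mul _) (j2.const_mul _), integral_const_mul,
    integral_const_mul] at hle
  have e : ∫ x in cubeO d, φ x ^ 2 = ∫ x in cubeO d, φ x * φ x := by simp only [sq]
  rw [e]
  linarith

/-- The values of the functional `u` on smooth compactly supported fields whose gradient has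
norm at most one. -/
def dualValues (u : Vec d → Fin d → ℝ) : Set ℝ :=
  {r : ℝ | ∃ v : Vec d → Fin d → ℝ,
            (∀ i, ContDiff ℝ (⊤ : ℕ∞) fun x => v x i) ∧
            (∀ i, tsupport (fun x => v x i) ⊆ cubeO d) ∧
            (∫ x in cubeO d, ∑ i, ∑ j, (pd j (fun y => v y i) x) ^ 2) ≤ 1 ∧
            r = ∫ x in cubeO d, ∑ i, u x i * v x i}

theorem dualValues_bddAbove {u : Vec d → Fin d → ℝ} (hu : ∀ i, Continuous fun x => u x i) :
    BddAbove (dualValues u) := by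
  refine ⟨(∫ x in cubeO d, ∑ i, 1 / 2 * u x i ^ 2) + 2, ?_⟩
  rintro r ⟨v, hv, hs, h1, rfl⟩
  have hvc : ∀ i, Continuous fun x => v x i := fun i => (hv i).continuous
  have hpc : ∀ i j, Continuous (pd j fun y => v y i) := fun i j => continuous_pd (hv i) j
  have k1 : ∫ x in cubeO d, ∑ i, u x i * v x i ≤
      ∫ x in cubeO d, ((∑ i, 1 / 2 * u x i ^ 2) + ∑ i, 1 / 2 * v x i ^ 2) := by
    refine integral_mono (integrableOn_cubeO_of_continuous (by fun_prop))
      (integrableOn_cubeO_of_continuous (by fun_prop)) fun x => ?_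
    rw [← Finset.sum_add_distrib]
    exact Finset.sum_le_sum fun i _ => by nlinarith [sq_nonneg (u x i - v x i)]
  rw [integral_add (integrableOn_cubeO_of_continuous (by fun_prop))
      (integrableOn_cubeO_of_continuous (by fun_prop))] at k1
  have k2 : ∫ x in cubeO d, ∑ i, 1 / 2 * v x i ^ 2 ≤
      2 * ∫ x in cubeO d, ∑ i, ∑ j, (pd j (fun y => v y i) x) ^ 2 := by
    rw [integral_finsetSum _ fun i _ => integrableOn_cubeO_of_continuous (by fun_prop),
      integral_finsetSum (f := fun i x => ∑ j, (pd j (fun y => v y i) x) ^ 2) _ fun i _ =>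
        integrableOn_cubeO_of_continuous (continuous_finsetSum _ fun j _ => (hpc i j).pow 2),
      Finset.mul_sum]
    refine Finset.sum_le_sum fun i _ => ?_
    rw [integral_const_mul]
    have p := integral_sq_le_integral_pd_sq (hv i) (hs i) i
    have q : ∫ x in cubeO d, pd i (fun y => v y i) x ^ 2 ≤
        ∫ x in cubeO d, ∑ j, (pd j (fun y => v y i) x) ^ 2 := by
      refine integral_mono (integrableOn_cubeO_of_continuous ((hpc i i).pow 2))
        (integrableOn_cubeO_of_continuous (continuous_finsetSum _ fun j _ => (hpc i j).pow 2))
        fun x => ?_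
      exact Finset.single_le_sum (f := fun j => pd j (fun y => v y i) x ^ 2)
        (fun j _ => sq_nonneg _) (Finset.mem_univ i)
    linarith
  linarith

theorem pd_const_mul {φ : Vec d → ℝ} (hφ : Differentiable ℝ φ) (c : ℝ) (j : Fin d) (x : Vec d) :
    pd j (fun y => c * φ y) x = c * pd j φ x := by
  have h : HasFDerivAt (fun y => c * φ y) (c • fderiv ℝ φ x) x := by
    simpa using (hφ x).hasFDerivAt.const_mul c
  rw [pd, h.fderiv]; rfl

theorem sq_integral_le_sSup_dualValues {u : Vec d → Fin d → ℝ}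
    (hu : ∀ i, Continuous fun x => u x i) {v : Vec d → Fin d → ℝ}
    (hv : ∀ i, ContDiff ℝ (⊤ : ℕ∞) fun x => v x i) (hs : ∀ i, tsupport (fun x => v x i) ⊆ cubeO d) :
    (∫ x in cubeO d, ∑ i, u x i * v x i) ^ 2 ≤ sSup (dualValues u) ^ 2 *
      ∫ x in cubeO d, ∑ i, ∑ j, (pd j (fun y => v y i) x) ^ 2 := by
  set G := ∫ x in cubeO d, ∑ i, ∑ j, (pd j (fun y => v y i) x) ^ 2 with hG
  set I := ∫ x in cubeO d, ∑ i, u x i * v x i with hI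
  set s := sSup (dualValues u) with hs'
  have hG0 : 0 ≤ G := integral_nonneg fun x =>
    Finset.sum_nonneg fun i _ => Finset.sum_nonneg fun j _ => sq_nonneg _
  have hdiff : ∀ i, Differentiable ℝ fun x => v x i := fun i => (hv i).differentiable (by simp)
  have scale : ∀ c : ℝ, c ^ 2 * G ≤ 1 → c * I ≤ s := fun c hc => by
    refine le_csSup (dualValues_bddAbove hu) ⟨fun x i => c * v x i, fun i => ?_, fun i => ?_, ?_, ?_⟩
    · exact contDiff_const.mul (hv i)
    · exact (closure_mono (Function.support_mul_subset_right _ _)).trans (hs i)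
    · simp only [pd_const_mul (hdiff _), mul_pow, ← Finset.mul_sum]
      rwa [integral_const_mul]
    · rw [hI, ← integral_const_mul]
      refine integral_congr_ae (Filter.Eventually.of_forall fun x => ?_)
      simp only [Finset.mul_sum]
      exact Finset.sum_congr rfl fun i _ => by ring
  have key : ∀ ε : ℝ, 0 < ε → I ^ 2 ≤ s ^ 2 * (G + ε) := fun ε hε => by
    have hp : 0 < G + ε := by linarith
    set q := Real.sqrt (G + ε) with hq
    have hq0 : 0 < q := Real.sqrt_pos.mpr hp
    have hq2 : q ^ 2 = G + ε := Real.sq_sqrt hp.le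
    have hle : (q⁻¹) ^ 2 * G ≤ 1 := by
      rw [inv_pow, hq2, inv_mul_le_iff₀ hp]; linarith
    have a1 := scale q⁻¹ hle
    have a2 := scale (-q⁻¹) (by rwa [neg_sq])
    rw [inv_mul_le_iff₀ hq0] at a1
    rw [neg_mul, ← mul_neg, inv_mul_le_iff₀ hq0] at a2
    have hab : |I| ≤ |q * s| := (abs_le'.mpr ⟨a1, a2⟩).trans (le_abs_self _)
    have := sq_le_sq.mpr hab
    rw [mul_pow, hq2] at this
    linarith
  have hlim : Filter.Tendsto (fun ε : ℝ => s ^ 2 * (G + ε)) (nhdsWithin 0 (Set.Ioi 0))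
      (nhds (s ^ 2 * (G + 0))) :=
    ((by fun_prop : Continuous fun ε : ℝ => s ^ 2 * (G + ε)).tendsto 0).mono_left
      nhdsWithin_le_nhds
  rw [add_zero] at hlim
  exact ge_of_tendsto hlim (by filter_upwards [self_mem_nhdsWithin] with ε hε using key ε hε)

end Duality

section DualNorm

variable {d N : ℕ} (hN : 2 ≤ N) {nd : Fin (N + 1) → ℝ} (hnd : IsLGL N nd)
  {Ψ : Fin (N + 1) → Polynomial ℝ} (hΨ : IsLagrange N nd Ψ)

theorem tsupport_tens_cutoff_subset {n : Type} [Fintype n] (R : n → Polynomial ℝ) (m : ℕ)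
    (F : (Fin d → n) → ℝ) :
    tsupport (tens (fun _ k => cutoff (R k) m) F) ⊆ cubeO d := by
  have hcl : IsClosed {x : Vec d | ∀ j, 1 ≤ ((m : ℝ) + 1) * (1 - x j ^ 2)} := by
    simp only [Set.ofPred_forall]
    exact isClosed_iInter fun j => isClosed_le continuous_const (by fun_prop)
  refine (closure_minimal (fun x hx j => ?_) hcl).trans fun x hx j _ => ?_
  · by_contra h
    refine hx (Finset.sum_eq_zero fun K _ => ?_)
    rw [Finset.prod_eq_zero (Finset.mem_univ j) (cutoff_eq_zero _ (not_le.mp h).le), mul_zero]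
  · have h1 : 1 ≤ ((m : ℝ) + 1) * (1 - x j ^ 2) := hx j
    have hm : (0 : ℝ) < (m : ℝ) + 1 := by positivity
    have : x j ^ 2 < 1 := by
      by_contra h
      nlinarith [mul_nonneg hm.le (sub_nonneg.mpr (not_lt.mp h))]
    exact abs_lt.mp ((sq_lt_one_iff_abs_lt_one _).mp this)

/-- The stiffness matrix of the collocation derivative on interior nodes. -/
def stiff (N : ℕ) (nd : Fin (N + 1) → ℝ) (Ψ : Fin (N + 1) → Polynomial ℝ) :
    Matrix (Fin (N + 1)) (Fin (N + 1)) ℝ :=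
  Matrix.of fun m k => if k = 0 ∨ k = Fin.last N then 0 else (derivative (Ψ k)).eval (nd m)

include hN hnd hΨ in
theorem diagonal_mul_adj_apply (B : Matrix (Fin (N + 1)) (Fin (N + 1)) ℝ) (a b : Fin (N + 1)) :
    (Matrix.diagonal (lglW N Ψ) * (adj (lglW N Ψ) B * B)) a b =
      ∑ m, lglW N Ψ m * (B m a * B m b) := by
  rw [Matrix.diagonal_mul, Matrix.mul_apply, Finset.mul_sum]
  refine Finset.sum_congr rfl fun m _ => ?_
  have := (lglW_pos hN hnd hΨ a).ne'
  rw [adj]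
  field_simp

include hN hnd hΨ in
theorem smul_diagonal_sub_gram_dualR_posSemidef :
    ((8 : ℝ) • Matrix.diagonal (lglW N Ψ) - gram (dualR N nd Ψ)).PosSemidef := by
  refine posSemidef_of_sum_nonneg (fun a b => ?_) fun z => ?_
  · rw [Matrix.sub_apply, Matrix.sub_apply, Matrix.smul_apply, Matrix.smul_apply, gram_comm,
      diagonal_symm]
  · simp only [Matrix.sub_apply, sub_mul, Finset.sum_sub_distrib, Matrix.smul_apply, smul_eq_mul,
      mul_assoc, ← Finset.mul_sum]
    rw [sum_gram, sum_diagonal_mul, sub_nonneg]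
    exact pint_dualR_sq_le hN hnd hΨ z

include hN hnd hΨ in
theorem smul_stiff_sub_gram_dualR_posSemidef :
    ((30 : ℝ) • (Matrix.diagonal (lglW N Ψ) * (adj (lglW N Ψ) (stiff N nd Ψ) * stiff N nd Ψ)) -
      gram fun k => derivative (dualR N nd Ψ k)).PosSemidef := by
  have e := diagonal_mul_adj_apply hN hnd hΨ (stiff N nd Ψ)
  refine posSemidef_of_sum_nonneg (fun a b => ?_) fun z => ?_
  · rw [Matrix.sub_apply, Matrix.sub_apply, Matrix.smul_apply, Matrix.smul_apply, gram_comm, e, e]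
    congr 2
    exact Finset.sum_congr rfl fun m _ => by ring
  · simp only [Matrix.sub_apply, sub_mul, Finset.sum_sub_distrib, Matrix.smul_apply, smul_eq_mul,
      mul_assoc, ← Finset.mul_sum]
    rw [sum_gram, sub_nonneg]
    refine (pint_derivative_dualR_sq_le hN hnd hΨ z).trans_eq ?_
    congr 1
    simp only [e, Finset.sum_mul]
    rw [Finset.sum_congr rfl fun a _ => Finset.sum_comm, Finset.sum_comm]
    refine Finset.sum_congr rfl fun m _ => ?_
    rw [sq, Finset.sum_mul_sum, Finset.mul_sum]
    refine Finset.sum_congr rfl fun a _ => ?_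
    rw [Finset.mul_sum]
    refine Finset.sum_congr rfl fun b _ => ?_
    simp only [stiff, Matrix.of_apply]
    ring

include hN hnd hΨ in
theorem qf_dualR_eq_gip (U : (Fin d → Fin (N + 1)) → ℝ) {φ : (Fin d → Fin (N + 1)) → ℝ}
    (hφ : ∀ k, (lglData hN hnd hΨ).Van k φ) :
    qf (fun _ => Matrix.of fun a b => pint (Ψ a * dualR N nd Ψ b)) U φ =
      gip d (lglW N Ψ) U φ := by
  rw [← qf_diagonal]
  refine Finset.sum_congr rfl fun K _ => Finset.sum_congr rfl fun L _ => ?_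
  by_cases h : ∃ j, L j = 0 ∨ L j = Fin.last N
  · obtain ⟨j, hj⟩ := h
    rw [hφ j L hj, mul_zero, mul_zero, mul_zero]
  · congr 1
    refine Finset.prod_congr rfl fun j _ => ?_
    refine (pint_basis_mul_dualR hN hnd hΨ (K j) (L j)).trans ?_
    rw [if_neg fun h' => h ⟨j, h'⟩]
    refine Eq.trans ?_ (Matrix.diagonal_apply (lglW N Ψ) (K j) (L j)).symm
    by_cases hk : K j = L j
    · rw [if_pos hk, if_pos hk, hk]
    · rw [if_neg hk, if_neg hk]

include hN hnd hΨ in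
theorem qf_gram_dualR_le {φ : (Fin d → Fin (N + 1)) → ℝ}
    (hφ : ∀ k, (lglData hN hnd hΨ).Van k φ) (j : Fin d) :
    qf (Function.update (fun _ => gram (dualR N nd Ψ)) j
      (gram fun k => derivative (dualR N nd Ψ k))) φ φ ≤
      30 * 8 ^ (d - 1) * (lglData hN hnd hΨ).ip (op j (lglData hN hnd hΨ).D φ)
        (op j (lglData hN hnd hΨ).D φ) := by
  set w := lglW N Ψ with hw
  set E := stiff N nd Ψ with hE
  have hop : op j E φ = op j (lglData hN hnd hΨ).D φ := by
    funext K
    rw [op_apply, op_apply]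
    refine Finset.sum_congr rfl fun m _ => ?_
    by_cases hm : m = 0 ∨ m = Fin.last N
    · have : φ (Function.update K j m) = 0 := hφ j _ (by rw [Function.update_self]; exact hm)
      rw [this, mul_zero, mul_zero]
    · rw [hE, stiff, Matrix.of_apply, if_neg hm]; rfl
  have h1 := qf_mono (A := Function.update (fun _ => gram (dualR N nd Ψ)) j
      (gram fun k => derivative (dualR N nd Ψ k)))
    (B := fun i => (Function.update (fun _ => (8 : ℝ)) j 30 : Fin d → ℝ) i •
      (Function.update (fun _ => Matrix.diagonal w) j (Matrix.diagonal w * (adj w E * E)) :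
        Fin d → Matrix _ _ ℝ) i)
    (fun i => by
      by_cases hi : i = j
      · subst hi; rw [Function.update_self]; exact gram_posSemidef _
      · rw [Function.update_of_ne hi]; exact gram_posSemidef _)
    (fun i => by
      by_cases hi : i = j
      · subst hi; simp only [Function.update_self]
        exact smul_stiff_sub_gram_dualR_posSemidef hN hnd hΨ
      · simp only [Function.update_of_ne hi]
        exact smul_diagonal_sub_gram_dualR_posSemidef hN hnd hΨ) φ
  rw [qf_smul, qf_update_diagonal, op_mul, ← gip_op_left (lglW_pos hN hnd hΨ), hop,
    Finset.prod_update_of_mem (Finset.mem_univ j), Finset.prod_const,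
    Finset.card_sdiff_of_subset (Finset.subset_univ _), Finset.card_univ, Finset.card_singleton,
    Fintype.card_fin] at h1
  exact h1

include hN hnd hΨ in
/-- The discrete pairing is controlled by the dual norm and the discrete gradient. -/
theorem sum_gip_sq_le (U φ : Fin d → (Fin d → Fin (N + 1)) → ℝ)
    (hφ : ∀ i k, (lglData hN hnd hΨ).Van k (φ i)) :
    (∑ i, (lglData hN hnd hΨ).ip (U i) (φ i)) ^ 2 ≤
      sSup (dualValues fun x i => interp Ψ (U i) x) ^ 2 *
        (30 * 8 ^ (d - 1) * ∑ i, ∑ j, (lglData hN hnd hΨ).ip (op j (lglData hN hnd hΨ).D (φ i))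
          (op j (lglData hN hnd hΨ).D (φ i))) := by
  set R := dualR N nd Ψ with hR
  have hRe := fun k => dualR_eval_end hnd hΨ k
  choose B hB using fun k => cutoff_bound (R := R k) (hRe k).1 (hRe k).2
  have hcd : ∀ k m, ContDiff ℝ (⊤ : ℕ∞) (cutoff (R k) m) := fun k m => cutoff_contDiff _ _
  have hdf : ∀ k m, Differentiable ℝ (cutoff (R k) m) := fun k m =>
    (hcd k m).differentiable (by simp)
  have hc : ∀ k m, Continuous (cutoff (R k) m) := fun k m => (hcd k m).continuous
  have hdc : ∀ k m, Continuous (deriv (cutoff (R k) m)) := fun k m =>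
    (hcd k m).continuous_deriv (by simp)
  set v : ℕ → Vec d → Fin d → ℝ := fun m x i => tens (fun _ k => cutoff (R k) m) (φ i) x with hv
  have hUc : ∀ i, Continuous fun x => interp Ψ (U i) x := fun i =>
    (tens_differentiable (fun _ k => (Ψ k).differentiable) (U i)).continuous
  have hvd : ∀ m i, ContDiff ℝ (⊤ : ℕ∞) fun x => v m x i := fun m i =>
    tens_contDiff (fun _ k => hcd k m) (φ i)
  have hp : ∀ m i j, pd j (fun y => v m y i) =
      tens (Function.update (fun _ k => cutoff (R k) m) j fun a => deriv (cutoff (R a) m)) (φ i) :=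
    fun m i j => pd_tens (fun _ k => hdf k m) j (φ i)
  have hcu : ∀ (m : ℕ) (j i : Fin d) (k : Fin (N + 1)),
      Continuous ((Function.update (fun _ k => cutoff (R k) m) j fun a => deriv (cutoff (R a) m) :
        Fin d → Fin (N + 1) → ℝ → ℝ) i k) := fun m j i k => by
    by_cases hi : i = j
    · subst hi; rw [Function.update_self]; exact hdc k m
    · rw [Function.update_of_ne hi]; exact hc k m
  have hcont_pd : ∀ m i j, Continuous (pd j fun y => v m y i) := fun m i j =>
    continuous_pd (hvd m i) j
  have key : ∀ m, (∑ i, qf (fun _ => Matrix.of fun a b =>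
        ∫ x in Set.Ioo (-1 : ℝ) 1, (Ψ a).eval x * cutoff (R b) m x) (U i) (φ i)) ^ 2 ≤
      sSup (dualValues fun x i => interp Ψ (U i) x) ^ 2 * ∑ i, ∑ j, qf (fun l a b =>
        ∫ x in Set.Ioo (-1 : ℝ) 1,
          (Function.update (fun _ k => cutoff (R k) m) j fun a => deriv (cutoff (R a) m) :
            Fin d → Fin (N + 1) → ℝ → ℝ) l a x *
          (Function.update (fun _ k => cutoff (R k) m) j fun a => deriv (cutoff (R a) m) :
            Fin d → Fin (N + 1) → ℝ → ℝ) l b x) (φ i) (φ i) := fun m => by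
    have h := sq_integral_le_sSup_dualValues (u := fun x i => interp Ψ (U i) x) hUc (hvd m)
      (fun i => tsupport_tens_cutoff_subset R m (φ i))
    have e1 : ∫ x in cubeO d, ∑ i, interp Ψ (U i) x * v m x i = ∑ i, qf (fun _ => Matrix.of fun a b =>
        ∫ x in Set.Ioo (-1 : ℝ) 1, (Ψ a).eval x * cutoff (R b) m x) (U i) (φ i) := by
      rw [integral_finsetSum (f := fun i x => interp Ψ (U i) x * v m x i) _ fun i _ =>
        integrableOn_cubeO_of_continuous ((hUc i).mul (hvd m i).continuous)]
      refine Finset.sum_congr rfl fun i _ => ?_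
      rw [restrict_cubeO]
      exact integral_tens_mul (fun j k l => integrableOn_Ioo_of_continuous
        ((Ψ k).continuous.mul (hc l m))) (U i) (φ i)
    have e2 : ∫ x in cubeO d, ∑ i, ∑ j, (pd j (fun y => v m y i) x) ^ 2 = ∑ i, ∑ j, qf (fun l a b =>
        ∫ x in Set.Ioo (-1 : ℝ) 1,
          (Function.update (fun _ k => cutoff (R k) m) j fun a => deriv (cutoff (R a) m) :
            Fin d → Fin (N + 1) → ℝ → ℝ) l a x *
          (Function.update (fun _ k => cutoff (R k) m) j fun a => deriv (cutoff (R a) m) :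
            Fin d → Fin (N + 1) → ℝ → ℝ) l b x) (φ i) (φ i) := by
      rw [integral_finsetSum (f := fun i x => ∑ j, (pd j (fun y => v m y i) x) ^ 2) _ fun i _ =>
        integrableOn_cubeO_of_continuous (continuous_finsetSum _ fun j _ => (hcont_pd m i j).pow 2)]
      refine Finset.sum_congr rfl fun i _ => ?_
      rw [integral_finsetSum (f := fun j x => (pd j (fun y => v m y i) x) ^ 2) _ fun j _ =>
        integrableOn_cubeO_of_continuous ((hcont_pd m i j).pow 2)]
      refine Finset.sum_congr rfl fun j _ => ?_
      simp only [hp, sq]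
      rw [restrict_cubeO]
      exact integral_tens_mul (fun l a b => integrableOn_Ioo_of_continuous
        ((hcu m j l a).mul (hcu m j l b))) (φ i) (φ i)
    rw [← e1, ← e2]
    exact h
  have ev : ∀ k, ∀ x ∈ Set.Ioo (-1 : ℝ) 1, _ := fun k x hx => cutoff_eventually (R k) hx
  have lim1 : Filter.Tendsto (fun m => (∑ i, qf (fun _ => Matrix.of fun a b =>
        ∫ x in Set.Ioo (-1 : ℝ) 1, (Ψ a).eval x * cutoff (R b) m x) (U i) (φ i)) ^ 2) Filter.atTop
      (nhds ((∑ i, qf (fun _ => Matrix.of fun a b => pint (Ψ a * R b)) (U i) (φ i)) ^ 2)) := by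
    refine (tendsto_finsetSum _ fun i _ => tendsto_qf (fun j a b => ?_) _ _).pow 2
    obtain ⟨M, hM⟩ := (isCompact_Icc (a := (-1 : ℝ)) (b := 1)).exists_bound_of_continuousOn
      (Ψ a).continuous.continuousOn
    exact tendsto_setIntegral_mul (fun m => (Ψ a).continuous) (fun m => hc b m)
      (fun m x hx => hM x (Set.Ioo_subset_Icc_self hx)) (fun m x hx => (hB b m x hx).1)
      (fun x _ => Filter.Eventually.of_forall fun _ => rfl)
      (fun x hx => (ev b x hx).mono fun _ h => h.1)
  have lim2 := fun i j => tendsto_qf (d := d) (n := Fin (N + 1)) (A := fun m l a b =>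
        ∫ x in Set.Ioo (-1 : ℝ) 1,
          (Function.update (fun _ k => cutoff (R k) m) j fun a => deriv (cutoff (R a) m) :
            Fin d → Fin (N + 1) → ℝ → ℝ) l a x *
          (Function.update (fun _ k => cutoff (R k) m) j fun a => deriv (cutoff (R a) m) :
            Fin d → Fin (N + 1) → ℝ → ℝ) l b x)
      (A' := Function.update (fun _ => gram R) j (gram fun k => derivative (R k)))
      (fun l a b => by
        by_cases hl : l = j
        · subst hl
          simp only [Function.update_self]
          exact tendsto_setIntegral_mul (fun m => hdc a m) (fun m => hdc b m)
            (fun m x hx => (hB a m x hx).2) (fun m x hx => (hB b m x hx).2)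
            (fun x hx => (ev a x hx).mono fun _ h => h.2)
            (fun x hx => (ev b x hx).mono fun _ h => h.2)
        · simp only [Function.update_of_ne hl]
          exact tendsto_setIntegral_mul (fun m => hc a m) (fun m => hc b m)
            (fun m x hx => (hB a m x hx).1) (fun m x hx => (hB b m x hx).1)
            (fun x hx => (ev a x hx).mono fun _ h => h.1)
            (fun x hx => (ev b x hx).mono fun _ h => h.1)) (φ i) (φ i)
  have fin := le_of_tendsto_of_tendsto' lim1 ((tendsto_finsetSum _ fun i _ =>
    tendsto_finsetSum _ fun j _ => lim2 i j).const_mul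
      (sSup (dualValues fun x i => interp Ψ (U i) x) ^ 2)) key
  rw [Finset.sum_congr rfl fun i _ => qf_dualR_eq_gip hN hnd hΨ (U i) (hφ i)] at fin
  refine fin.trans (mul_le_mul_of_nonneg_left ?_ (sq_nonneg _))
  rw [Finset.mul_sum]
  refine Finset.sum_le_sum fun i _ => ?_
  rw [Finset.mul_sum]
  exact Finset.sum_le_sum fun j _ => qf_gram_dualR_le hN hnd hΨ (hφ i) j

end DualNorm

theorem IsLGL.unique {N : ℕ} {nd nd' : Fin (N + 1) → ℝ} (h : IsLGL N nd) (h' : IsLGL N nd') :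
    nd = nd' :=
  (StrictMono.range_inj h.1 h'.1).1 (Set.ext fun x => (h.2.2.2 x).symm.trans (h'.2.2.2 x))

theorem IsLagrange.unique {N : ℕ} {nd : Fin (N + 1) → ℝ} (hnd : IsLGL N nd)
    {Ψ Ψ' : Fin (N + 1) → ℝ[X]} (h : IsLagrange N nd Ψ) (h' : IsLagrange N nd Ψ') : Ψ = Ψ' := by
  funext k
  rw [h'.eq_sum hnd (h k).1]
  refine (Finset.sum_eq_single k ?_ ?_).trans ?_
  · intro m _ hm
    rw [(h k).2, if_neg hm, C_0, zero_mul]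
  · simp
  · rw [(h k).2, if_pos rfl, C_1, one_mul]

/-- Observability of the collocation system, uniformly in the order `N`. -/
theorem exists_uniform_observable {d : ℕ} {lam mu T : ℝ} (hd : 0 < d) (hlam : 0 < lam)
    (hmu : 0 < mu) (hT : 16 * √(d / mu) ≤ T) :
    ∃ C > 0, ∀ (N : ℕ) (hN : 2 ≤ N) (nd : Fin (N + 1) → ℝ) (hnd : IsLGL N nd)
      (Ψ : Fin (N + 1) → ℝ[X]) (hΨ : IsLagrange N nd Ψ),
      (lglData hN hnd hΨ).Observable d lam mu T C := by
  have hd' : (0 : ℝ) < d := by exact_mod_cast hd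
  have hs : 0 < √(d / mu) := Real.sqrt_pos.2 (by positivity)
  have hT0 : 0 < T := by linarith
  have hsmall : ∀ N : ℕ, ∃ C > 0, ∀ (hN : 2 ≤ N) (nd : Fin (N + 1) → ℝ) (hnd : IsLGL N nd)
      (Ψ : Fin (N + 1) → ℝ[X]) (hΨ : IsLagrange N nd Ψ),
      (lglData hN hnd hΨ).Observable d lam mu T C := by
    intro N
    by_cases hex : ∃ (_ : 2 ≤ N) (nd : Fin (N + 1) → ℝ) (_ : IsLGL N nd)
        (Ψ : Fin (N + 1) → ℝ[X]), IsLagrange N nd Ψ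
    · obtain ⟨hN, nd, hnd, Ψ, hΨ⟩ := hex
      obtain ⟨C, hC, h⟩ := (lglData hN hnd hΨ).exists_observable hd hlam hmu hT0
      refine ⟨C, hC, fun hN' nd' hnd' Ψ' hΨ' => ?_⟩
      obtain rfl := hnd.unique hnd'
      obtain rfl := IsLagrange.unique hnd hΨ hΨ'
      exact h
    · exact ⟨1, one_pos, fun hN nd hnd Ψ hΨ => (hex ⟨hN, nd, hnd, Ψ, hΨ⟩).elim⟩
  choose Cs hCs hobs using hsmall
  obtain ⟨M, hM⟩ := exists_nat_ge (LGLData.virialC d lam mu)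
  set Cl := LGLData.obsC d lam mu / (3 / 4 * √(d / mu)) with hCl
  have hCl0 : 0 ≤ Cl := div_nonneg (LGLData.obsC_nonneg hlam hmu) (by positivity)
  have hsum : 0 ≤ ∑ m ∈ Finset.range M, Cs m := Finset.sum_nonneg fun m _ => (hCs m).le
  refine ⟨1 + Cl + ∑ m ∈ Finset.range M, Cs m, by positivity, fun N hN nd hnd Ψ hΨ => ?_⟩
  by_cases hNM : N < M
  · refine LGLData.Observable.mono _ hT0.le (hobs N hN nd hnd Ψ hΨ) ?_
    have := Finset.single_le_sum (f := Cs) (fun m _ => (hCs m).le) (Finset.mem_range.2 hNM)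
    linarith
  · refine LGLData.Observable.mono _ hT0.le (LGLData.observable_of_large _ hd hlam hmu ?_ hT) ?_
    · exact hM.trans (by exact_mod_cast not_lt.1 hNM)
    · linarith

theorem sum_gip_sq_le_mul {d : ℕ} {n : Type} [Fintype n] {w : n → ℝ} (hw : ∀ i, 0 < w i)
    (u v : Fin d → (Fin d → n) → ℝ) :
    (∑ i, gip d w (u i) (v i)) ^ 2 ≤ (∑ i, gip d w (u i) (u i)) * ∑ i, gip d w (v i) (v i) := by
  simp only [gip_apply, ← Finset.sum_product']
  refine Finset.sum_sq_le_sum_mul_sum_of_sq_le_mul _ (fun p _ => ?_) (fun p _ => ?_)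
    fun p _ => le_of_eq (by ring)
  all_goals
    exact mul_nonneg (Finset.prod_nonneg fun _ _ => (hw _).le) (mul_self_nonneg _)

/-- Continuity of the duality pairing of the initial data with respect to the energy. -/
theorem sq_ipV_sub_le {d N : ℕ} {lam mu : ℝ} (hlam : 0 < lam) (hmu : 0 < mu) (hN : 2 ≤ N)
    {nd : Fin (N + 1) → ℝ} (hnd : IsLGL N nd) {Ψ : Fin (N + 1) → ℝ[X]} (hΨ : IsLagrange N nd Ψ)
    (u0 u1 : (lglData hN hnd hΨ).diS d)
    (z : (lglData hN hnd hΨ).diS d × (lglData hN hnd hΨ).diS d) :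
    ((lglData hN hnd hΨ).ipV u1 z.1 - (lglData hN hnd hΨ).ipV u0 z.2) ^ 2 ≤
      (2 * (30 * 8 ^ (d - 1) / mu + 3 ^ d)) *
        ((∫ x in cubeO d, ∑ i, interp Ψ (u0.1 i) x ^ 2) +
          sSup (dualValues fun x i => interp Ψ (u1.1 i) x) ^ 2) *
      ((lglData hN hnd hΨ).ipV z.2 z.2 + (lglData hN hnd hΨ).afV lam mu z.1 z.1) := by
  have hw : ∀ k, 0 < (lglData hN hnd hΨ).w k := (lglData hN hnd hΨ).w_pos
  have h1 := sum_gip_sq_le hN hnd hΨ u1.1 z.1.1 z.1.2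
  have h2 := LGLData.le_af (lglData hN hnd hΨ) hlam hmu z.1.1
  have h3 : (∑ i, (lglData hN hnd hΨ).ip (u0.1 i) (z.2.1 i)) ^ 2 ≤
      (∑ i, (lglData hN hnd hΨ).ip (u0.1 i) (u0.1 i)) *
        ∑ i, (lglData hN hnd hΨ).ip (z.2.1 i) (z.2.1 i) := sum_gip_sq_le_mul hw u0.1 z.2.1
  have h4 : ∑ i, (lglData hN hnd hΨ).ip (u0.1 i) (u0.1 i) ≤
      3 ^ d * ∫ x in cubeO d, ∑ i, interp Ψ (u0.1 i) x ^ 2 := by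
    rw [integral_finsetSum (f := fun i x => interp Ψ (u0.1 i) x ^ 2), Finset.mul_sum]
    · exact Finset.sum_le_sum fun i _ => gip_le_integral_sq hN hnd hΨ (u0.1 i)
    · intro i _
      refine integrableOn_cubeO_of_continuous ?_
      exact (tens_differentiable (fun _ k => (Ψ k).differentiable) _).continuous.pow 2
  have h5 : 0 ≤ ∑ i, (lglData hN hnd hΨ).ip (z.2.1 i) (z.2.1 i) :=
    Finset.sum_nonneg fun i _ => gip_self_nonneg hw _
  have h6 : 0 ≤ ∫ x in cubeO d, ∑ i, interp Ψ (u0.1 i) x ^ 2 :=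
    integral_nonneg fun x => Finset.sum_nonneg fun i _ => sq_nonneg _
  rw [Finset.sum_comm] at h2
  rw [LGLData.ipV_apply, LGLData.ipV_apply, LGLData.ipV_apply, LGLData.afV_apply]
  set p := ∑ i, (lglData hN hnd hΨ).ip (u1.1 i) (z.1.1 i)
  set q := ∑ i, (lglData hN hnd hΨ).ip (u0.1 i) (z.2.1 i)
  set B := ∑ i, (lglData hN hnd hΨ).ip (z.2.1 i) (z.2.1 i)
  set A := (lglData hN hnd hΨ).af lam mu z.1.1 z.1.1
  set I := ∫ x in cubeO d, ∑ i, interp Ψ (u0.1 i) x ^ 2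
  set G := ∑ i, ∑ j, (lglData hN hnd hΨ).ip (op j (lglData hN hnd hΨ).D (z.1.1 i))
    (op j (lglData hN hnd hΨ).D (z.1.1 i))
  set Q := sSup (dualValues fun x i => interp Ψ (u1.1 i) x) ^ 2
  have hQ : 0 ≤ Q := sq_nonneg _
  have hG0 : 0 ≤ G := Finset.sum_nonneg fun i _ => Finset.sum_nonneg fun j _ => gip_self_nonneg hw _
  have hA0 : 0 ≤ A := (mul_nonneg hmu.le hG0).trans h2
  have hG : G ≤ A / mu := by rw [le_div_iff₀ hmu]; linarith
  have hp : p ^ 2 ≤ 30 * 8 ^ (d - 1) / mu * (Q * A) := by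
    refine h1.trans ?_
    calc Q * (30 * 8 ^ (d - 1) * G) ≤ Q * (30 * 8 ^ (d - 1) * (A / mu)) := by gcongr
      _ = _ := by ring
  have hq : q ^ 2 ≤ 3 ^ d * (I * B) := h3.trans (by
    calc _ ≤ (3 ^ d * I) * B := by gcongr
      _ = _ := by ring)
  set c1 : ℝ := 30 * 8 ^ (d - 1) / mu
  set c2 : ℝ := 3 ^ d
  have hc1 : 0 ≤ c1 := by positivity
  have hc2 : 0 ≤ c2 := by positivity
  have e1 : c1 * (Q * A) ≤ c1 * ((I + Q) * (B + A)) := by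
    gcongr <;> linarith
  have e2 : c2 * (I * B) ≤ c2 * ((I + Q) * (B + A)) := by
    gcongr <;> linarith
  nlinarith [sq_nonneg (p + q)]

theorem HasDerivAt.linearMap_comp {V : Type*} [NormedAddCommGroup V] [NormedSpace ℝ V]
    [FiniteDimensional ℝ V] (L : V →ₗ[ℝ] ℝ) {U : ℝ → V} {U' : V} {t : ℝ}
    (h : HasDerivAt U U' t) : HasDerivAt (fun s => L (U s)) (L U') t :=
  (LinearMap.toContinuousLinearMap L).hasFDerivAt.comp_hasDerivAt t h

section

variable {d N : ℕ}

/-- Evaluation of a component of the interpolation at a point, as a linear functional of the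
nodal values. -/
def interpL (Ψ : Fin (N + 1) → ℝ[X]) (x : Vec d) (i : Fin d) :
    (Fin d → (Fin d → Fin (N + 1)) → ℝ) →ₗ[ℝ] ℝ where
  toFun ζ := interp Ψ (ζ i) x
  map_add' ζ ξ := by simp only [interp, tens, Pi.add_apply, add_mul, Finset.sum_add_distrib]
  map_smul' c ζ := by
    simp only [interp, tens, Pi.smul_apply, smul_eq_mul, mul_assoc, Finset.mul_sum,
      RingHom.id_apply]

theorem interp_add (Ψ : Fin (N + 1) → ℝ[X]) (F G : (Fin d → Fin (N + 1)) → ℝ) :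
    interp Ψ (F + G) = interp Ψ F + interp Ψ G := by
  funext x
  simp only [interp, tens, Pi.add_apply, add_mul, Finset.sum_add_distrib]

theorem interp_sum {ι : Type*} (s : Finset ι) (Ψ : Fin (N + 1) → ℝ[X])
    (F : ι → (Fin d → Fin (N + 1)) → ℝ) (x : Vec d) :
    interp Ψ (∑ j ∈ s, F j) x = ∑ j ∈ s, interp Ψ (F j) x := by
  simp only [interp, tens, Finset.sum_apply, Finset.sum_mul]
  exact Finset.sum_comm

theorem elast_interp {lam mu : ℝ} (hN : 2 ≤ N) {nd : Fin (N + 1) → ℝ} (hnd : IsLGL N nd)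
    {Ψ : Fin (N + 1) → ℝ[X]} (hΨ : IsLagrange N nd Ψ)
    (ζ : Fin d → (Fin d → Fin (N + 1)) → ℝ) (K : Fin d → Fin (N + 1)) (i : Fin d) :
    elast lam mu (fun x i => interp Ψ (ζ i) x) (nodeP nd K) i =
      (lglData hN hnd hΨ).el lam mu ζ i K := by
  have hpd : ∀ (k : Fin d) (F : (Fin d → Fin (N + 1)) → ℝ), pd k (interp Ψ F) =
      interp Ψ (op k (lglData hN hnd hΨ).D F) := fun k F => pd_interp hnd hΨ k F
  have hdiv : vdiv (fun x i => interp Ψ (ζ i) x) = interp Ψ ((lglData hN hnd hΨ).dv ζ) := by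
    funext x
    rw [LGLData.dv, interp_sum]
    exact Finset.sum_congr rfl fun j _ => congrFun (hpd j (ζ j)) x
  have h2 : ∀ j, pd j (pd j fun y => interp Ψ (ζ i) y) (nodeP nd K) =
      op j (lglData hN hnd hΨ).D (op j (lglData hN hnd hΨ).D (ζ i)) K := fun j => by
    rw [show (fun y => interp Ψ (ζ i) y) = interp Ψ (ζ i) from rfl, hpd, hpd, interp_nodeP hΨ]
  simp only [elast, hdiv, hpd, interp_nodeP hΨ, LGLData.el, Pi.add_apply, Pi.smul_apply,
    smul_eq_mul, Finset.sum_apply]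

theorem nodeP_mem_cubeO (hN : 2 ≤ N) {nd : Fin (N + 1) → ℝ} (hnd : IsLGL N nd)
    {Ψ : Fin (N + 1) → ℝ[X]} (hΨ : IsLagrange N nd Ψ) (K : Fin d → Fin (N + 1)) :
    nodeP nd K ∈ cubeO d ↔ ∀ j, ¬ (lglData hN hnd hΨ).IsEnd (K j) := by
  simp only [cubeO, Set.mem_univ_pi, nodeP]
  refine forall_congr' fun j => ⟨fun h he => ?_, fun h => ?_⟩
  · rcases he with he | he
    · have : nd (K j) = -1 := by rw [he]; exact hnd.2.1
      exact absurd h.1 (by rw [this]; exact lt_irrefl _)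
    · have : nd (K j) = 1 := by rw [he]; exact hnd.2.2.1
      exact absurd h.2 (by rw [this]; exact lt_irrefl _)
  · have := hnd.sq_lt (k := K j) (fun h0 => h (Or.inl h0)) (fun h0 => h (Or.inr h0))
    exact abs_lt.1 ((sq_lt_one_iff_abs_lt_one _).1 this)

theorem nodeP_mem_cubeB (hN : 2 ≤ N) {nd : Fin (N + 1) → ℝ} (hnd : IsLGL N nd)
    {Ψ : Fin (N + 1) → ℝ[X]} (hΨ : IsLagrange N nd Ψ) (K : Fin d → Fin (N + 1)) :
    nodeP nd K ∈ cubeB d ↔ ∃ j, (lglData hN hnd hΨ).IsEnd (K j) := by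
  have hC : nodeP nd K ∈ cubeC d := fun j _ => by
    have := hnd.sq_le (K j)
    exact abs_le.1 ((sq_le_one_iff_abs_le_one _).1 this)
  rw [cubeB, Set.mem_sdiff, and_iff_right hC, nodeP_mem_cubeO hN hnd hΨ]
  push Not
  rfl

theorem update_nodeP {nd : Fin (N + 1) → ℝ} (K : Fin d → Fin (N + 1)) (j : Fin d)
    (m : Fin (N + 1)) : Function.update (nodeP nd K) j (nd m) = nodeP nd (Function.update K j m) := by
  funext l
  by_cases h : l = j
  · subst h; simp [nodeP]
  · simp [nodeP, h]

/-- The nodal values of a Dirichlet polynomial field form a Dirichlet grid field. -/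
theorem di_of_memPolyDi (hN : 2 ≤ N) {nd : Fin (N + 1) → ℝ} (hnd : IsLGL N nd)
    {Ψ : Fin (N + 1) → ℝ[X]} (hΨ : IsLagrange N nd Ψ) {u : Vec d → Fin d → ℝ}
    (hu : ∀ i, MemPolyDi d N fun x => u x i) :
    (lglData hN hnd hΨ).Di fun i K => u (nodeP nd K) i :=
  fun i k K hK => (hu i).2 _ ((nodeP_mem_cubeB hN hnd hΨ K).2 ⟨k, hK⟩)

theorem continuous_interp_joint {X : Type*} [TopologicalSpace X] (Ψ : Fin (N + 1) → ℝ[X])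
    {F : X → (Fin d → Fin (N + 1)) → ℝ} (hF : Continuous F) {y : X → Vec d} (hy : Continuous y) :
    Continuous fun t => interp Ψ (F t) (y t) := by
  unfold interp tens
  refine continuous_finsetSum _ fun K _ => Continuous.mul ?_ ?_
  · exact (continuous_apply K).comp hF
  · exact continuous_finsetProd _ fun j _ =>
      (Ψ (K j)).continuous.comp ((continuous_apply j).comp hy)

theorem continuous_faceInt_interp (Ψ : Fin (N + 1) → ℝ[X]) (k : Fin d) (c : ℝ)
    {F : ℝ → Fin d → (Fin d → Fin (N + 1)) → ℝ} (hF : Continuous F) :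
    Continuous fun t => faceInt d k c fun x => ∑ i, interp Ψ (F t i) x ^ 2 := by
  unfold faceInt
  refine continuous_const.mul ?_
  refine continuous_parametric_integral_of_continuous
    (f := fun t x => ∑ i, interp Ψ (F t i) (Function.update x k c) ^ 2) ?_ isBounded_cubeC
  refine continuous_finsetSum _ fun i _ => Continuous.pow (continuous_interp_joint Ψ ?_ ?_) 2
  · exact (continuous_apply i).comp (hF.comp continuous_fst)
  · exact continuous_snd.update k continuous_const

theorem faceInt_sum_interp_le (hN : 2 ≤ N) {nd : Fin (N + 1) → ℝ} (hnd : IsLGL N nd)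
    {Ψ : Fin (N + 1) → ℝ[X]} (hΨ : IsLagrange N nd Ψ) (k : Fin d) (e : Fin (N + 1))
    (F : Fin d → (Fin d → Fin (N + 1)) → ℝ) :
    (faceInt d k (nd e) fun x => ∑ i, interp Ψ (F i) x ^ 2) ≤
      ∑ i, (lglData hN hnd hΨ).fip k e (F i) (F i) := by
  have h : (faceInt d k (nd e) fun x => ∑ i, interp Ψ (F i) x ^ 2) =
      ∑ i, faceInt d k (nd e) fun x => interp Ψ (F i) x ^ 2 := by
    unfold faceInt
    rw [integral_finsetSum _ fun i _ => (faceInt_interp_sq_le hN hnd hΨ k e (F i)).1,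
      Finset.mul_sum]
  rw [h]
  exact Finset.sum_le_sum fun i _ => (faceInt_interp_sq_le hN hnd hΨ k e (F i)).2

end

namespace LGLData

variable {n : Type} [Fintype n] [DecidableEq n] (S : LGLData n) {d : ℕ}

theorem lift_eq_zero {lam mu : ℝ} (φ : Fin d → (Fin d → n) → ℝ) (i : Fin d) {K : Fin d → n}
    (hK : ∀ j, K j ≠ S.b) : S.lift lam mu φ i K = 0 := by
  simp only [lift_apply, Pi.neg_apply, Pi.smul_apply, Finset.sum_apply, F, op_diagonal_apply,
    if_neg (hK _), zero_mul, Finset.sum_const_zero, smul_zero, neg_zero]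

theorem fip_lift_self (lam mu : ℝ) (φ : Fin d → (Fin d → n) → ℝ) (k i : Fin d) :
    S.fip k S.b (S.lift lam mu φ i) (S.lift lam mu φ i) =
      S.fip k S.b (S.obsF lam mu k φ i) (S.obsF lam mu k φ i) := by
  rw [fip_b_lift, fip_comm, fip_b_lift, neg_neg]

/-- The second family of controls on the face `x_k = s c`. -/
def ctrl (lam mu : ℝ) (c : n) (k : Fin d) :
    (Fin d → (Fin d → n) → ℝ) →ₗ[ℝ] (Fin d → (Fin d → n) → ℝ) where
  toFun φ i := (-√(S.w c) * cf lam mu k i) • op k S.D (op k S.D (φ i))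
  map_add' φ ψ := by funext i; simp only [Pi.add_apply, map_add, smul_add]
  map_smul' c φ := by
    funext i
    simp only [Pi.smul_apply, map_smul, RingHom.id_apply]
    rw [smul_comm]

theorem ctrl_apply (lam mu : ℝ) (c : n) (k : Fin d) (φ : Fin d → (Fin d → n) → ℝ) (i : Fin d) :
    S.ctrl lam mu c k φ i = (-√(S.w c) * cf lam mu k i) • op k S.D (op k S.D (φ i)) := rfl

theorem fip_ctrl_self (lam mu : ℝ) (c : n) (k : Fin d) (φ : Fin d → (Fin d → n) → ℝ) (i : Fin d) :
    S.fip k c (S.ctrl lam mu c k φ i) (S.ctrl lam mu c k φ i) =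
      S.w c * (cf lam mu k i ^ 2 *
        S.fip k c (op k S.D (op k S.D (φ i))) (op k S.D (op k S.D (φ i)))) := by
  have := Real.sq_sqrt (S.w_pos c).le
  simp only [ctrl_apply, map_smul, LinearMap.smul_apply, smul_eq_mul]
  linear_combination (cf lam mu k i ^ 2 *
    S.fip k c (op k S.D (op k S.D (φ i))) (op k S.D (op k S.D (φ i)))) * this

theorem obs_eq_controls (lam mu : ℝ) (φ : Fin d → (Fin d → n) → ℝ) :
    S.obs lam mu φ φ = ∑ k, ∑ i, S.fip k S.b (S.lift lam mu φ i) (S.lift lam mu φ i) +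
      ∑ k, (∑ i, S.fip k S.b (S.ctrl lam mu S.b k φ i) (S.ctrl lam mu S.b k φ i) +
        ∑ i, S.fip k S.a (S.ctrl lam mu S.a k φ i) (S.ctrl lam mu S.a k φ i)) := by
  simp only [obs, fip_lift_self, fip_ctrl_self, ← Finset.sum_add_distrib]
  exact Finset.sum_congr rfl fun k _ => Finset.sum_congr rfl fun i _ => by ring

theorem op_hk_apply (σ : ℝ) (c : n) (k : Fin d) (u : (Fin d → n) → ℝ) (K : Fin d → n) :
    op k (S.hk σ c) u K =
      (-(S.D * S.D) (K k) c + σ * S.D (K k) c / S.w c) * u (Function.update K k c) := by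
  rw [op_apply]
  simp only [hk_apply, ite_mul, zero_mul, Finset.sum_ite_eq', Finset.mem_univ, if_true]

/-- The source term expressed through the second family of controls. -/
theorem src_eq_controls (lam mu : ℝ) (φ : Fin d → (Fin d → n) → ℝ) (i : Fin d) (K : Fin d → n) :
    S.src lam mu φ i K = ∑ k,
      (cf lam mu k i * (1 / √(S.w S.b) *
          (-(S.D * S.D) (K k) S.b + S.D (K k) S.b / S.w S.b)) *
        S.ctrl lam mu S.b k φ i (Function.update K k S.b) +
      cf lam mu k i * (1 / √(S.w S.a) *
          (-(S.D * S.D) (K k) S.a - S.D (K k) S.a / S.w S.a)) *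
        S.ctrl lam mu S.a k φ i (Function.update K k S.a)) := by
  have ha := (Real.sqrt_pos.2 (S.w_pos S.a)).ne'
  have hb := (Real.sqrt_pos.2 (S.w_pos S.b)).ne'
  simp only [src_apply, ctrl_apply, Pi.neg_apply, Finset.sum_apply, Pi.smul_apply, Pi.add_apply,
    op_hk_apply, smul_eq_mul]
  rw [← Finset.sum_neg_distrib]
  refine Finset.sum_congr rfl fun k _ => ?_
  generalize op k S.D (op k S.D (φ i)) (Function.update K k S.b) = x
  generalize op k S.D (op k S.D (φ i)) (Function.update K k S.a) = y
  have e1 : 1 / √(S.w S.b) * √(S.w S.b) = 1 := one_div_mul_cancel hb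
  have e2 : 1 / √(S.w S.a) * √(S.w S.a) = 1 := one_div_mul_cancel ha
  linear_combination (cf lam mu k i ^ 2 * (-(S.D * S.D) (K k) S.b + S.D (K k) S.b / S.w S.b) * x) *
    e1 + (cf lam mu k i ^ 2 * (-(S.D * S.D) (K k) S.a - S.D (K k) S.a / S.w S.a) * y) * e2

end LGLData

/-- The second derivative of a Lagrange polynomial at the nodes. -/
theorem lglData_D_mul_D {N : ℕ} (hN : 2 ≤ N) {nd : Fin (N + 1) → ℝ} (hnd : IsLGL N nd)
    {Ψ : Fin (N + 1) → ℝ[X]} (hΨ : IsLagrange N nd Ψ) (m e : Fin (N + 1)) :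
    ((lglData hN hnd hΨ).D * (lglData hN hnd hΨ).D) m e =
      (derivative (derivative (Ψ e))).eval (nd m) := by
  have h : derivative (Ψ e) = ∑ k, C ((derivative (Ψ e)).eval (nd k)) * Ψ k :=
    hΨ.eq_sum hnd ((natDegree_derivative_le _).trans ((Nat.sub_le _ _).trans (hΨ e).1))
  rw [h, Matrix.mul_apply]
  simp only [derivative_sum, derivative_C_mul, eval_finsetSum, eval_mul, eval_C]
  exact Finset.sum_congr rfl fun k _ => mul_comm _ _

/-- The interpolant of `(1 + σ x) / 2` at the interior nodes vanishing at the end points, where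
`σ = ±1` is the end point carrying the value `1`. -/
theorem endPoly_spec {N : ℕ} (hN : 2 ≤ N) {nd : Fin (N + 1) → ℝ} (hnd : IsLGL N nd)
    {Ψ : Fin (N + 1) → ℝ[X]} (hΨ : IsLagrange N nd Ψ) (σ : ℝ) (e : Fin (N + 1)) :
    (C (1 / 2) * (1 + C σ * X) - Ψ e).natDegree ≤ N ∧
      (∀ k, (C (1 / 2) * (1 + C σ * X) - Ψ e).eval (nd k) =
        (1 + σ * nd k) / 2 - if k = e then 1 else 0) ∧
      ∀ m, (derivative (derivative (C (1 / 2) * (1 + C σ * X) - Ψ e))).eval (nd m) =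
        -((lglData hN hnd hΨ).D * (lglData hN hnd hΨ).D) m e := by
  refine ⟨?_, fun k => ?_, fun m => ?_⟩
  · refine (natDegree_sub_le _ _).trans (max_le ?_ (hΨ e).1)
    refine (natDegree_C_mul_le _ _).trans ((natDegree_add_le _ _).trans (max_le ?_ ?_))
    · simp
    · exact (natDegree_C_mul_le _ _).trans (natDegree_X_le.trans (by omega))
  · simp only [eval_sub, eval_mul, eval_C, eval_add, eval_one, eval_X, (hΨ e).2 k]
    ring
  · rw [lglData_D_mul_D hN hnd hΨ]
    simp

theorem integral_sum_add_sum {ι : Type*} [Fintype ι] {p q r : ι → ℝ → ℝ}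
    (hp : ∀ k, Continuous (p k)) (hq : ∀ k, Continuous (q k)) (hr : ∀ k, Continuous (r k))
    (a b : ℝ) : (∫ t in a..b, ∑ k, p k t) +
      ∑ k, ((∫ t in a..b, q k t) + ∫ t in a..b, r k t) =
      ∫ t in a..b, (∑ k, p k t + ∑ k, (q k t + r k t)) := by
  rw [intervalIntegral.integral_add
    ((continuous_finsetSum _ fun k _ => hp k).intervalIntegrable _ _)
    ((continuous_finsetSum _ fun k _ => (hq k).fun_add (hr k)).intervalIntegrable _ _),
    intervalIntegral.integral_finsetSum (f := fun k t => q k t + r k t)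
      fun k _ => ((hq k).add (hr k)).intervalIntegrable _ _]
  congr 1
  exact Finset.sum_congr rfl fun k _ => (intervalIntegral.integral_add
    ((hq k).intervalIntegrable _ _) ((hr k).intervalIntegrable _ _)).symm

theorem stmt13 (d : ℕ) (hd : 2 ≤ d) (T lam mu : ℝ) (hlam : 0 < lam) (hmu : 0 < mu) :
    ∃ C > (0 : ℝ), ∀ N : ℕ, 2 ≤ N →
    ∀ nd : Fin (N + 1) → ℝ, IsLGL N nd →
    ∀ Ψ : Fin (N + 1) → Polynomial ℝ, IsLagrange N nd Ψ →
    4 * Real.sqrt d * (2 + (N : ℝ)⁻¹) ^ d / Real.sqrt mu < T →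
    ∀ u0 u1 : Vec d → Fin d → ℝ,
      (∀ i, MemPolyDi d N fun x => u0 x i) → (∀ i, MemPolyDi d N fun x => u1 x i) →
    ∃ h1 h2 : Polynomial ℝ,
      (h1.natDegree ≤ N ∧ h1.eval (-1) = 0 ∧ h1.eval 1 = 0 ∧
        ∀ k : Fin (N + 1), k ≠ 0 → k ≠ Fin.last N →
          h1.eval (nd k) = (1 + nd k) / 2) ∧
      (h2.natDegree ≤ N ∧ h2.eval (-1) = 0 ∧ h2.eval 1 = 0 ∧
        ∀ k : Fin (N + 1), k ≠ 0 → k ≠ Fin.last N →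
          h2.eval (nd k) = (1 - nd k) / 2) ∧
    ∃ f : ℝ → Vec d → Fin d → ℝ, ∃ g : Fin d → Bool → ℝ → Vec d → Fin d → ℝ,
    ∃ u w : ℝ → Vec d → Fin d → ℝ,
      -- `f(t,·) ∈ P_N(Γ)` (restriction to `Γ` of a polynomial), measurable in time
      (∀ t i, MemPolyN d N fun x => f t x i) ∧
      (∀ x i, Measurable fun t => f t x i) ∧
      -- `g_j(t,·) ∈ P_N(Γ_j)`, measurable in time
      (∀ j b t i, MemPolyN d N fun x => g j b t x i) ∧
      (∀ j b x i, Measurable fun t => g j b t x i) ∧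
      -- `u ∈ C¹([0,T]; P_N(Ω)^d)`
      (∀ x i, ContDiff ℝ 1 fun t => u t x i) ∧
      (∀ t ∈ Set.Icc (0 : ℝ) T, ∀ i, MemPolyN d N fun x => u t x i) ∧
      -- `u_t` is absolutely continuous in `t`, with a.e. second derivative `w`
      (∀ x i, Measurable fun t => w t x i) ∧
      (∀ x i, IntervalIntegrable (fun s => w s x i) volume 0 T) ∧
      (∀ t ∈ Set.Icc (0 : ℝ) T, ∀ x i,
        tderiv u t x i = tderiv u 0 x i + ∫ s in (0 : ℝ)..t, w s x i) ∧
      -- the controlled collocation equations at interior nodes, for a.e. `t ∈ (0,T)`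
      (∀ᵐ t : ℝ, t ∈ Set.Ioo (0 : ℝ) T →
        ∀ k : Fin d → Fin (N + 1), nodeP nd k ∈ cubeO d → ∀ i,
          w t (nodeP nd k) i - elast lam mu (u t) (nodeP nd k) i =
            ∑ j : Fin d,
              ((mu + (mu + lam) * if i = j then 1 else 0) *
                  ((1 / Real.sqrt (lglW N Ψ (Fin.last N))) *
                    ((derivative (derivative h1)).eval (nodeP nd k j) +
                      (derivative (Ψ (Fin.last N))).eval (nodeP nd k j) /
                        lglW N Ψ (Fin.last N))) *
                  g j true t (Function.update (nodeP nd k) j 1) i +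
                (mu + (mu + lam) * if i = j then 1 else 0) *
                  ((1 / Real.sqrt (lglW N Ψ 0)) *
                    ((derivative (derivative h2)).eval (nodeP nd k j) -
                      (derivative (Ψ 0)).eval (nodeP nd k j) / lglW N Ψ 0)) *
                  g j false t (Function.update (nodeP nd k) j (-1)) i)) ∧
      -- boundary condition `u = f·χ_Γ` at boundary nodes
      (∀ t ∈ Set.Icc (0 : ℝ) T, ∀ k : Fin d → Fin (N + 1), nodeP nd k ∈ cubeB d → ∀ i,
        u t (nodeP nd k) i =
          if ∃ j : Fin d, nodeP nd k j = 1 then f t (nodeP nd k) i else 0) ∧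
      -- initial conditions at interior nodes
      (∀ k : Fin d → Fin (N + 1), nodeP nd k ∈ cubeO d → ∀ i,
        u 0 (nodeP nd k) i = u0 (nodeP nd k) i ∧
          tderiv u 0 (nodeP nd k) i = u1 (nodeP nd k) i) ∧
      -- null-controllability at time `T` at interior nodes
      (∀ k : Fin d → Fin (N + 1), nodeP nd k ∈ cubeO d → ∀ i,
        u T (nodeP nd k) i = 0 ∧ tderiv u T (nodeP nd k) i = 0) ∧
      -- the controls are square integrable on the boundary
      (∀ j : Fin d, IntervalIntegrable
        (fun t => faceInt d j 1 fun x => ∑ i, (f t x i) ^ 2) volume 0 T) ∧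
      (∀ j : Fin d, ∀ b : Bool, IntervalIntegrable
        (fun t => faceInt d j (if b then 1 else -1) fun x => ∑ i, (g j b t x i) ^ 2)
        volume 0 T) ∧
      -- uniform cost estimate
      (∫ t in (0 : ℝ)..T, ∑ j : Fin d,
          faceInt d j 1 fun x => ∑ i, (f t x i) ^ 2) +
        (∑ j : Fin d,
          ((∫ t in (0 : ℝ)..T, faceInt d j 1 fun x => ∑ i, (g j true t x i) ^ 2) +
            ∫ t in (0 : ℝ)..T, faceInt d j (-1) fun x => ∑ i, (g j false t x i) ^ 2)) ≤
        C * ((∫ x in cubeO d, ∑ i, (u0 x i) ^ 2) +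
          (sSup {r : ℝ | ∃ v : Vec d → Fin d → ℝ,
            (∀ i, ContDiff ℝ (⊤ : ℕ∞) fun x => v x i) ∧
            (∀ i, tsupport (fun x => v x i) ⊆ cubeO d) ∧
            (∫ x in cubeO d, ∑ i, ∑ j, (pd j (fun y => v y i) x) ^ 2) ≤ 1 ∧
            r = ∫ x in cubeO d, ∑ i, u1 x i * v x i}) ^ 2) := by
  have hd0 : 0 < d := by omega
  by_cases hT : 16 * √(d / mu) ≤ T
  swap
  · refine ⟨1, one_pos, fun N _ nd _ Ψ _ hT' => (hT ?_).elim⟩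
    refine le_trans ?_ hT'.le
    have h1 : (4 : ℝ) ≤ (2 + (N : ℝ)⁻¹) ^ d := by
      calc (4 : ℝ) = 2 ^ 2 := by norm_num
        _ ≤ 2 ^ d := pow_le_pow_right₀ (by norm_num) hd
        _ ≤ _ := pow_le_pow_left₀ (by norm_num) (by simp) d
    rw [Real.sqrt_div' _ hmu.le, ← mul_div_assoc]
    refine div_le_div_of_nonneg_right ?_ (Real.sqrt_nonneg _)
    calc 16 * √(d : ℝ) = 4 * √(d : ℝ) * 4 := by ring
      _ ≤ _ := by gcongr
  have hT0 : 0 < T := by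
    have : 0 < √((d : ℝ) / mu) := Real.sqrt_pos.2 (by positivity)
    linarith
  obtain ⟨Co, hCo, hobs⟩ := exists_uniform_observable hd0 hlam hmu hT
  refine ⟨2 * (30 * 8 ^ (d - 1) / mu + 3 ^ d) * Co, by positivity, ?_⟩
  intro N hN nd hnd Ψ hΨ _ u0 u1 hu0 hu1
  obtain ⟨hd1, he1, hdd1⟩ := endPoly_spec hN hnd hΨ 1 (Fin.last N)
  obtain ⟨hd2, he2, hdd2⟩ := endPoly_spec hN hnd hΨ (-1) 0
  have hlast : nd (Fin.last N) = 1 := hnd.2.2.1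
  have hzero : nd 0 = -1 := hnd.2.1
  have hne : (0 : Fin (N + 1)) ≠ Fin.last N := zero_ne_last' hN
  refine ⟨C (1 / 2) * (1 + C 1 * X) - Ψ (Fin.last N), C (1 / 2) * (1 + C (-1) * X) - Ψ 0,
    ⟨hd1, ?_, ?_, fun k _ hk => ?_⟩, ⟨hd2, ?_, ?_, fun k hk _ => ?_⟩, ?_⟩
  · rw [← hzero, he1, hzero, if_neg hne]; norm_num
  · have := he1 (Fin.last N)
    rw [hlast] at this
    rw [this, if_pos rfl]; norm_num
  · rw [he1, if_neg hk]; ring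
  · have := he2 0
    rw [hzero] at this
    rw [this, if_pos rfl]; norm_num
  · have := he2 (Fin.last N)
    rw [hlast] at this
    rw [this, if_neg hne.symm]; norm_num
  · rw [he2, if_neg hk]; ring
  have hobs := hobs N hN nd hnd Ψ hΨ
  set S := lglData hN hnd hΨ with hS
  let a0 : S.diS d := ⟨fun i K => u0 (nodeP nd K) i, di_of_memPolyDi hN hnd hΨ hu0⟩
  let a1 : S.diS d := ⟨fun i K => u1 (nodeP nd K) i, di_of_memPolyDi hN hnd hΨ hu1⟩
  have hu0' : ∀ x i, interp Ψ (a0.1 i) x = u0 x i := fun x i =>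
    (congrFun ((hu0 i).1.eq_interp hnd hΨ) x).symm
  have hu1' : ∀ x i, interp Ψ (a1.1 i) x = u1 x i := fun x i =>
    (congrFun ((hu1 i).1.eq_interp hnd hΨ) x).symm
  have hX := sq_ipV_sub_le hlam hmu hN hnd hΨ a0 a1
  simp only [hu0', hu1'] at hX
  have hI : 0 ≤ ∫ x in cubeO d, ∑ i, u0 x i ^ 2 :=
    integral_nonneg fun x => Finset.sum_nonneg fun i _ => sq_nonneg _
  obtain ⟨φ, χ, U, W, hwave, hU, hW, hU0, hW0, hUT, hWT, hcost⟩ :=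
    S.exists_control hd0 hlam hmu hT0 hCo.le hobs (by positivity) a0 a1 hX
  have hφc : Continuous φ := hwave.continuous.1
  have hUc : Continuous U := continuous_iff_continuousAt.2 fun t => (hU t).continuousAt
  have hWc : Continuous W := continuous_iff_continuousAt.2 fun t => (hW t).continuousAt
  let L : Vec d → Fin d → S.diS d →ₗ[ℝ] ℝ := fun x i => interpL Ψ x i ∘ₗ (S.diS d).subtype
  let R : Vec d → Fin d → S.diS d →ₗ[ℝ] ℝ := fun x i =>
    interpL Ψ x i ∘ₗ S.lift lam mu ∘ₗ (S.diS d).subtype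
  let e : Bool → Fin (N + 1) := fun b => if b then S.b else S.a
  let Q : Fin d → Bool → Vec d → Fin d → S.diS d →ₗ[ℝ] ℝ := fun k b x i =>
    interpL Ψ x i ∘ₗ S.ctrl lam mu (e b) k ∘ₗ (S.diS d).subtype
  have hcL : ∀ M : S.diS d →ₗ[ℝ] ℝ, Continuous M := fun M => M.continuous_of_finiteDimensional
  have hcK : Continuous (S.Kop (d := d) lam mu) := LinearMap.continuous_of_finiteDimensional _
  have hcB : Continuous (S.Bop (d := d) lam mu) := LinearMap.continuous_of_finiteDimensional _
  let u : ℝ → Vec d → Fin d → ℝ := fun t x i => L x i (U t) + R x i (φ t)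
  let v : ℝ → Vec d → Fin d → ℝ := fun t x i => L x i (W t) + R x i (χ t)
  let w : ℝ → Vec d → Fin d → ℝ := fun t x i =>
    L x i (S.Kop lam mu (U t) + S.Bop lam mu (φ t)) + R x i (S.Kop lam mu (φ t))
  have hu : ∀ t x i, HasDerivAt (fun s => u s x i) (v t x i) t := fun t x i =>
    ((hU t).linearMap_comp (L x i)).add ((hwave.1 t).linearMap_comp (R x i))
  have hv : ∀ t x i, HasDerivAt (fun s => v s x i) (w t x i) t := fun t x i =>
    ((hW t).linearMap_comp (L x i)).add ((hwave.2 t).linearMap_comp (R x i))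
  have hwc : ∀ x i, Continuous fun t => w t x i := fun x i =>
    ((hcL _).comp ((hcK.comp hUc).add (hcB.comp hφc))).add ((hcL _).comp (hcK.comp hφc))
  have hvc : ∀ x i, Continuous fun t => v t x i := fun x i =>
    continuous_iff_continuousAt.2 fun t => (hv t x i).continuousAt
  have hud : tderiv u = v := by
    funext t x i; exact (hu t x i).deriv
  have hu_interp : ∀ t, u t = fun x i => interp Ψ (((U t).1 + S.lift lam mu (φ t).1) i) x := by
    intro t; funext x i
    exact (congrFun (interp_add Ψ ((U t).1 i) (S.lift lam mu (φ t).1 i)) x).symm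
  have hLn : ∀ (z : S.diS d) K i, L (nodeP nd K) i z = z.1 i K := fun z K i =>
    interp_nodeP hΨ _ _
  have hRn : ∀ (z : S.diS d) K i, R (nodeP nd K) i z = S.lift lam mu z.1 i K := fun z K i =>
    interp_nodeP hΨ _ _
  have hin : ∀ K : Fin d → Fin (N + 1), nodeP nd K ∈ cubeO d → ∀ j, ¬ S.IsEnd (K j) :=
    fun K => (nodeP_mem_cubeO hN hnd hΨ K).1
  have hRin : ∀ (z : S.diS d) K i, nodeP nd K ∈ cubeO d → R (nodeP nd K) i z = 0 :=
    fun z K i hK => (hRn z K i).trans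
      (S.lift_eq_zero z.1 i fun j hj => hin K hK j (Or.inr hj))
  have hlift : Continuous (S.lift (d := d) lam mu) := LinearMap.continuous_of_finiteDimensional _
  have hctrl : ∀ c k, Continuous (S.ctrl (d := d) lam mu c k) := fun c k =>
    LinearMap.continuous_of_finiteDimensional _
  have hφc' : Continuous fun t => (φ t).1 := continuous_subtype_val.comp hφc
  have hfc : ∀ k c, Continuous fun t => faceInt d k c fun x => ∑ i, R x i (φ t) ^ 2 :=
    fun k c => continuous_faceInt_interp Ψ k c (hlift.comp hφc')
  have hgc : ∀ k b c, Continuous fun t => faceInt d k c fun x => ∑ i, Q k b x i (φ t) ^ 2 :=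
    fun k b c => continuous_faceInt_interp Ψ k c ((hctrl (e b) k).comp hφc')
  refine ⟨fun t x i => R x i (φ t), fun k b t x i => Q k b x i (φ t), u, w,
    fun t i => interp_memPolyN hΨ _, fun x i => ((hcL _).comp hφc).measurable,
    fun k b t i => interp_memPolyN hΨ _, fun k b x i => ((hcL _).comp hφc).measurable,
    fun x i => ?_, fun t _ i => ?_, fun x i => (hwc x i).measurable,
    fun x i => (hwc x i).intervalIntegrable _ _, fun t _ x i => ?_,
    Filter.Eventually.of_forall fun t _ K hK i => ?_, fun t _ K hK i => ?_, fun K hK i => ?_,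
    fun K hK i => ?_, fun k => (hfc k 1).intervalIntegrable _ _,
    fun k b => (hgc k b _).intervalIntegrable _ _, ?_⟩
  · rw [contDiff_one_iff_deriv]
    refine ⟨fun t => (hu t x i).differentiableAt, ?_⟩
    rw [show deriv (fun t => u t x i) = fun t => v t x i from funext fun t => (hu t x i).deriv]
    exact hvc x i
  · rw [hu_interp]
    exact interp_memPolyN hΨ _
  · rw [hud, intervalIntegral.integral_eq_sub_of_hasDerivAt (fun s _ => hv s x i)
      ((hwc x i).intervalIntegrable _ _)]
    ring
  · rw [hu_interp, elast_interp hN hnd hΨ]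
    have hinn : ∀ F : (Fin d → Fin (N + 1)) → ℝ, S.inn F K = F K := fun F => by
      rw [LGLData.inn_apply, if_pos (hin K hK)]
    have hw' : w t (nodeP nd K) i = S.el lam mu (U t).1 i K +
        (S.el lam mu (S.lift lam mu (φ t).1) i K + S.src lam mu (φ t).1 i K) := by
      change L _ _ _ + R _ _ _ = _
      rw [hRin _ _ _ hK, hLn, add_zero]
      change S.inn _ K + S.inn _ K = _
      rw [hinn, hinn]
      rfl
    rw [hw', LGLData.el_add, Pi.add_apply, add_sub_add_left_eq_sub, add_sub_cancel_left,
      S.src_eq_controls]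
    refine Finset.sum_congr rfl fun k _ => ?_
    have h1 : Q k true (Function.update (nodeP nd K) k 1) i (φ t) =
        S.ctrl lam mu S.b k (φ t).1 i (Function.update K k S.b) := by
      rw [← hlast, update_nodeP]
      exact interp_nodeP hΨ _ _
    have h2 : Q k false (Function.update (nodeP nd K) k (-1)) i (φ t) =
        S.ctrl lam mu S.a k (φ t).1 i (Function.update K k S.a) := by
      rw [← hzero, update_nodeP]
      exact interp_nodeP hΨ _ _
    beta_reduce
    rw [show nodeP nd K k = nd (K k) from rfl, hdd1, hdd2, h1, h2, LGLData.cf, add_comm lam mu]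
    rfl
  · obtain ⟨k, hk⟩ := (nodeP_mem_cubeB hN hnd hΨ K).1 hK
    change L _ _ _ + R _ _ _ = _
    rw [hLn, (U t).2 i k K hk, zero_add]
    split_ifs with hj
    · rfl
    · rw [hRn]
      refine S.lift_eq_zero _ i fun j h => hj ⟨j, ?_⟩
      change nd (K j) = 1
      rw [h]
      exact hlast
  · rw [hud]
    refine ⟨?_, ?_⟩
    · change L _ _ _ + R _ _ _ = _
      rw [hRin _ _ _ hK, hLn, hU0, add_zero]
    · change L _ _ _ + R _ _ _ = _
      rw [hRin _ _ _ hK, hLn, hW0, add_zero]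
  · rw [hud]
    refine ⟨?_, ?_⟩
    · change L _ _ _ + R _ _ _ = _
      rw [hRin _ _ _ hK, hLn, hUT, add_zero]
      rfl
    · change L _ _ _ + R _ _ _ = _
      rw [hRin _ _ _ hK, hLn, hWT, add_zero]
      rfl
  · have hobsc : Continuous fun t => S.obs lam mu (φ t).1 (φ t).1 := by
      have : ∀ t, S.obs lam mu (φ t).1 (φ t).1 = S.ipV (S.Bop lam mu (φ t)) (φ t) := fun t =>
        (S.obsV_apply lam mu (φ t) (φ t)).symm
      simp only [this, LGLData.ipV_apply, LGLData.ip, gip_apply]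
      have h1 := continuous_subtype_val.comp (hcB.comp hφc)
      exact continuous_finsetSum _ fun i _ => continuous_finsetSum _ fun K _ =>
        continuous_const.mul (((continuous_apply K).comp ((continuous_apply i).comp h1)).mul
          ((continuous_apply K).comp ((continuous_apply i).comp hφc')))
    refine le_of_eq_of_le (integral_sum_add_sum (fun k => hfc k 1) (fun k => hgc k true 1)
      (fun k => hgc k false (-1)) 0 T) ?_
    refine (intervalIntegral.integral_mono_on hT0.le
      (Continuous.intervalIntegrable ((continuous_finsetSum _ fun k _ => hfc k 1).add
        (continuous_finsetSum _ fun k _ => (hgc k true 1).add (hgc k false (-1)))) _ _)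
      (hobsc.intervalIntegrable _ _) fun t _ => ?_).trans
      (hcost.trans (le_of_eq ?_))
    · rw [S.obs_eq_controls]
      have hb := fun (k : Fin d) F => faceInt_sum_interp_le (d := d) hN hnd hΨ k (Fin.last N) F
      have ha := fun (k : Fin d) F => faceInt_sum_interp_le (d := d) hN hnd hΨ k 0 F
      simp only [hlast, hzero] at ha hb
      exact add_le_add (Finset.sum_le_sum fun k _ => hb k (S.lift lam mu (φ t).1))
        (Finset.sum_le_sum fun k _ => add_le_add (hb k (S.ctrl lam mu S.b k (φ t).1))
          (ha k (S.ctrl lam mu S.a k (φ t).1)))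
    · rw [dualValues]
      ring

end
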